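/- Assume the Riemann hypothesis: every nontrivial zero of the Riemann zeta function ζ(s) has real part 1/2. Assume moreover that all nontrivial zeros of ζ are simple and that there exists θ with 1 ≤ θ < 3 − √3 such that J_{−1}(T) := ∑_{0<γ≤T} |ζ′(1/2+iγ)|^{−2} ≪ T^θ. Then lim_{Y→∞} (1/Y)∫_0^Y (L(e^y)/e^{y/2})² dy = 1/ζ(1/2)² + ∑_{γ>0, ζ(1/2+iγ)=0} 2 |ζ(2ρ)/(ρ ζ′(ρ))|², where L(x) = ∑_{n≤x} λ(n) with λ the Liouville function and the sum runs over the nontrivial zeros ρ = 1/2 + iγ of ζ with γ > 0. -/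

import Mathlib

open MeasureTheory Filter Topology

/-- The Liouville function `λ(n) = (-1)^{Ω(n)}`. -/
noncomputable def liouville (n : ℕ) : ℝ := (-1) ^ (ArithmeticFunction.cardFactors n)

/-- `L(x) = ∑_{n ≤ x} λ(n)`, the summatory function of the Liouville function. -/
noncomputable def Lfun (x : ℝ) : ℝ :=
  ∑ n ∈ Finset.Icc 1 ⌊x⌋₊, liouville n

/-- The integral of `f` along the boundary of the rectangle with opposite corners `z` and `w`. -/
noncomputable def rectIntegral (f : ℂ → ℂ) (z w : ℂ) : ℂ :=
  (∫ x : ℝ in z.re..w.re, f (x + z.im * Complex.I)) -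
    (∫ x : ℝ in z.re..w.re, f (x + w.im * Complex.I)) +
    Complex.I • (∫ y : ℝ in z.im..w.im, f (w.re + y * Complex.I)) -
    Complex.I • ∫ y : ℝ in z.im..w.im, f (z.re + y * Complex.I)

lemma Complex.log_I_mul_of_re_pos {w : ℂ} (hw : 0 < w.re) :
    Complex.log (Complex.I * w) = Complex.log w + Real.pi / 2 * Complex.I := by
  have h0 : w ≠ 0 := by rintro rfl; simp at hw
  have h := Complex.abs_arg_lt_pi_div_two_iff.2 (Or.inl hw)
  rw [abs_lt] at h
  have hp := Real.pi_pos
  rw [Complex.log_mul Complex.I_ne_zero h0 (by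
    rw [Complex.arg_I]; constructor <;> linarith), Complex.log_I]
  ring

lemma Complex.log_neg_I_mul_of_re_pos {w : ℂ} (hw : 0 < w.re) :
    Complex.log (-Complex.I * w) = Complex.log w - Real.pi / 2 * Complex.I := by
  have h0 : w ≠ 0 := by rintro rfl; simp at hw
  have h := Complex.abs_arg_lt_pi_div_two_iff.2 (Or.inl hw)
  rw [abs_lt] at h
  have hp := Real.pi_pos
  rw [Complex.log_mul (neg_ne_zero.2 Complex.I_ne_zero) h0 (by
    rw [Complex.arg_neg_I]; constructor <;> linarith), Complex.log_neg_I]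
  ring

lemma integral_inv_add_mul_eq_log_sub {z v k : ℂ} {a b : ℝ} (hk : k ≠ 0)
    (h : ∀ x : ℝ, 0 < (k * (x * v + z)).re) :
    v * ∫ x : ℝ in a..b, (x * v + z)⁻¹ = Complex.log (k * (b * v + z)) - Complex.log (k * (a * v + z)) := by
  have hne : ∀ x : ℝ, (x * v + z) ≠ 0 := fun x hx => by
    have := h x; simp [hx] at this
  rw [← intervalIntegral.integral_const_mul]
  refine intervalIntegral.integral_eq_sub_of_hasDerivAt
    (f := fun x : ℝ => Complex.log (k * (x * v + z))) (fun x _ => ?_) ?_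
  · have h1 : HasDerivAt (fun y : ℝ => k * ((y : ℂ) * v + z)) (k * v) x := by
      have := ((Complex.ofRealCLM.hasDerivAt (x := x)).mul_const v).add_const z |>.const_mul k
      simpa using this
    have h2 := h1.clog_real (Or.inl (h x))
    have h3 : v * (x * v + z)⁻¹ = k * v / (k * (x * v + z)) := by
      rw [mul_div_mul_left _ _ hk, div_eq_mul_inv]
    rw [h3]
    exact h2
  · apply Continuous.intervalIntegrable
    exact continuous_const.mul (Continuous.inv₀ (by fun_prop) hne)

lemma rectIntegral_inv_sub {z w p : ℂ} (h1 : z.re < p.re) (h2 : p.re < w.re)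
    (h3 : z.im < p.im) (h4 : p.im < w.im) :
    rectIntegral (fun s => (s - p)⁻¹) z w = 2 * Real.pi * Complex.I := by
  unfold rectIntegral
  have e1 := integral_inv_add_mul_eq_log_sub (z := z.im * Complex.I - p) (v := 1) (k := Complex.I)
    (a := z.re) (b := w.re) Complex.I_ne_zero (fun x => by simp; linarith)
  have e2 := integral_inv_add_mul_eq_log_sub (z := w.im * Complex.I - p) (v := 1) (k := -Complex.I)
    (a := z.re) (b := w.re) (neg_ne_zero.2 Complex.I_ne_zero) (fun x => by simp; linarith)
  have e3 := integral_inv_add_mul_eq_log_sub (z := w.re - p) (v := Complex.I) (k := 1)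
    (a := z.im) (b := w.im) one_ne_zero (fun x => by simp; linarith)
  have e4 := integral_inv_add_mul_eq_log_sub (z := z.re - p) (v := Complex.I) (k := -1)
    (a := z.im) (b := w.im) (by simp) (fun x => by simp; linarith)
  have c1 : ∀ u : ℝ, ∫ x : ℝ in z.re..w.re, ((x : ℂ) + u * Complex.I - p)⁻¹ =
    ∫ x : ℝ in z.re..w.re, ((x : ℂ) * 1 + (u * Complex.I - p))⁻¹ := fun u => by
      congr 1; ext x; congr 1; ring
  have c2 : ∀ u : ℝ, ∫ x : ℝ in z.im..w.im, ((u : ℂ) + x * Complex.I - p)⁻¹ =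
    ∫ x : ℝ in z.im..w.im, ((x : ℂ) * Complex.I + (u - p))⁻¹ := fun u => by
      congr 1; ext x; congr 1; ring
  rw [one_mul] at e1 e2
  rw [c1, c1, c2, c2, e1, e2, smul_eq_mul, smul_eq_mul, e3, e4]
  have k1 := Complex.log_I_mul_of_re_pos (w := w.re * 1 + (z.im * Complex.I - p)) (by simp; linarith)
  have k2 := Complex.log_neg_I_mul_of_re_pos (w := w.re * 1 + (w.im * Complex.I - p)) (by simp; linarith)
  have k3 := Complex.log_neg_I_mul_of_re_pos (w := -(z.re * 1 + (z.im * Complex.I - p))) (by simp; linarith)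
  have k4 := Complex.log_I_mul_of_re_pos (w := -(z.re * 1 + (w.im * Complex.I - p))) (by simp; linarith)
  rw [neg_mul_neg] at k3
  rw [mul_neg, ← neg_mul] at k4
  rw [k1, k2, k3, k4]
  have q1 : (w.im * Complex.I + (w.re - p)) = (w.re * 1 + (w.im * Complex.I - p)) := by ring
  have q2 : (z.im * Complex.I + (w.re - p)) = (w.re * 1 + (z.im * Complex.I - p)) := by ring
  have q3 : (w.im * Complex.I + (z.re - p)) = (z.re * 1 + (w.im * Complex.I - p)) := by ring
  have q4 : (z.im * Complex.I + (z.re - p)) = (z.re * 1 + (z.im * Complex.I - p)) := by ring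
  rw [q1, q2, q3, q4, one_mul, one_mul, neg_one_mul, neg_one_mul]
  ring

/-- The boundary of the rectangle with opposite corners `z` and `w`. -/
def rectBoundary (z w : ℂ) : Set ℂ :=
  {s | (s.re ∈ Set.Icc z.re w.re ∧ (s.im = z.im ∨ s.im = w.im)) ∨
    (s.im ∈ Set.Icc z.im w.im ∧ (s.re = z.re ∨ s.re = w.re))}

lemma rectIntegral_congr {f g : ℂ → ℂ} {z w : ℂ} (h1 : z.re ≤ w.re) (h2 : z.im ≤ w.im)
    (h : ∀ s ∈ rectBoundary z w, f s = g s) : rectIntegral f z w = rectIntegral g z w := by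
  unfold rectIntegral
  congr 1; congr 1; congr 1
  · exact intervalIntegral.integral_congr fun x hx => h _ (by
      rw [Set.uIcc_of_le h1] at hx; left; simpa using hx)
  · exact intervalIntegral.integral_congr fun x hx => h _ (by
      rw [Set.uIcc_of_le h1] at hx; left; simpa using hx)
  · congr 1
    exact intervalIntegral.integral_congr fun x hx => h _ (by
      rw [Set.uIcc_of_le h2] at hx; right; simpa using hx)
  · congr 1
    exact intervalIntegral.integral_congr fun x hx => h _ (by
      rw [Set.uIcc_of_le h2] at hx; right; simpa using hx)

lemma rectIntegral_add {f g : ℂ → ℂ} {z w : ℂ} (h1 : z.re ≤ w.re) (h2 : z.im ≤ w.im)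
    (hf : ContinuousOn f (rectBoundary z w)) (hg : ContinuousOn g (rectBoundary z w)) :
    rectIntegral (fun s => f s + g s) z w = rectIntegral f z w + rectIntegral g z w := by
  have hor : ∀ (F : ℂ → ℂ) (u : ℝ), u = z.im ∨ u = w.im → ContinuousOn F (rectBoundary z w) →
      IntervalIntegrable (fun x : ℝ => F (x + u * Complex.I)) volume z.re w.re := by
    intro F u hu hF
    apply ContinuousOn.intervalIntegrable
    refine hF.comp (by fun_prop) fun x hx => ?_
    rw [Set.uIcc_of_le h1] at hx
    left; simpa using ⟨hx, hu⟩
  have ver : ∀ (F : ℂ → ℂ) (u : ℝ), u = z.re ∨ u = w.re → ContinuousOn F (rectBoundary z w) →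
      IntervalIntegrable (fun x : ℝ => F (u + x * Complex.I)) volume z.im w.im := by
    intro F u hu hF
    apply ContinuousOn.intervalIntegrable
    refine hF.comp (by fun_prop) fun x hx => ?_
    rw [Set.uIcc_of_le h2] at hx
    right; simpa using ⟨hx, hu⟩
  unfold rectIntegral
  rw [intervalIntegral.integral_add (hor f _ (.inl rfl) hf) (hor g _ (.inl rfl) hg),
    intervalIntegral.integral_add (hor f _ (.inr rfl) hf) (hor g _ (.inr rfl) hg),
    intervalIntegral.integral_add (ver f _ (.inr rfl) hf) (ver g _ (.inr rfl) hg),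
    intervalIntegral.integral_add (ver f _ (.inl rfl) hf) (ver g _ (.inl rfl) hg)]
  simp only [smul_eq_mul]; ring

lemma rectIntegral_const_mul (c : ℂ) (f : ℂ → ℂ) (z w : ℂ) :
    rectIntegral (fun s => c * f s) z w = c * rectIntegral f z w := by
  unfold rectIntegral
  simp only [intervalIntegral.integral_const_mul, smul_eq_mul]; ring

/-- The residue theorem on a rectangle for functions with finitely many simple poles. -/
theorem rectIntegral_eq_sum_residues {z w : ℂ} (h1 : z.re < w.re) (h2 : z.im < w.im)
    (P : Finset ℂ) (r : ℂ → ℂ) :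
    ∀ f : ℂ → ℂ, (∀ p ∈ P, z.re < p.re ∧ p.re < w.re ∧ z.im < p.im ∧ p.im < w.im) →
    (∀ s : ℂ, s.re ∈ Set.Icc z.re w.re → s.im ∈ Set.Icc z.im w.im → s ∉ P →
      DifferentiableAt ℂ f s) →
    (∀ p ∈ P, Tendsto (fun s => (s - p) * f s) (𝓝[≠] p) (𝓝 (r p))) →
    rectIntegral f z w = 2 * Real.pi * Complex.I * ∑ p ∈ P, r p := by
  classical
  induction P using Finset.induction_on with
  | empty =>
    intro f _ hd _
    simp only [Finset.sum_empty, mul_zero]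
    refine Complex.integral_boundary_rect_eq_zero_of_differentiableOn f z w fun s hs => ?_
    rw [Set.uIcc_of_le h1.le, Set.uIcc_of_le h2.le, Complex.mem_reProdIm] at hs
    exact (hd s hs.1 hs.2 (by simp)).differentiableWithinAt
  | insert p P hp ih =>
    intro f hP hd hr
    set g : ℂ → ℂ := fun s => f s - r p * (s - p)⁻¹ with hg
    set g1 := Function.update g p (limUnder (𝓝[≠] p) g) with hg1
    have hev : ∀ s, s ≠ p → g1 =ᶠ[𝓝 s] g := fun s hs => by
      filter_upwards [isOpen_ne.mem_nhds hs] with t ht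
      rw [hg1, Function.update_of_ne ht]
    have hpin := hP p (Finset.mem_insert_self _ _)
    have hgd : ∀ s, s ≠ p → DifferentiableAt ℂ f s → DifferentiableAt ℂ g s := fun s hs h =>
      h.sub (((differentiableAt_id.sub_const p).inv (sub_ne_zero.2 hs)).const_mul _)
    have hU : {s : ℂ | z.re < s.re ∧ s.re < w.re ∧ z.im < s.im ∧ s.im < w.im ∧ s ∉ P} ∈ 𝓝 p := by
      have hPc : IsClosed (P : Set ℂ) := P.finite_toSet.isClosed
      filter_upwards [(isOpen_lt continuous_const Complex.continuous_re).mem_nhds hpin.1,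
        (isOpen_lt Complex.continuous_re continuous_const).mem_nhds hpin.2.1,
        (isOpen_lt continuous_const Complex.continuous_im).mem_nhds hpin.2.2.1,
        (isOpen_lt Complex.continuous_im continuous_const).mem_nhds hpin.2.2.2,
        hPc.isOpen_compl.mem_nhds (by simpa using hp : p ∈ (P : Set ℂ)ᶜ)] with s a1 a2 a3 a4 a5
      exact ⟨a1, a2, a3, a4, by simpa using a5⟩
    have hg1p : DifferentiableAt ℂ g1 p := by
      refine (Complex.differentiableOn_update_limUnder_of_isLittleO hU (f := g) ?_ ?_).differentiableAt hU
      · rintro s ⟨⟨a1, a2, a3, a4, a5⟩, hs⟩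
        refine (hgd s hs (hd s ⟨a1.le, a2.le⟩ ⟨a3.le, a4.le⟩ ?_)).differentiableWithinAt
        simp only [Finset.mem_insert, not_or]; exact ⟨hs, a5⟩
      · have ht : Tendsto (fun s => (s - p) * (g s - g p)) (𝓝[≠] p) (𝓝 0) := by
          have t1 := (hr p (Finset.mem_insert_self _ _)).sub_const (r p)
          rw [sub_self] at t1
          have t2 : Tendsto (fun s : ℂ => (s - p) * g p) (𝓝[≠] p) (𝓝 0) := by
            have : Tendsto (fun s : ℂ => (s - p) * g p) (𝓝 p) (𝓝 ((p - p) * g p)) :=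
              (Continuous.tendsto (by fun_prop) p)
            simp only [sub_self, zero_mul] at this
            exact this.mono_left nhdsWithin_le_nhds
          have t3 := t1.sub t2
          rw [sub_zero] at t3
          refine t3.congr' ?_
          filter_upwards [self_mem_nhdsWithin] with s hs
          have : s - p ≠ 0 := sub_ne_zero.2 hs
          simp only [hg]; field_simp
        rw [Asymptotics.isLittleO_iff_tendsto']
        · refine ht.congr fun s => ?_
          rw [div_inv_eq_mul, mul_comm]
        · filter_upwards [self_mem_nhdsWithin] with s hs h0
          exact absurd (inv_eq_zero.1 h0) (sub_ne_zero.2 hs)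
    have key := ih g1 (fun q hq => hP q (Finset.mem_insert_of_mem hq)) (fun s a b c => by
      by_cases hs : s = p
      · rw [hs]; exact hg1p
      · refine (hev s hs).differentiableAt_iff.2 (hgd s hs (hd s a b ?_))
        simp only [Finset.mem_insert, not_or]; exact ⟨hs, c⟩) (fun q hq => by
      have hqp : q ≠ p := fun h => hp (h ▸ hq)
      have t1 := hr q (Finset.mem_insert_of_mem hq)
      have t2 : Tendsto (fun s : ℂ => (s - q) * (r p * (s - p)⁻¹)) (𝓝[≠] q) (𝓝 0) := by
        have : ContinuousAt (fun s : ℂ => (s - q) * (r p * (s - p)⁻¹)) q :=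
          (continuousAt_id.sub continuousAt_const).mul
            (continuousAt_const.mul ((continuousAt_id.sub continuousAt_const).inv₀ (sub_ne_zero.2 hqp)))
        have h' := this.tendsto
        simp only [sub_self, zero_mul] at h'
        exact h'.mono_left nhdsWithin_le_nhds
      have t3 := t1.sub t2
      rw [sub_zero] at t3
      refine t3.congr' ?_
      filter_upwards [nhdsWithin_le_nhds (hev q hqp)] with s hs
      rw [hs]; simp only [hg]; ring)
    have hb : ∀ s ∈ rectBoundary z w, s.re ∈ Set.Icc z.re w.re ∧ s.im ∈ Set.Icc z.im w.im ∧
        ∀ q ∈ insert p P, s ≠ q := by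
      rintro s (⟨ha, hb⟩ | ⟨ha, hb⟩)
      · refine ⟨ha, by rcases hb with h | h <;> rw [h] <;> simp [h2.le], fun q hq hsq => ?_⟩
        have := hP q hq; rw [← hsq] at this
        rcases hb with h | h <;> rw [h] at this <;> simp at this
      · refine ⟨by rcases hb with h | h <;> rw [h] <;> simp [h1.le], ha, fun q hq hsq => ?_⟩
        have := hP q hq; rw [← hsq] at this
        rcases hb with h | h <;> rw [h] at this <;> simp at this
    have hfd : ∀ s ∈ rectBoundary z w, DifferentiableAt ℂ f s := fun s hs =>
      hd s (hb s hs).1 (hb s hs).2.1 fun h => (hb s hs).2.2 s h rfl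
    have hne : ∀ s ∈ rectBoundary z w, s ≠ p := fun s hs => (hb s hs).2.2 p (by simp)
    have e1 : rectIntegral f z w = rectIntegral (fun s => g1 s + r p * (s - p)⁻¹) z w := by
      refine rectIntegral_congr h1.le h2.le fun s hs => ?_
      rw [(hev s (hne s hs)).eq_of_nhds]; simp [hg]
    rw [e1, rectIntegral_add h1.le h2.le, rectIntegral_const_mul, key,
      rectIntegral_inv_sub hpin.1 hpin.2.1 hpin.2.2.1 hpin.2.2.2, Finset.sum_insert hp]
    · ring
    · intro s hs
      exact (((hev s (hne s hs)).differentiableAt_iff).2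
        (hgd s (hne s hs) (hfd s hs))).continuousAt.continuousWithinAt
    · intro s hs
      exact (continuousAt_const.mul ((continuousAt_id.sub continuousAt_const).inv₀
        (sub_ne_zero.2 (hne s hs)))).continuousWithinAt

lemma exists_eq_prod_sub_mul {f : ℂ → ℂ} (hf : Differentiable ℂ f) (P : Finset ℂ)
    (hP : ∀ p ∈ P, f p = 0) :
    ∃ g : ℂ → ℂ, Differentiable ℂ g ∧ ∀ s, f s = (∏ p ∈ P, (s - p)) * g s := by
  classical
  induction P using Finset.induction_on generalizing f with
  | empty => exact ⟨f, hf, fun s => by simp⟩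
  | insert p P hp ih =>
    have hd : Differentiable ℂ (dslope f p) := by
      rw [← differentiableOn_univ, Complex.differentiableOn_dslope univ_mem]
      exact hf.differentiableOn
    obtain ⟨g, hg, hfg⟩ := ih hd fun q hq => by
      have hqp : q ≠ p := fun h => hp (h ▸ hq)
      rw [dslope_of_ne _ hqp, slope_def_field, hP q (by simp [hq]), hP p (by simp)]
      simp
    refine ⟨g, hg, fun s => ?_⟩
    have h := sub_smul_dslope f p s
    rw [hP p (by simp), sub_zero, smul_eq_mul, hfg] at h
    rw [← h, Finset.prod_insert hp, mul_assoc]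

/-- Dividing out finitely many zeros by Blaschke factors. -/
lemma exists_blaschke_quotient {f : ℂ → ℂ} (hf : Differentiable ℂ f) {R M : ℝ} (hR : 0 < R)
    (hM : ∀ s, ‖s‖ ≤ R → ‖f s‖ ≤ M) (P : Finset ℂ) (hP : ∀ p ∈ P, f p = 0 ∧ ‖p‖ < R) :
    ∃ g G : ℂ → ℂ, Differentiable ℂ g ∧ Differentiable ℂ G ∧
      (∀ s, f s = (∏ p ∈ P, (s - p)) * g s) ∧
      (∀ s, G s = (∏ p ∈ P, ((R : ℂ) ^ 2 - starRingEnd ℂ p * s) / R) * g s) ∧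
      ∀ s, ‖s‖ ≤ R → ‖G s‖ ≤ M := by
  obtain ⟨g, hg, hfg⟩ := exists_eq_prod_sub_mul hf P fun p hp => (hP p hp).1
  have hG : Differentiable ℂ fun s => (∏ p ∈ P, ((R : ℂ) ^ 2 - starRingEnd ℂ p * s) / R) * g s := by
    refine Differentiable.mul ?_ hg
    exact Differentiable.fun_finsetProd fun p _ => by fun_prop
  refine ⟨g, _, hg, hG, hfg, fun s => rfl, fun s hs => ?_⟩
  refine Complex.norm_le_of_forall_mem_frontier_norm_le (U := Metric.ball 0 R) Metric.isBounded_ball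
    hG.diffContOnCl (fun z hz => ?_) (by rw [closure_ball _ hR.ne']; simpa using hs)
  rw [frontier_ball _ hR.ne', mem_sphere_zero_iff_norm] at hz
  refine le_trans (le_of_eq ?_) (hM z hz.le)
  rw [hfg, norm_mul, norm_mul, norm_prod, norm_prod]
  congr 1
  refine Finset.prod_congr rfl fun p _ => ?_
  have h1 : (R : ℂ) ^ 2 = starRingEnd ℂ z * z := by
    rw [mul_comm, Complex.mul_conj, Complex.normSq_eq_norm_sq, hz]; push_cast; rfl
  rw [h1, ← sub_mul, ← map_sub, norm_div, norm_mul, RCLike.norm_conj, hz, Complex.norm_real,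
    Real.norm_of_nonneg hR.le, mul_div_assoc, div_self hR.ne', mul_one]

/-- Jensen's bound for the number of zeros of an entire function. -/
lemma norm_mul_pow_card_zeros_le {f : ℂ → ℂ} (hf : Differentiable ℂ f) {ρ R M : ℝ} (hρ : 0 < ρ)
    (hρR : ρ < R) (hM : ∀ s, ‖s‖ ≤ R → ‖f s‖ ≤ M) (P : Finset ℂ)
    (hP : ∀ p ∈ P, f p = 0 ∧ ‖p‖ ≤ ρ) : ‖f 0‖ * (R / ρ) ^ P.card ≤ M := by
  have hR : 0 < R := hρ.trans hρR
  obtain ⟨g, G, -, -, hfg, hGg, hGM⟩ := exists_blaschke_quotient hf hR hM P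
    fun p hp => ⟨(hP p hp).1, (hP p hp).2.trans_lt hρR⟩
  have h1 := hGM 0 (by simpa using hR.le)
  rw [hGg] at h1
  have h2 : ∀ p ∈ P, ((R : ℂ) ^ 2 - starRingEnd ℂ p * 0) / R = R := fun p _ => by
    have : (R : ℂ) ≠ 0 := by exact_mod_cast hR.ne'
    field_simp; ring
  rw [Finset.prod_congr rfl h2, Finset.prod_const, norm_mul, norm_pow, Complex.norm_real,
    Real.norm_of_nonneg hR.le] at h1
  have h3 : ‖f 0‖ ≤ ρ ^ P.card * ‖g 0‖ := by
    rw [hfg, norm_mul, norm_prod]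
    gcongr
    rw [← Finset.prod_const]
    exact Finset.prod_le_prod (fun _ _ => norm_nonneg _) fun p hp => by simpa using (hP p hp).2
  calc ‖f 0‖ * (R / ρ) ^ P.card ≤ ρ ^ P.card * ‖g 0‖ * (R / ρ) ^ P.card := by gcongr
    _ = R ^ P.card * ‖g 0‖ := by rw [div_pow]; field_simp
    _ ≤ M := h1

/-- A lower bound for nonvanishing functions, from the Borel–Carathéodory theorem. -/
lemma norm_ge_of_ne_zero_on_ball {G : ℂ → ℂ} (hG : Differentiable ℂ G) {ρ r M : ℝ} (hr : 0 ≤ r)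
    (hrρ : r < ρ) (hM : ∀ s, ‖s‖ < ρ → ‖G s‖ ≤ M) (h0 : ∀ s, ‖s‖ < ρ → G s ≠ 0)
    (hM0 : ‖G 0‖ < M) {s : ℂ} (hs : ‖s‖ ≤ r) :
    ‖G 0‖ * Real.exp (-(2 * Real.log (M / ‖G 0‖) * r / (ρ - r))) ≤ ‖G s‖ := by
  have hρ : 0 < ρ := hr.trans_lt hrρ
  have hG0 : G 0 ≠ 0 := h0 0 (by simpa using hρ)
  have hb : ∀ s ∈ Metric.ball (0 : ℂ) ρ, G s ≠ 0 := fun s hs => h0 s (by simpa using hs)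
  have hq : DifferentiableOn ℂ (fun s => deriv G s / G s) (Metric.ball 0 ρ) := by
    intro s hs
    exact ((hG.deriv s).div (hG s) (hb s hs)).differentiableWithinAt
  obtain ⟨h, hh0, hh⟩ := (hq.isExactOn_ball).with_val_at 0 0
  have hhd : DifferentiableOn ℂ h (Metric.ball 0 ρ) := fun s hs =>
    (hh s hs).differentiableAt.differentiableWithinAt
  have hGh : Set.EqOn (fun s => G s * Complex.exp (-h s)) (fun _ => G 0) (Metric.ball 0 ρ) := by
    refine Metric.isOpen_ball.eqOn_of_deriv_eq (convex_ball _ _).isPreconnected ?_ ?_ ?_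
      (Metric.mem_ball_self hρ) ?_
    · exact hG.differentiableOn.mul hhd.neg.cexp
    · exact differentiableOn_const _
    · intro s hs
      have h1 := (hG s).hasDerivAt.mul (hh s hs).neg.cexp
      simp only [deriv_const]
      refine (h1.deriv).trans ?_
      have := hb s hs
      field_simp
      simp
    · simp [hh0]
  have hre : ∀ s ∈ Metric.ball (0 : ℂ) ρ, ‖G s‖ = ‖G 0‖ * Real.exp (h s).re := fun s hs => by
    have h1 := hGh hs
    simp only [Complex.exp_neg] at h1
    rw [← h1, norm_mul, norm_inv, Complex.norm_exp, mul_assoc, inv_mul_cancel₀ (Real.exp_pos _).ne',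
      mul_one]
  have hpos : 0 < ‖G 0‖ := norm_pos_iff.2 hG0
  have hlog : 0 < Real.log (M / ‖G 0‖) := Real.log_pos (by rwa [one_lt_div hpos])
  have hsb : s ∈ Metric.ball (0 : ℂ) ρ := by simpa using hs.trans_lt hrρ
  have hbc := Complex.borelCaratheodory_zero hlog hhd (fun t ht => by
    have h1 := hM t (by simpa using ht)
    rw [hre t ht] at h1
    show (h t).re ≤ _
    rw [Real.le_log_iff_exp_le (by positivity [hpos.trans hM0]), le_div_iff₀ hpos, mul_comm]
    exact h1) hρ hsb hh0
  rw [hre s hsb]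
  gcongr
  have h2 : 2 * Real.log (M / ‖G 0‖) * ‖s‖ / (ρ - ‖s‖) ≤ 2 * Real.log (M / ‖G 0‖) * r / (ρ - r) := by
    have : 0 < ρ - r := by linarith
    gcongr
  have h3 := Complex.abs_re_le_norm (h s)
  linarith [neg_abs_le (h s).re]

/-- A lower bound for an entire function away from its zeros. -/
lemma norm_ge_of_dist_zeros {f : ℂ → ℂ} (hf : Differentiable ℂ f) {r ρ R M δ : ℝ} (hr : 0 ≤ r)
    (hrρ : r < ρ) (hρR : ρ < R) (hM : ∀ s, ‖s‖ ≤ R → ‖f s‖ ≤ M) (P : Finset ℂ)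
    (hP : ∀ p ∈ P, f p = 0 ∧ deriv f p ≠ 0 ∧ ‖p‖ ≤ ρ) (hP' : ∀ s, ‖s‖ ≤ ρ → f s = 0 → s ∈ P)
    (h0 : f 0 ≠ 0) (hM0 : ‖f 0‖ < M) (hδ : 0 ≤ δ)
    {s : ℂ} (hs : ‖s‖ ≤ r) (hsδ : ∀ p ∈ P, δ ≤ ‖s - p‖) :
    ‖f 0‖ * Real.exp (-(2 * Real.log (M / ‖f 0‖) * r / (ρ - r))) * (δ / (2 * R)) ^ P.card ≤ ‖f s‖ := by
  have hρ : 0 < ρ := hr.trans_lt hrρ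
  have hR : 0 < R := hρ.trans hρR
  obtain ⟨g, G, hg, hGd, hfg, hGg, hGM⟩ := exists_blaschke_quotient hf hR hM P
    fun p hp => ⟨(hP p hp).1, (hP p hp).2.2.trans_lt hρR⟩
  have hgp : ∀ p ∈ P, g p ≠ 0 := by
    intro p hp hgp
    apply (hP p hp).2.1
    have h1 : HasDerivAt f ((deriv (fun s => ∏ q ∈ P, (s - q)) p) * g p +
        (∏ q ∈ P, (p - q)) * deriv g p) p := by
      rw [show f = fun s => (∏ q ∈ P, (s - q)) * g s from funext hfg]
      refine HasDerivAt.mul ?_ (hg p).hasDerivAt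
      refine DifferentiableAt.hasDerivAt ?_
      exact DifferentiableAt.fun_finsetProd fun q _ => by fun_prop
    rw [h1.deriv, hgp, Finset.prod_eq_zero hp (sub_self p)]; simp
  have hg0 : ∀ t, ‖t‖ ≤ ρ → g t ≠ 0 := by
    intro t ht hgt
    refine hgp t (hP' t ht ?_) hgt
    rw [hfg, hgt, mul_zero]
  have hne : ∀ p ∈ P, ∀ t : ℂ, ‖t‖ ≤ ρ → (R : ℂ) ^ 2 - starRingEnd ℂ p * t ≠ 0 := by
    intro p hp t ht h
    have h1 : (R : ℂ) ^ 2 = starRingEnd ℂ p * t := sub_eq_zero.1 h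
    have h2 := congrArg norm h1
    rw [norm_pow, Complex.norm_real, Real.norm_of_nonneg hR.le, norm_mul, RCLike.norm_conj] at h2
    nlinarith [(hP p hp).2.2, norm_nonneg p, norm_nonneg t, mul_le_mul (hP p hp).2.2 ht (norm_nonneg t) hρ.le]
  have hRc : (R : ℂ) ≠ 0 := by exact_mod_cast hR.ne'
  have hG0 : ∀ t, ‖t‖ < ρ → G t ≠ 0 := by
    intro t ht
    rw [hGg]
    exact mul_ne_zero (Finset.prod_ne_zero_iff.2 fun p hp => div_ne_zero (hne p hp t ht.le) hRc)
      (hg0 t ht.le)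
  have hfG0 : ‖f 0‖ ≤ ‖G 0‖ := by
    rw [hfg, hGg, norm_mul, norm_mul, norm_prod, norm_prod]
    refine mul_le_mul_of_nonneg_right ?_ (norm_nonneg _)
    refine Finset.prod_le_prod (fun _ _ => norm_nonneg _) fun p hp => ?_
    have : ((R : ℂ) ^ 2 - starRingEnd ℂ p * 0) / R = R := by field_simp; ring
    rw [this, zero_sub, norm_neg, Complex.norm_real, Real.norm_of_nonneg hR.le]
    exact (hP p hp).2.2.trans hρR.le
  have hpos : 0 < ‖f 0‖ := norm_pos_iff.2 h0
  have hGs : ‖G s‖ * (δ / (2 * R)) ^ P.card ≤ ‖f s‖ := by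
    rw [hfg, hGg, norm_mul, norm_mul, norm_prod, norm_prod, mul_right_comm]
    refine mul_le_mul_of_nonneg_right ?_ (norm_nonneg _)
    rw [← Finset.prod_const, ← Finset.prod_mul_distrib]
    refine Finset.prod_le_prod (fun _ _ => by positivity) fun p hp => ?_
    have h1 : ‖(R : ℂ) ^ 2 - starRingEnd ℂ p * s‖ ≤ 2 * R ^ 2 := by
      refine (norm_sub_le _ _).trans ?_
      rw [norm_pow, Complex.norm_real, Real.norm_of_nonneg hR.le, norm_mul, RCLike.norm_conj]
      nlinarith [mul_le_mul (hP p hp).2.2 (hs.trans hrρ.le) (norm_nonneg s) hρ.le]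
    rw [norm_div, Complex.norm_real, Real.norm_of_nonneg hR.le]
    calc _ ≤ 2 * R ^ 2 / R * (δ / (2 * R)) := by gcongr
      _ = δ := by field_simp
      _ ≤ _ := hsδ p hp
  refine le_trans ?_ hGs
  refine mul_le_mul_of_nonneg_right ?_ (by positivity)
  have hlog : 0 < Real.log (M / ‖f 0‖) := Real.log_pos (by rwa [one_lt_div hpos])
  have hd : 0 < ρ - r := by linarith
  rcases lt_or_ge ‖G 0‖ M with hlt | hge
  · refine le_trans ?_ (norm_ge_of_ne_zero_on_ball hGd hr hrρ (fun t ht => hGM t (by linarith)) hG0 hlt hs)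
    have hM' : 0 < M := hpos.trans hM0
    have hG0' : 0 < ‖G 0‖ := hpos.trans_le hfG0
    gcongr
  · have hmax : ‖G s‖ = ‖G 0‖ := by
      have hbound : ∀ t, ‖t‖ ≤ R → ‖G t‖ ≤ ‖G 0‖ := fun t ht => (hGM t ht).trans hge
      have := Complex.norm_eqOn_of_isPreconnected_of_isMaxOn (f := G) (U := Metric.ball 0 R) (c := 0)
        (convex_ball _ _).isPreconnected Metric.isOpen_ball hGd.differentiableOn
        (Metric.mem_ball_self hR) (fun t ht => hbound t (by simpa using (Metric.mem_ball.1 ht).le))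
      exact this (by simpa using (hs.trans_lt (hrρ.trans hρR)))
    rw [hmax]
    have hexp : Real.exp (-(2 * Real.log (M / ‖f 0‖) * r / (ρ - r))) ≤ 1 :=
      Real.exp_le_one_iff.2 (by simp only [Left.neg_nonpos_iff]; positivity)
    calc _ ≤ ‖f 0‖ * 1 := by gcongr
      _ ≤ _ := by rw [mul_one]; exact hfG0

/-- The `n`-th term of a series for `(s - 1) * ζ(s) - 1` which converges for `Re s > 0`. -/
noncomputable def zetaTerm (n : ℕ) (s : ℂ) : ℂ :=
  (s - 1) * ((n + 1 : ℝ) : ℂ) ^ (-s) + ((n + 2 : ℝ) : ℂ) ^ (1 - s) - ((n + 1 : ℝ) : ℂ) ^ (1 - s)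

lemma hasDerivAt_ofReal_cpow {x : ℝ} (hx : 0 < x) (c : ℂ) :
    HasDerivAt (fun y : ℝ => (y : ℂ) ^ c) (c * (x : ℂ) ^ (c - 1)) x := by
  have h : HasDerivAt (fun y : ℂ => y ^ c) (c * (x : ℂ) ^ (c - 1) * 1) (x : ℂ) :=
    (hasDerivAt_id (x : ℂ)).cpow_const (Or.inl (by simpa using hx))
  simpa using h.comp_ofReal

lemma norm_ofReal_cpow_sub_le {m x : ℝ} (hm : 0 < m) (hx : m ≤ x) {s : ℂ} (hs : 0 ≤ s.re) :
    ‖(x : ℂ) ^ (-s) - (m : ℂ) ^ (-s)‖ ≤ ‖s‖ * m ^ (-s.re - 1) * (x - m) := by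
  have h := Convex.norm_image_sub_le_of_norm_hasDerivWithin_le (s := Set.Icc m x) (x := m) (y := x)
    (f := fun y : ℝ => (y : ℂ) ^ (-s)) (f' := fun y => -s * (y : ℂ) ^ (-s - 1))
    (C := ‖s‖ * m ^ (-s.re - 1))
    (fun y hy => (hasDerivAt_ofReal_cpow (hm.trans_le hy.1) _).hasDerivWithinAt)
    (fun y hy => by
      rw [norm_mul, norm_neg, Complex.norm_cpow_eq_rpow_re_of_pos (hm.trans_le hy.1)]
      gcongr ?_ * ?_
      simp only [Complex.sub_re, Complex.neg_re, Complex.one_re]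
      exact Real.rpow_le_rpow_of_nonpos hm hy.1 (by linarith))
    (convex_Icc _ _) (Set.left_mem_Icc.2 hx) (Set.right_mem_Icc.2 hx)
  simpa [Real.norm_of_nonneg (sub_nonneg.2 hx)] using h

lemma norm_zetaTerm_le_of {n : ℕ} {s : ℂ} {C : ℝ}
    (hC : ∀ x ∈ Set.Icc (n + 1 : ℝ) (n + 2), ‖(x : ℂ) ^ (-s) - ((n + 1 : ℝ) : ℂ) ^ (-s)‖ ≤ C) :
    ‖zetaTerm n s‖ ≤ ‖s - 1‖ * C := by
  have hn : (0 : ℝ) < n + 1 := by positivity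
  have h := Convex.norm_image_sub_le_of_norm_hasDerivWithin_le (s := Set.Icc (n + 1 : ℝ) (n + 2))
    (x := (n + 1 : ℝ)) (y := n + 2)
    (f := fun y : ℝ => (y : ℂ) ^ (1 - s) - (y : ℂ) * ((1 - s) * ((n + 1 : ℝ) : ℂ) ^ (-s)))
    (f' := fun y => (1 - s) * (y : ℂ) ^ (1 - s - 1) - 1 * ((1 - s) * ((n + 1 : ℝ) : ℂ) ^ (-s)))
    (C := ‖s - 1‖ * C)
    (fun y hy => ((hasDerivAt_ofReal_cpow (hn.trans_le hy.1) _).sub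
      ((hasDerivAt_id y).ofReal_comp.mul_const _)).hasDerivWithinAt)
    (fun y hy => by
      have e : (1 - s) * (y : ℂ) ^ (1 - s - 1) - 1 * ((1 - s) * ((n + 1 : ℝ) : ℂ) ^ (-s))
        = (1 - s) * ((y : ℂ) ^ (-s) - ((n + 1 : ℝ) : ℂ) ^ (-s)) := by
        rw [show 1 - s - 1 = -s by ring]; ring
      rw [e, norm_mul, norm_sub_rev]
      exact mul_le_mul_of_nonneg_left (hC y hy) (norm_nonneg _))
    (convex_Icc _ _) (Set.left_mem_Icc.2 (by linarith)) (Set.right_mem_Icc.2 (by linarith))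
  have e2 : (n + 2 : ℝ) - (n + 1) = 1 := by ring
  rw [e2, norm_one, mul_one] at h
  refine le_trans (le_of_eq ?_) h
  congr 1
  simp only [zetaTerm]
  push_cast
  ring

lemma norm_zetaTerm_le (n : ℕ) {s : ℂ} (hs : 0 ≤ s.re) :
    ‖zetaTerm n s‖ ≤ ‖s - 1‖ * (‖s‖ * (n + 1 : ℝ) ^ (-s.re - 1)) := by
  have hn : (0 : ℝ) < n + 1 := by positivity
  refine norm_zetaTerm_le_of fun x hx => ?_
  refine (norm_ofReal_cpow_sub_le hn hx.1 hs).trans ?_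
  exact mul_le_of_le_one_right (by positivity) (by linarith [hx.2])

lemma norm_zetaTerm_le' (n : ℕ) {s : ℂ} (hs : 0 ≤ s.re) :
    ‖zetaTerm n s‖ ≤ ‖s - 1‖ * (2 * (n + 1 : ℝ) ^ (-s.re)) := by
  have hn : (0 : ℝ) < n + 1 := by positivity
  refine norm_zetaTerm_le_of fun x hx => ?_
  refine (norm_sub_le _ _).trans ?_
  rw [Complex.norm_cpow_eq_rpow_re_of_pos (hn.trans_le hx.1), Complex.norm_cpow_eq_rpow_re_of_pos hn,
    two_mul, Complex.neg_re]
  gcongr ?_ + _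
  exact Real.rpow_le_rpow_of_nonpos hn hx.1 (by linarith)

lemma summable_natCast_add_one_rpow {a : ℝ} (ha : a < -1) :
    Summable fun n : ℕ => (n + 1 : ℝ) ^ a := by
  have := (Real.summable_nat_rpow.2 ha)
  simpa using (summable_nat_add_iff 1).2 this

lemma differentiable_zetaTerm (n : ℕ) : Differentiable ℂ (zetaTerm n) := by
  unfold zetaTerm
  have h1 : ((n + 1 : ℝ) : ℂ) ≠ 0 := by exact_mod_cast (by positivity : (n + 1 : ℝ) ≠ 0)
  have h2 : ((n + 2 : ℝ) : ℂ) ≠ 0 := by exact_mod_cast (by positivity : (n + 2 : ℝ) ≠ 0)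
  intro s
  have e : ∀ (c : ℂ), c ≠ 0 → ∀ g : ℂ → ℂ, DifferentiableAt ℂ g s →
      DifferentiableAt ℂ (fun s => c ^ g s) s := fun c hc g hg => hg.const_cpow (Or.inl hc)
  exact ((((differentiableAt_id.sub_const 1).mul (e _ h1 _ (by fun_prop))).add
    (e _ h2 _ (by fun_prop))).sub (e _ h1 _ (by fun_prop)))

lemma riemannZeta₁_eq_of_ne_one {s : ℂ} (hs : s ≠ 1) :
    riemannZeta₁ s = (s - 1) * riemannZeta s := by
  rw [riemannZeta_eq_inv_sub_mul hs, mul_inv_cancel_left₀ (sub_ne_zero.2 hs)]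

lemma hasSum_telescope {s : ℂ} (hs : 1 < s.re) :
    HasSum (fun n : ℕ => ((n + 2 : ℝ) : ℂ) ^ (1 - s) - ((n + 1 : ℝ) : ℂ) ^ (1 - s)) (-1) := by
  have hlim : Tendsto (fun n : ℕ => ((n + 1 : ℝ) : ℂ) ^ (1 - s)) atTop (𝓝 0) := by
    rw [tendsto_zero_iff_norm_tendsto_zero]
    have : (fun n : ℕ => ‖((n + 1 : ℝ) : ℂ) ^ (1 - s)‖) = fun n : ℕ => (n + 1 : ℝ) ^ (-(s.re - 1)) := by
      funext n
      rw [Complex.norm_cpow_eq_rpow_re_of_pos (by positivity)]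
      simp
    rw [this]
    exact (tendsto_rpow_neg_atTop (by linarith : 0 < s.re - 1)).comp
      (tendsto_natCast_atTop_atTop.atTop_add tendsto_const_nhds)
  have hsum : Summable (fun n : ℕ => ((n + 2 : ℝ) : ℂ) ^ (1 - s) - ((n + 1 : ℝ) : ℂ) ^ (1 - s)) := by
    refine Summable.of_norm_bounded (g := fun n : ℕ => ‖s - 1‖ * (n + 1 : ℝ) ^ (-s.re)) ?_ ?_
    · exact (summable_natCast_add_one_rpow (by linarith)).mul_left _
    · intro n
      have hn : (0 : ℝ) < n + 1 := by positivity
      have h := norm_ofReal_cpow_sub_le (s := s - 1) hn (by linarith : (n + 1 : ℝ) ≤ n + 2) (by simp; linarith)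
      simp only [neg_sub, Complex.sub_re, Complex.one_re] at h
      refine h.trans (le_of_eq ?_)
      ring_nf
  have h2 := hsum.hasSum.tendsto_sum_nat
  have h3 : Tendsto (fun N : ℕ => ∑ n ∈ Finset.range N,
      (((n + 2 : ℝ) : ℂ) ^ (1 - s) - ((n + 1 : ℝ) : ℂ) ^ (1 - s))) atTop (𝓝 (0 - 1)) := by
    have : ∀ N : ℕ, ∑ n ∈ Finset.range N, (((n + 2 : ℝ) : ℂ) ^ (1 - s) - ((n + 1 : ℝ) : ℂ) ^ (1 - s))
        = ((N + 1 : ℝ) : ℂ) ^ (1 - s) - 1 := by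
      intro N
      have := Finset.sum_range_sub (fun n : ℕ => ((n + 1 : ℝ) : ℂ) ^ (1 - s)) N
      simp only [CharP.cast_eq_zero, zero_add, Complex.ofReal_one, Complex.one_cpow] at this
      rw [← this]
      refine Finset.sum_congr rfl fun n _ => ?_
      push_cast
      ring_nf
    simp_rw [this]
    exact hlim.sub_const 1
  rw [← zero_sub, ← tendsto_nhds_unique h2 h3]
  exact hsum.hasSum

lemma riemannZeta₁_eq_tsum_of_one_lt {s : ℂ} (hs : 1 < s.re) :
    riemannZeta₁ s = 1 + ∑' n, zetaTerm n s := by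
  have hne : s ≠ 1 := by rintro rfl; simp at hs
  have hz : HasSum (fun n : ℕ => ((n + 1 : ℝ) : ℂ) ^ (-s)) (riemannZeta s) := by
    rw [zeta_eq_tsum_one_div_nat_add_one_cpow hs]
    have h : Summable (fun n : ℕ => 1 / ((n : ℂ) + 1) ^ s) := by
      have := (summable_nat_add_iff 1).2 (Complex.summable_one_div_nat_cpow.2 hs)
      simpa using this
    convert h.hasSum using 2 with n
    rw [Complex.cpow_neg, one_div]; push_cast; rfl
  have := ((hz.mul_left (s - 1)).add (hasSum_telescope hs)).tsum_eq
  simp only [zetaTerm, add_sub_assoc]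
  rw [this, riemannZeta₁_eq_of_ne_one hne]; ring

theorem riemannZeta₁_eq_tsum {s : ℂ} (hs : 0 < s.re) :
    riemannZeta₁ s = 1 + ∑' n, zetaTerm n s := by
  let U : Set ℂ := {s | 0 < s.re}
  have hU : IsOpen U := isOpen_lt continuous_const Complex.continuous_re
  have hUc : IsPreconnected U := (convex_halfSpace_re_gt 0).isPreconnected
  have hd : DifferentiableOn ℂ (fun s => 1 + ∑' n, zetaTerm n s) U := by
    intro t ht
    let σ := t.re / 2
    have hσ : 0 < σ := half_pos ht
    let V : Set ℂ := {s | σ < s.re} ∩ Metric.ball 0 (‖t‖ + 1)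
    have hV : IsOpen V := (isOpen_lt continuous_const Complex.continuous_re).inter Metric.isOpen_ball
    have htV : t ∈ V := ⟨show t.re / 2 < t.re from half_lt_self ht, by simp⟩
    have := Complex.differentiableOn_tsum_of_summable_norm (U := V) (F := zetaTerm)
      (u := fun n : ℕ => (‖t‖ + 2) * ((‖t‖ + 1) * (n + 1 : ℝ) ^ (-σ - 1)))
      (((summable_natCast_add_one_rpow (by linarith)).mul_left _).mul_left _)
      (fun n => (differentiable_zetaTerm n).differentiableOn) hV
      (fun n w hw => by
        have h1 : ‖w‖ < ‖t‖ + 1 := by simpa using hw.2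
        have h2 : ‖w - 1‖ ≤ ‖t‖ + 2 := (norm_sub_le _ _).trans (by rw [norm_one]; linarith)
        have h3 : σ < w.re := hw.1
        refine (norm_zetaTerm_le n (hσ.trans h3).le).trans ?_
        gcongr
        linarith)
    exact ((this.const_add 1).differentiableAt (hV.mem_nhds htV)).differentiableWithinAt
  have h := (differentiable_riemannZeta₁.differentiableOn.analyticOnNhd hU).eqOn_of_preconnected_of_eventuallyEq
    (hd.analyticOnNhd hU) hUc (z₀ := 2) (by simp [U])
    (by
      filter_upwards [(isOpen_lt continuous_const Complex.continuous_re).mem_nhds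
        (show (2 : ℂ) ∈ {s : ℂ | 1 < s.re} by simp)] with s hs
      exact riemannZeta₁_eq_tsum_of_one_lt hs)
  exact h hs

lemma exists_norm_riemannZeta₁_le {σ : ℝ} (hσ : 0 < σ) :
    ∃ C : ℝ, 0 < C ∧ ∀ s : ℂ, σ ≤ s.re → ‖riemannZeta₁ s‖ ≤ C * (1 + ‖s‖) ^ 2 := by
  have hsum := summable_natCast_add_one_rpow (a := -σ - 1) (by linarith)
  have h0 : 0 ≤ ∑' n : ℕ, (n + 1 : ℝ) ^ (-σ - 1) := tsum_nonneg fun n => by positivity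
  refine ⟨1 + ∑' n : ℕ, (n + 1 : ℝ) ^ (-σ - 1), by linarith, fun s hs => ?_⟩
  rw [riemannZeta₁_eq_tsum (hσ.trans_le hs)]
  have h1 : ‖∑' n, zetaTerm n s‖ ≤ ‖s - 1‖ * (‖s‖ * ∑' n : ℕ, (n + 1 : ℝ) ^ (-σ - 1)) := by
    refine tsum_of_norm_bounded ((hsum.hasSum.mul_left _).mul_left _) fun n => ?_
    refine (norm_zetaTerm_le n (hσ.le.trans hs)).trans ?_
    gcongr
    linarith
  refine (norm_add_le _ _).trans ?_
  rw [norm_one]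
  have h2 : ‖s - 1‖ ≤ 1 + ‖s‖ := by
    refine (norm_sub_le _ _).trans ?_
    rw [norm_one, add_comm]
  have h3 := norm_nonneg s
  set Z := ∑' n : ℕ, (n + 1 : ℝ) ^ (-σ - 1)
  have : ‖s - 1‖ * (‖s‖ * Z) ≤ (1 + ‖s‖) * ((1 + ‖s‖) * Z) := by gcongr; linarith
  nlinarith [this, h1]

lemma exists_norm_riemannZeta₁_le_of_one_le :
    ∃ C : ℝ, 0 < C ∧ ∀ s : ℂ, 1 ≤ s.re →
      ‖riemannZeta₁ s‖ ≤ 1 + C * (‖s - 1‖ * (1 + ‖s‖) ^ (1 / 8 : ℝ)) := by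
  have hsum := summable_natCast_add_one_rpow (a := -(9 / 8)) (by norm_num)
  have h0 : 0 ≤ ∑' n : ℕ, (n + 1 : ℝ) ^ (-(9 / 8) : ℝ) := tsum_nonneg fun n => by positivity
  refine ⟨2 * (1 + ∑' n : ℕ, (n + 1 : ℝ) ^ (-(9 / 8) : ℝ)), by linarith, fun s hs => ?_⟩
  rw [riemannZeta₁_eq_tsum (by linarith)]
  have h1 : ‖∑' n, zetaTerm n s‖ ≤ ‖s - 1‖ * (2 * (1 + ‖s‖) ^ (1 / 8 : ℝ) *
      ∑' n : ℕ, (n + 1 : ℝ) ^ (-(9 / 8) : ℝ)) := by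
    refine tsum_of_norm_bounded ((hsum.hasSum.mul_left _).mul_left _) fun n => ?_
    have hn : (0 : ℝ) < n + 1 := by positivity
    have hn1 : (1 : ℝ) ≤ n + 1 := by linarith [(Nat.cast_nonneg n : (0 : ℝ) ≤ n)]
    rcases le_total (n + 1 : ℝ) (1 + ‖s‖) with h | h
    · refine (norm_zetaTerm_le' n (by linarith)).trans ?_
      rw [mul_assoc 2]
      gcongr
      calc (n + 1 : ℝ) ^ (-s.re) ≤ (n + 1 : ℝ) ^ (-1 : ℝ) :=
            Real.rpow_le_rpow_of_exponent_le hn1 (by linarith)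
        _ = (n + 1 : ℝ) ^ (1 / 8 : ℝ) * (n + 1 : ℝ) ^ (-(9 / 8) : ℝ) := by
            rw [← Real.rpow_add hn]; norm_num
        _ ≤ _ := by gcongr
    · refine (norm_zetaTerm_le n (by linarith)).trans ?_
      refine mul_le_mul_of_nonneg_left ?_ (norm_nonneg _)
      have hp : (0 : ℝ) < 1 + ‖s‖ := by positivity
      have hnn := norm_nonneg s
      calc ‖s‖ * (n + 1 : ℝ) ^ (-s.re - 1) ≤ (1 + ‖s‖) * (n + 1 : ℝ) ^ (-2 : ℝ) := by
            gcongr ?_ * ?_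
            · linarith
            · exact Real.rpow_le_rpow_of_exponent_le hn1 (by linarith)
        _ = (1 + ‖s‖) ^ (1 / 8 : ℝ) * ((1 + ‖s‖) ^ (7 / 8 : ℝ) * (n + 1 : ℝ) ^ (-2 : ℝ)) := by
            rw [← mul_assoc, ← Real.rpow_add hp]; norm_num
        _ ≤ (1 + ‖s‖) ^ (1 / 8 : ℝ) * ((n + 1 : ℝ) ^ (7 / 8 : ℝ) * (n + 1 : ℝ) ^ (-2 : ℝ)) := by
            gcongr
        _ = (1 + ‖s‖) ^ (1 / 8 : ℝ) * (n + 1 : ℝ) ^ (-(9 / 8) : ℝ) := by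
            rw [← Real.rpow_add hn]; norm_num
        _ ≤ 2 * (1 + ‖s‖) ^ (1 / 8 : ℝ) * (n + 1 : ℝ) ^ (-(9 / 8) : ℝ) := by
            rw [mul_assoc 2]
            exact le_mul_of_one_le_left (by positivity) (by norm_num)
  refine (norm_add_le _ _).trans ?_
  rw [norm_one]
  refine add_le_add le_rfl (h1.trans ?_)
  have : 0 ≤ ‖s - 1‖ * (1 + ‖s‖) ^ (1 / 8 : ℝ) := by positivity
  nlinarith

lemma Complex.norm_Gamma_le_Gamma_re {s : ℂ} (hs : 0 < s.re) : ‖Complex.Gamma s‖ ≤ Real.Gamma s.re := by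
  rw [Complex.Gamma_eq_integral hs, Real.Gamma_eq_integral hs, Complex.GammaIntegral]
  refine (norm_integral_le_integral_norm _).trans (le_of_eq ?_)
  refine setIntegral_congr_fun measurableSet_Ioi fun x hx => ?_
  have hx' : 0 < x := hx
  simp only [norm_mul, Complex.norm_cpow_eq_rpow_re_of_pos hx', Complex.norm_real, Real.norm_eq_abs,
    Complex.sub_re, Complex.one_re]
  rw [abs_of_pos (Real.exp_pos _)]

lemma Complex.norm_cos_le (z : ℂ) : ‖Complex.cos z‖ ≤ Real.exp |z.im| := by
  rw [Complex.cos, norm_div, Complex.norm_ofNat, div_le_iff₀ two_pos]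
  refine (norm_add_le _ _).trans ?_
  rw [Complex.norm_exp, Complex.norm_exp]
  have h1 : (z * Complex.I).re ≤ |z.im| := by simp [neg_le_abs]
  have h2 : (-z * Complex.I).re ≤ |z.im| := by simp [le_abs_self]
  linarith [Real.exp_le_exp.2 h1, Real.exp_le_exp.2 h2]

lemma Real.sinh_le_mul_cosh {u : ℝ} (hu : 0 ≤ u) : Real.sinh u ≤ u * Real.cosh u := by
  have h := Convex.image_sub_le_mul_sub_of_deriv_le (D := Set.Icc 0 u) (convex_Icc _ _)
    (f := Real.sinh) (C := Real.cosh u) Real.continuous_sinh.continuousOn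
    Real.differentiable_sinh.differentiableOn (fun x hx => by
      rw [interior_Icc] at hx
      rw [Real.deriv_sinh]
      exact Real.cosh_le_cosh.2 (by rw [abs_of_pos hx.1, abs_of_nonneg hu]; exact hx.2.le))
    0 (Set.left_mem_Icc.2 hu) u (Set.right_mem_Icc.2 hu) hu
  simp only [Real.sinh_zero, sub_zero] at h
  linarith

lemma norm_riemannZeta_sub_one_le {s : ℂ} (hs : 2 ≤ s.re) : ‖riemannZeta s - 1‖ ≤ 2 / 3 := by
  have hs1 : 1 < s.re := by linarith
  have h1 : Summable fun n : ℕ => 1 / ((n : ℂ) + 1) ^ s := by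
    have := (summable_nat_add_iff 1).2 (Complex.summable_one_div_nat_cpow.2 hs1)
    simpa using this
  have h2 : HasSum (fun n : ℕ => 1 / ((n : ℝ) + 1) ^ 2) (Real.pi ^ 2 / 6) := by
    have := (hasSum_nat_add_iff (f := fun n : ℕ => 1 / (n : ℝ) ^ 2) (g := Real.pi ^ 2 / 6) 1).2
      (by simpa using hasSum_zeta_two)
    simpa using this
  have h3 : HasSum (fun n : ℕ => 1 / ((n : ℝ) + 1 + 1) ^ 2) (Real.pi ^ 2 / 6 - 1) := by
    have := (hasSum_nat_add_iff (f := fun n : ℕ => 1 / ((n : ℝ) + 1) ^ 2) (g := Real.pi ^ 2 / 6 - 1) 1).2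
      (by simpa using h2)
    simpa using this
  rw [zeta_eq_tsum_one_div_nat_add_one_cpow hs1, h1.tsum_eq_zero_add]
  simp only [CharP.cast_eq_zero, zero_add, Complex.one_cpow, div_one, add_sub_cancel_left]
  have h4 : ‖∑' b : ℕ, 1 / (((b + 1 : ℕ) : ℂ) + 1) ^ s‖ ≤ Real.pi ^ 2 / 6 - 1 := by
    refine tsum_of_norm_bounded h3 fun n => ?_
    have e : (((n + 1 : ℕ) : ℂ) + 1) = ((n + 1 + 1 : ℝ) : ℂ) := by push_cast; ring
    have hp : (0 : ℝ) < n + 1 + 1 := by positivity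
    rw [e, norm_div, norm_one, Complex.norm_cpow_eq_rpow_re_of_pos hp, ← Real.rpow_two]
    gcongr
    linarith [(Nat.cast_nonneg n : (0 : ℝ) ≤ n)]
  nlinarith [Real.pi_lt_d4, Real.pi_pos]

lemma norm_riemannZeta_ge {s : ℂ} (hs : 2 ≤ s.re) : 1 / 3 ≤ ‖riemannZeta s‖ := by
  have h := norm_riemannZeta_sub_one_le hs
  have := norm_sub_norm_le (1 : ℂ) (1 - riemannZeta s)
  rw [sub_sub_cancel, norm_one, norm_sub_rev] at this
  linarith

lemma one_le_norm_Gamma_mul_cos (t : ℝ) :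
    1 ≤ ‖Complex.Gamma (2 + t * Complex.I) * Complex.cos (Real.pi * (2 + t * Complex.I) / 2)‖ := by
  rcases eq_or_ne t 0 with rfl | ht
  · simp
  have hc : Complex.cos (Real.pi * (2 + t * Complex.I) / 2) = -(Real.cosh (Real.pi * t / 2) : ℝ) := by
    rw [show (Real.pi * (2 + t * Complex.I) / 2 : ℂ) = ((Real.pi * t / 2 : ℝ) : ℂ) * Complex.I + Real.pi by
      push_cast; ring, Complex.cos_add_pi, Complex.cos_mul_I, Complex.ofReal_cosh]
  have hne : (t * Complex.I : ℂ) ≠ 0 := by simp [ht]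
  have hg : Complex.Gamma (2 + t * Complex.I) = (1 + t * Complex.I) * Complex.Gamma (1 + t * Complex.I) := by
    rw [← Complex.Gamma_add_one]
    · congr 1; ring
    · intro h; have := congrArg Complex.re h; simp at this
  have hg1 : Complex.Gamma (1 + t * Complex.I) = t * Complex.I * Complex.Gamma (t * Complex.I) := by
    rw [← Complex.Gamma_add_one _ hne, add_comm]
  have hconj : ‖Complex.Gamma (1 - t * Complex.I)‖ = ‖Complex.Gamma (1 + t * Complex.I)‖ := by
    rw [← RCLike.norm_conj, ← Complex.Gamma_conj]
    simp
  have hrefl : ‖Complex.Gamma (1 + t * Complex.I)‖ ^ 2 = Real.pi * t / Real.sinh (Real.pi * t) := by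
    have h := Complex.Gamma_mul_Gamma_one_sub (t * Complex.I)
    have h2 : Complex.Gamma (1 + t * Complex.I) * Complex.Gamma (1 - t * Complex.I) =
        ((Real.pi * t / Real.sinh (Real.pi * t) : ℝ) : ℂ) := by
      rw [hg1, mul_assoc, h, ← mul_assoc, ← Complex.ofReal_mul, Complex.sin_mul_I]
      have : Real.sinh (Real.pi * t) ≠ 0 := by
        rw [Ne, Real.sinh_eq_zero]; simp [ht, Real.pi_ne_zero]
      have h3 : Complex.sinh ((Real.pi * t : ℝ) : ℂ) ≠ 0 := by
        rw [← Complex.ofReal_sinh]; exact_mod_cast this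
      rw [Complex.ofReal_div, Complex.ofReal_sinh]
      field_simp
      push_cast; ring
    have h4 := congrArg norm h2
    rw [norm_mul, hconj, Complex.norm_real, ← sq] at h4
    rw [h4, Real.norm_of_nonneg]
    rcases lt_or_gt_of_ne ht with h | h
    · exact div_nonneg_of_nonpos (by nlinarith [Real.pi_pos])
        (Real.sinh_nonpos_iff.2 (by nlinarith [Real.pi_pos]))
    · exact div_nonneg (by positivity) (Real.sinh_nonneg_iff.2 (by positivity))
  have hcosh : 1 ≤ Real.pi * t / Real.sinh (Real.pi * t) * Real.cosh (Real.pi * t / 2) ^ 2 := by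
    have key : ∀ u : ℝ, 0 < u → 1 ≤ 2 * u / Real.sinh (2 * u) * Real.cosh u ^ 2 := by
      intro u hu
      have h1 := Real.sinh_le_mul_cosh hu.le
      have h2 : 0 < Real.sinh u := Real.sinh_pos_iff.2 hu
      have h3 := Real.cosh_pos u
      rw [Real.sinh_two_mul, div_mul_eq_mul_div, le_div_iff₀ (by positivity)]
      nlinarith
    have hpi := Real.pi_pos
    rcases lt_or_gt_of_ne ht with h | h
    · have := key (-(Real.pi * t / 2)) (by nlinarith)
      rw [show 2 * -(Real.pi * t / 2) = -(Real.pi * t) by ring, Real.sinh_neg, Real.cosh_neg, neg_div_neg_eq] at this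
      exact this
    · have := key (Real.pi * t / 2) (by positivity)
      rwa [show 2 * (Real.pi * t / 2) = Real.pi * t by ring] at this
  have h1t : 1 ≤ ‖(1 + t * Complex.I : ℂ)‖ := by
    have := Complex.abs_re_le_norm (1 + t * Complex.I : ℂ)
    simpa using this
  rw [hc, hg, norm_mul, norm_mul, norm_neg, Complex.norm_real, Real.norm_of_nonneg (Real.cosh_pos _).le]
  have : 1 ≤ (‖Complex.Gamma (1 + t * Complex.I)‖ * Real.cosh (Real.pi * t / 2)) ^ 2 := by
    rw [mul_pow, hrefl]; exact hcosh
  have h5 : 1 ≤ ‖Complex.Gamma (1 + t * Complex.I)‖ * Real.cosh (Real.pi * t / 2) := by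
    have hn : 0 ≤ ‖Complex.Gamma (1 + t * Complex.I)‖ * Real.cosh (Real.pi * t / 2) :=
      mul_nonneg (norm_nonneg _) (Real.cosh_pos _).le
    nlinarith
  rw [mul_assoc]
  nlinarith

lemma norm_riemannZeta_neg_one_add_ge (t : ℝ) : 1 / 60 ≤ ‖riemannZeta (-1 + t * Complex.I)‖ := by
  set s : ℂ := 2 + ((-t : ℝ) : ℂ) * Complex.I with hs
  have hre : s.re = 2 := by simp [hs]
  have h := riemannZeta_one_sub (s := s) (fun n hn => by
    have := congrArg Complex.re hn
    rw [hre] at this; simp at this; linarith [(Nat.cast_nonneg n : (0 : ℝ) ≤ n)])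
    (fun hn => by rw [hn] at hre; simp at hre)
  rw [show (-1 + t * Complex.I : ℂ) = 1 - s by rw [hs]; push_cast; ring, h, mul_assoc (2 * (2 * (Real.pi : ℂ)) ^ (-s)),
    norm_mul, norm_mul, norm_mul]
  have h1 := one_le_norm_Gamma_mul_cos (-t)
  rw [← hs] at h1
  have h2 := norm_riemannZeta_ge (s := s) hre.ge
  have h3 : ‖(2 * (Real.pi : ℂ)) ^ (-s)‖ = 1 / (4 * Real.pi ^ 2) := by
    rw [show (2 * (Real.pi : ℂ)) = ((2 * Real.pi : ℝ) : ℂ) by push_cast; ring,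
      Complex.norm_cpow_eq_rpow_re_of_pos (by positivity), Complex.neg_re, hre, Real.rpow_neg (by positivity),
      Real.rpow_two]
    rw [mul_pow]; norm_num
  have h4 : Real.pi ^ 2 < 10 := by nlinarith [Real.pi_lt_d4, Real.pi_pos]
  have h5 : 1 / 40 ≤ 1 / (4 * Real.pi ^ 2) := by
    apply one_div_le_one_div_of_le (by positivity); linarith
  rw [h3, Complex.norm_ofNat]
  calc (1 / 60 : ℝ) = 2 * (1 / 40) * 1 * (1 / 3) := by norm_num
    _ ≤ _ := by gcongr

lemma riemannZeta_ne_zero_of_re_nonpos {s : ℂ} (hs : s.re ≤ 0) (h : s.im ≠ 0 ∨ -1 ≤ s.re) :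
    riemannZeta s ≠ 0 := by
  rcases eq_or_ne s 0 with rfl | hs0
  · rw [riemannZeta_zero]; norm_num
  have hre : 1 ≤ (1 - s).re := by simp; linarith
  have h1 := riemannZeta_one_sub (s := 1 - s) (fun n hn => by
    have := congrArg Complex.re hn
    rw [this] at hre; simp at hre; linarith [(Nat.cast_nonneg n : (0 : ℝ) ≤ n)])
    (fun hn => hs0 (by linear_combination -hn))
  rw [sub_sub_cancel] at h1
  rw [h1]
  refine mul_ne_zero (mul_ne_zero (mul_ne_zero (mul_ne_zero two_ne_zero ?_) ?_) ?_) ?_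
  · rw [Complex.cpow_def_of_ne_zero (by simp [Real.pi_ne_zero])]
    exact Complex.exp_ne_zero _
  · exact Complex.Gamma_ne_zero_of_re_pos (by linarith)
  · intro hc
    obtain ⟨k, hk⟩ := Complex.cos_eq_zero_iff.1 hc
    have hpi : (Real.pi : ℂ) ≠ 0 := by exact_mod_cast Real.pi_ne_zero
    have hk' : s = ((-2 * k : ℤ) : ℂ) := by
      have : (1 - s) = 2 * k + 1 := by
        field_simp at hk; linear_combination hk
      push_cast; linear_combination -this
    rcases h with h | h
    · apply h; rw [hk']; simp
    · have e : s.re = ((-2 * k : ℤ) : ℝ) := by rw [hk']; simp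
      rw [e] at hs h
      have a1 : -2 * k ≤ 0 := by exact_mod_cast hs
      have a2 : -1 ≤ -2 * k := by exact_mod_cast h
      have : k = 0 := by omega
      apply hs0; rw [hk', this]; simp
  · exact riemannZeta_ne_zero_of_one_le_re hre

/-- A crude exponential bound for `(s - 1) * ζ(s)` in a vertical strip. -/
lemma exists_norm_riemannZeta₁_le_exp :
    ∃ C : ℝ, 0 < C ∧ ∀ s : ℂ, -3 ≤ s.re → s.re ≤ 7 → ‖riemannZeta₁ s‖ ≤ Real.exp (C * (1 + |s.im|)) := by
  obtain ⟨C, hC, hb⟩ := exists_norm_riemannZeta₁_le (σ := 1 / 2) (by norm_num)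
  obtain ⟨G, hG⟩ := (isCompact_Icc (a := (1 / 2 : ℝ)) (b := 4)).exists_bound_of_continuousOn
    (f := Real.Gamma) (fun x hx => (Real.differentiableAt_Gamma fun m => by
      intro h; have := hx.1; rw [h] at this; linarith [(Nat.cast_nonneg m : (0 : ℝ) ≤ m)]).continuousAt.continuousWithinAt)
  obtain ⟨B, hB⟩ := (isCompact_Icc.reProdIm isCompact_Icc :
    IsCompact ((Set.Icc (-3 : ℝ) 7) ×ℂ (Set.Icc (-1 : ℝ) 1))).exists_bound_of_continuousOn
      differentiable_riemannZeta₁.continuous.continuousOn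
  have hG0 : 0 ≤ G := (norm_nonneg _).trans (hG 1 (by norm_num))
  have hpoly : ∀ x : ℝ, 0 ≤ x → (1 + x) ^ 2 ≤ Real.exp (2 * x) := by
    intro x hx
    have := Real.add_one_le_exp x
    rw [two_mul, Real.exp_add, ← sq]
    gcongr; linarith
  have hright : ∀ s : ℂ, 1 / 2 ≤ s.re → s.re ≤ 7 → ‖riemannZeta₁ s‖ ≤ Real.exp (C + 16 + 2 * |s.im|) := by
    intro s h1 h2
    refine (hb s h1).trans ?_
    have hn : ‖s‖ ≤ 7 + |s.im| := (Complex.norm_le_abs_re_add_abs_im s).trans (by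
      gcongr; rw [abs_le]; constructor <;> linarith)
    calc C * (1 + ‖s‖) ^ 2 ≤ Real.exp C * Real.exp (2 * ‖s‖) := by
          gcongr
          · linarith [Real.add_one_le_exp C]
          · exact hpoly _ (norm_nonneg _)
      _ ≤ _ := by rw [← Real.exp_add]; exact Real.exp_le_exp.2 (by linarith)
  refine ⟨C + 16 + B ^ 2 + G + 40, by positivity, fun s h1 h2 => ?_⟩
  have hBe : B ≤ B ^ 2 + 1 := by nlinarith [sq_nonneg (B - 1)]
  rcases le_total (1 / 2) s.re with h | h
  · refine (hright s h h2).trans (Real.exp_le_exp.2 ?_)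
    have := abs_nonneg s.im
    nlinarith [mul_nonneg hC.le this, mul_nonneg (sq_nonneg B) this, mul_nonneg hG0 this, sq_nonneg B]
  rcases le_or_gt |s.im| 1 with hi | hi
  · refine (hB s ⟨⟨h1, h2⟩, abs_le.1 hi⟩).trans ?_
    refine le_trans ?_ (Real.add_one_le_exp _)
    have := abs_nonneg s.im
    nlinarith [mul_nonneg hC.le this, mul_nonneg (sq_nonneg B) this, mul_nonneg hG0 this, sq_nonneg B]
  have hi0 : s.im ≠ 0 := by intro h0; rw [h0] at hi; norm_num at hi
  have hs1 : s ≠ 1 := by rintro rfl; simp at hi0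
  have hs0 : 1 - s ≠ 1 := by intro h0; apply hi0; have := congrArg Complex.im h0; simpa using this
  have hre : 1 / 2 ≤ (1 - s).re := by simp; linarith
  have hre' : (1 - s).re ≤ 4 := by simp; linarith
  have him : |(1 - s).im| = |s.im| := by simp
  have e := riemannZeta_one_sub (s := 1 - s) (fun n hn => by
    have := congrArg Complex.re hn
    rw [this] at hre; simp at hre; linarith [(Nat.cast_nonneg n : (0 : ℝ) ≤ n)]) hs0
  rw [sub_sub_cancel] at e
  have e2 : riemannZeta (1 - s) = (-s)⁻¹ * riemannZeta₁ (1 - s) := by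
    rw [riemannZeta_eq_inv_sub_mul hs0]; congr 2; ring
  have hns : 1 ≤ ‖s‖ := hi.le.trans (Complex.abs_im_le_norm s)
  have hns' : ‖s - 1‖ ≤ 2 * ‖s‖ := (norm_sub_le _ _).trans (by rw [norm_one]; linarith)
  rw [riemannZeta₁_eq_of_ne_one hs1, e, e2]
  simp only [norm_mul, norm_inv, norm_neg, Complex.norm_ofNat]
  have b1 : ‖(2 * (Real.pi : ℂ)) ^ (-(1 - s))‖ ≤ 1 := by
    rw [show (2 * (Real.pi : ℂ)) = ((2 * Real.pi : ℝ) : ℂ) by push_cast; ring,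
      Complex.norm_cpow_eq_rpow_re_of_pos (by positivity)]
    apply Real.rpow_le_one_of_one_le_of_nonpos
    · linarith [Real.pi_gt_three]
    · simp; linarith
  have b2 : ‖Complex.Gamma (1 - s)‖ ≤ G := (Complex.norm_Gamma_le_Gamma_re (by linarith)).trans
    ((le_abs_self _).trans (hG _ ⟨hre, hre'⟩))
  have b3 : ‖Complex.cos (Real.pi * (1 - s) / 2)‖ ≤ Real.exp (2 * |s.im|) := by
    refine (Complex.norm_cos_le _).trans (Real.exp_le_exp.2 ?_)
    have : (Real.pi * (1 - s) / 2 : ℂ).im = -(Real.pi / 2) * s.im := by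
      rw [show (Real.pi * (1 - s) / 2 : ℂ) = ((Real.pi / 2 : ℝ) : ℂ) * (1 - s) by push_cast; ring,
        Complex.im_ofReal_mul]
      simp
    rw [this, abs_mul, abs_neg, abs_of_pos (by positivity)]
    gcongr
    linarith [Real.pi_le_four]
  have b4 := hright (1 - s) hre (by linarith)
  rw [him] at b4
  calc ‖s - 1‖ * (2 * ‖(2 * (Real.pi : ℂ)) ^ (-(1 - s))‖ * ‖Complex.Gamma (1 - s)‖ *
        ‖Complex.cos (Real.pi * (1 - s) / 2)‖ * (‖s‖⁻¹ * ‖riemannZeta₁ (1 - s)‖))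
      ≤ (2 * ‖s‖) * (2 * 1 * G * Real.exp (2 * |s.im|) * (‖s‖⁻¹ * Real.exp (C + 16 + 2 * |s.im|))) := by
        gcongr
    _ = 4 * G * (Real.exp (2 * |s.im|) * Real.exp (C + 16 + 2 * |s.im|)) := by
        have : ‖s‖ ≠ 0 := by linarith
        field_simp; ring
    _ ≤ Real.exp (4 + G) * (Real.exp (2 * |s.im|) * Real.exp (C + 16 + 2 * |s.im|)) := by
        gcongr
        rw [Real.exp_add]
        have h4 : 4 ≤ Real.exp 4 := by linarith [Real.add_one_le_exp (4 : ℝ)]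
        have h5 : G ≤ Real.exp G := by linarith [Real.add_one_le_exp G]
        gcongr
    _ ≤ _ := by
        rw [← Real.exp_add, ← Real.exp_add]
        gcongr
        have := abs_nonneg s.im
        nlinarith [mul_nonneg hC.le this, mul_nonneg (sq_nonneg B) this, mul_nonneg hG0 this, sq_nonneg B]

lemma riemannZeta₁_eq_zero_iff {s : ℂ} : riemannZeta₁ s = 0 ↔ riemannZeta s = 0 := by
  rcases eq_or_ne s 1 with rfl | hs
  · simp [riemannZeta_one_ne_zero]
  · rw [riemannZeta₁_eq_of_ne_one hs, mul_eq_zero, sub_eq_zero]; simp [hs]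

lemma deriv_riemannZeta₁_of_zero {s : ℂ} (hs : riemannZeta s = 0) :
    deriv riemannZeta₁ s = (s - 1) * deriv riemannZeta s := by
  have hs1 : s ≠ 1 := by rintro rfl; exact riemannZeta_one_ne_zero hs
  have h : riemannZeta₁ =ᶠ[𝓝 s] fun w => (w - 1) * riemannZeta w := by
    filter_upwards [isOpen_ne.mem_nhds hs1] with w hw
    exact riemannZeta₁_eq_of_ne_one hw
  rw [h.deriv_eq]
  have := ((hasDerivAt_id s).sub_const 1).mul (differentiableAt_riemannZeta hs1).hasDerivAt
  refine (HasDerivAt.deriv this).trans ?_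
  rw [hs]; simp

lemma re_pos_of_riemannZeta_eq_zero {s : ℂ} (hs : riemannZeta s = 0) (h : s.im ≠ 0 ∨ -1 ≤ s.re) :
    0 < s.re ∧ s.re < 1 := by
  constructor
  · by_contra! h0
    exact riemannZeta_ne_zero_of_re_nonpos h0 h hs
  · by_contra! h0
    exact riemannZeta_ne_zero_of_one_le_re h0 hs

lemma norm_riemannZeta₁_two_add_ge (t : ℝ) : 1 / 3 ≤ ‖riemannZeta₁ (2 + t * Complex.I)‖ := by
  rw [riemannZeta₁_eq_of_ne_one (by intro h; have := congrArg Complex.re h; simp at this), norm_mul]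
  have h1 := norm_riemannZeta_ge (s := 2 + t * Complex.I) (by simp)
  have h2 : 1 ≤ ‖(2 + t * Complex.I - 1 : ℂ)‖ := by
    have := Complex.abs_re_le_norm (2 + t * Complex.I - 1 : ℂ)
    norm_num at this; exact this
  nlinarith

lemma exists_card_zeros_le : ∃ C : ℝ, 0 < C ∧ ∀ t : ℝ, ∀ S : Finset ℝ,
    (∀ γ ∈ S, riemannZeta (1 / 2 + γ * Complex.I) = 0 ∧ |γ - t| ≤ 1 / 4) →
      (S.card : ℝ) ≤ C * (1 + |t|) ^ (1 / 4 : ℝ) := by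
  obtain ⟨C, hC, hb⟩ := exists_norm_riemannZeta₁_le (σ := 3 / 10) (by norm_num)
  have hl : 0 < Real.log (17 / 16) := Real.log_pos (by norm_num)
  refine ⟨8 * (3 * C * 25) ^ (1 / 8 : ℝ) / Real.log (17 / 16), by positivity, fun t S hS => ?_⟩
  have hinj : Function.Injective fun γ : ℝ => ((-3 / 2 : ℂ) + (γ - t : ℝ) * Complex.I) := by
    intro a b h
    have := congrArg Complex.im h
    simpa using this
  have ht := abs_nonneg t
  have h := norm_mul_pow_card_zeros_le (f := fun s => riemannZeta₁ (s + (2 + t * Complex.I)))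
    (by fun_prop) (ρ := 8 / 5) (R := 17 / 10) (M := C * (5 * (1 + |t|)) ^ 2) (by norm_num) (by norm_num)
    (fun s hs => by
      have h1 := (abs_le.1 ((Complex.abs_re_le_norm s).trans hs)).1
      refine (hb _ (by simp; linarith)).trans ?_
      gcongr
      have : ‖s + (2 + t * Complex.I)‖ ≤ 17 / 10 + (2 + |t|) := by
        refine (norm_add_le _ _).trans (add_le_add hs ((norm_add_le _ _).trans ?_))
        simp
      linarith)
    (S.map ⟨_, hinj⟩)
    (fun p hp => by
      obtain ⟨γ, hγ, rfl⟩ := Finset.mem_map.1 hp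
      obtain ⟨h1, h2⟩ := hS γ hγ
      refine ⟨?_, ?_⟩
      · rw [riemannZeta₁_eq_zero_iff, ← h1]
        congr 1
        simp only [Function.Embedding.coeFn_mk]; push_cast; ring
      · simp only [Function.Embedding.coeFn_mk]
        rw [← sq_le_sq₀ (norm_nonneg _) (by norm_num), Complex.sq_norm, Complex.normSq_apply]
        have h3 := sq_abs (γ - t)
        have : |γ - t| ^ 2 ≤ (1 / 4) ^ 2 := by gcongr
        simp
        nlinarith)
  rw [Finset.card_map] at h
  simp only [zero_add] at h
  have h2 := norm_riemannZeta₁_two_add_ge t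
  have h3 : (17 / 16 : ℝ) ^ S.card ≤ 3 * C * 25 * (1 + |t|) ^ 2 := by
    have : (17 / 10 / (8 / 5) : ℝ) = 17 / 16 := by norm_num
    rw [this] at h
    have hp : (0 : ℝ) < (17 / 16) ^ S.card := by positivity
    nlinarith
  have h4 : S.card * Real.log (17 / 16) ≤ Real.log (3 * C * 25 * (1 + |t|) ^ 2) := by
    rw [← Real.log_pow]
    exact Real.log_le_log (by positivity) h3
  have h5 := Real.log_le_rpow_div (x := 3 * C * 25 * (1 + |t|) ^ 2) (by positivity) (ε := 1 / 8) (by norm_num)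
  rw [Real.mul_rpow (by positivity) (by positivity), ← Real.rpow_natCast (1 + |t|), ← Real.rpow_mul (by positivity)] at h5
  norm_num at h5
  rw [div_mul_eq_mul_div, le_div_iff₀ hl]
  refine (h4.trans (h5.trans (le_of_eq ?_)))
  norm_num
  ring

lemma exists_dist_ge_of_card {a b δ : ℝ} (hδ : 0 ≤ δ) (S : Finset ℝ)
    (h : 2 * δ * S.card < b - a) : ∃ T ∈ Set.Icc a b, ∀ γ ∈ S, δ ≤ |T - γ| := by
  by_contra! hcon
  have hsub : Set.Icc a b ⊆ ⋃ γ ∈ S, Metric.ball γ δ := by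
    intro T hT
    obtain ⟨γ, hγ, hd⟩ := hcon T hT
    exact Set.mem_biUnion hγ (by rwa [Metric.mem_ball, Real.dist_eq])
  have h1 := (measure_mono hsub).trans (measure_biUnion_finset_le (μ := volume) S _)
  simp only [Real.volume_Icc, Real.volume_ball, Finset.sum_const, nsmul_eq_mul] at h1
  rw [← ENNReal.ofReal_natCast, ← ENNReal.ofReal_mul (by positivity),
    ENNReal.ofReal_le_ofReal_iff (by positivity)] at h1
  linarith

lemma finite_zeros_im_mem_Icc (a b : ℝ) :
    {γ : ℝ | riemannZeta (1 / 2 + γ * Complex.I) = 0 ∧ γ ∈ Set.Icc a b}.Finite := by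
  have hinj : Function.Injective fun γ : ℝ => ((1 / 2 : ℂ) + γ * Complex.I) := by
    intro x y h
    have := congrArg Complex.im h
    simpa using this
  have h := ((isCompact_singleton (x := (1 / 2 : ℝ))).reProdIm (isCompact_Icc (a := a) (b := b)))
    |>.inter_riemannZetaZeros_finite
  refine (h.preimage hinj.injOn).subset ?_
  rintro γ ⟨h1, h2⟩
  refine ⟨⟨by simp, by simpa using h2⟩, h1⟩

/-- Along suitable heights `(s - 1) * ζ(s)` is not too small on horizontal segments. -/
lemma exists_heights
    (hRH : ∀ ρ : ℂ, riemannZeta ρ = 0 → 0 < ρ.re → ρ.re < 1 → ρ.re = 1 / 2)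
    (hsimple : ∀ ρ : ℂ, riemannZeta ρ = 0 → 0 < ρ.re → ρ.re < 1 → deriv riemannZeta ρ ≠ 0) :
    ∃ C : ℝ, ∃ T : ℕ → ℝ, Tendsto T atTop atTop ∧ (∀ n, 8 ≤ T n) ∧
      ∀ n, ∀ s : ℂ, -1 ≤ s.re → s.re ≤ 3 → |s.im| = T n →
        Real.exp (-(C * (T n) ^ (3 / 2 : ℝ))) ≤ ‖riemannZeta₁ s‖ := by
  obtain ⟨C₁, hC₁, hcount⟩ := exists_card_zeros_le
  obtain ⟨C₂, hC₂, hexp⟩ := exists_norm_riemannZeta₁_le_exp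
  have hT : ∀ n : ℕ, ∃ T ∈ Set.Icc ((n + 10 : ℝ) - 1 / 8) ((n + 10 : ℝ) + 1 / 8),
      ∀ γ : ℝ, riemannZeta (1 / 2 + γ * Complex.I) = 0 → 1 / (16 * (C₁ + 1) * T) ≤ |T - γ| := by
    intro n
    have hn : (0 : ℝ) ≤ n := Nat.cast_nonneg n
    have hfin := finite_zeros_im_mem_Icc ((n + 10 : ℝ) - 1 / 4) ((n + 10 : ℝ) + 1 / 4)
    have hcard := hcount (n + 10) hfin.toFinset (fun γ hγ => by
      obtain ⟨h1, h2, h3⟩ := hfin.mem_toFinset.1 hγ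
      refine ⟨h1, abs_le.2 ⟨by linarith, by linarith⟩⟩)
    have hcard' : (hfin.toFinset.card : ℝ) ≤ C₁ * (n + 11) := by
      refine hcard.trans ?_
      rw [abs_of_nonneg (by positivity)]
      gcongr
      calc (1 + ((n : ℝ) + 10)) ^ (1 / 4 : ℝ) ≤ (1 + ((n : ℝ) + 10)) ^ (1 : ℝ) :=
            Real.rpow_le_rpow_of_exponent_le (by linarith) (by norm_num)
        _ = _ := by rw [Real.rpow_one]; ring
    obtain ⟨T, hTm, hT⟩ := exists_dist_ge_of_card (a := (n + 10 : ℝ) - 1 / 8) (b := (n + 10 : ℝ) + 1 / 8)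
      (δ := 1 / (10 * (C₁ + 1) * (n + 11))) (by positivity) hfin.toFinset (by
        calc 2 * (1 / (10 * (C₁ + 1) * (n + 11))) * (hfin.toFinset.card : ℝ)
            ≤ 2 * (1 / (10 * (C₁ + 1) * (n + 11))) * (C₁ * (n + 11)) := by gcongr
          _ = 1 / 5 * (C₁ / (C₁ + 1)) := by field_simp; norm_num
          _ ≤ 1 / 5 * 1 := by
            gcongr
            rw [div_le_one (by positivity)]; linarith
          _ < _ := by norm_num)
    refine ⟨T, hTm, fun γ hγ => ?_⟩
    have hTn : (n : ℝ) + 9 ≤ T := by linarith [hTm.1]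
    by_cases hmem : γ ∈ hfin.toFinset
    · refine le_trans ?_ (hT γ hmem)
      apply one_div_le_one_div_of_le (by positivity)
      nlinarith
    · have h8 : 1 / 8 ≤ |T - γ| := by
        by_contra! hlt
        apply hmem
        rw [abs_lt] at hlt
        exact hfin.mem_toFinset.2 ⟨hγ, by linarith [hTm.1], by linarith [hTm.2]⟩
      refine le_trans ?_ h8
      apply one_div_le_one_div_of_le (by norm_num)
      nlinarith
  choose T hTm hT using hT
  have hT8 : ∀ n, 8 ≤ T n := fun n => by linarith [(hTm n).1, (Nat.cast_nonneg n : (0 : ℝ) ≤ n)]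
  have hl : 0 < Real.log (5 / 4) := Real.log_pos (by norm_num)
  set C₃ : ℝ := (2 + 2 * C₂) / Real.log (5 / 4) with hC₃
  have hC₃0 : 0 < C₃ := by positivity
  refine ⟨2 + 6 * (2 + 2 * C₂) + C₃ * (2 * (160 * (C₁ + 1)) ^ (1 / 2 : ℝ)), T, ?_, hT8, ?_⟩
  · refine tendsto_atTop_mono (fun n => (show (n : ℝ) ≤ T n by linarith [(hTm n).1])) tendsto_natCast_atTop_atTop
  intro n
  have hT0 : 0 < T n := by linarith [hT8 n]
  have key : ∀ s : ℂ, -1 ≤ s.re → s.re ≤ 3 → s.im = T n →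
        Real.exp (-((2 + 6 * (2 + 2 * C₂) + C₃ * (2 * (160 * (C₁ + 1)) ^ (1 / 2 : ℝ))) * (T n) ^ (3 / 2 : ℝ))) ≤ ‖riemannZeta₁ s‖ := by
    intro s h1 h2 h3
    set a : ℂ := 2 + T n * Complex.I with ha
    have hare : a.re = 2 := by simp [ha]
    have haim : a.im = T n := by simp [ha]
    have hfd : Differentiable ℂ fun w => riemannZeta₁ (w + a) := by fun_prop
    have hM : ∀ w : ℂ, ‖w‖ ≤ 5 → ‖riemannZeta₁ (w + a)‖ ≤ Real.exp (C₂ * (6 + T n)) := by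
      intro w hw
      have hre := abs_le.1 ((Complex.abs_re_le_norm w).trans hw)
      have him := abs_le.1 ((Complex.abs_im_le_norm w).trans hw)
      refine (hexp _ (by simp [hare]; linarith [hre.1]) (by simp [hare]; linarith [hre.2])).trans ?_
      refine Real.exp_le_exp.2 (mul_le_mul_of_nonneg_left ?_ hC₂.le)
      rw [Complex.add_im, haim]
      have : |w.im + T n| ≤ 5 + T n := abs_le.2 ⟨by linarith [him.1], by linarith [him.2]⟩
      linarith
    have hfin := ((isCompact_closedBall a 4).inter_riemannZetaZeros_finite)
    set P : Finset ℂ := hfin.toFinset.map (addRightEmbedding (-a)) with hP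
    have hPm : ∀ p ∈ P, ‖p‖ ≤ 4 ∧ riemannZeta (p + a) = 0 := by
      intro p hp
      obtain ⟨q, hq, rfl⟩ := Finset.mem_map.1 hp
      obtain ⟨hq1, hq2⟩ := hfin.mem_toFinset.1 hq
      change ‖q + -a‖ ≤ 4 ∧ riemannZeta (q + -a + a) = 0
      rw [neg_add_cancel_right, ← sub_eq_add_neg]
      exact ⟨by simpa [dist_eq_norm] using hq1, hq2⟩
    have hPstrip : ∀ p ∈ P, 0 < (p + a).re ∧ (p + a).re < 1 := by
      intro p hp
      obtain ⟨hp1, hp2⟩ := hPm p hp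
      refine re_pos_of_riemannZeta_eq_zero hp2 (Or.inl ?_)
      have := (abs_le.1 ((Complex.abs_im_le_norm p).trans hp1)).1
      simp only [Complex.add_im, haim]
      linarith [hT8 n]
    have hf0 : 1 / 3 ≤ ‖riemannZeta₁ (0 + a)‖ := by
      rw [zero_add]; exact norm_riemannZeta₁_two_add_ge _
    have hf0u : ‖riemannZeta₁ (0 + a)‖ < Real.exp (C₂ * (6 + T n)) := by
      rw [zero_add]
      refine (hexp a (by rw [hare]; norm_num) (by rw [hare]; norm_num)).trans_lt ?_
      rw [haim, abs_of_pos hT0]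
      gcongr
      norm_num
    have hlogM : Real.log (Real.exp (C₂ * (6 + T n)) / ‖riemannZeta₁ (0 + a)‖) ≤ (2 + 2 * C₂) * T n := by
      calc _ ≤ Real.log (Real.exp (C₂ * (6 + T n)) / (1 / 3)) := by gcongr
        _ = C₂ * (6 + T n) + Real.log 3 := by
            rw [div_div_eq_mul_div, div_one, Real.log_mul (Real.exp_ne_zero _) (by norm_num), Real.log_exp]
        _ ≤ _ := by
            have := Real.log_le_sub_one_of_pos (x := 3) (by norm_num)
            nlinarith [hT8 n]
    have hcardP : (P.card : ℝ) ≤ C₃ * T n := by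
      have h := norm_mul_pow_card_zeros_le hfd (ρ := 4) (R := 5) (by norm_num) (by norm_num) hM P
        (fun p hp => ⟨riemannZeta₁_eq_zero_iff.2 (hPm p hp).2, (hPm p hp).1⟩)
      rw [mul_comm, ← le_div_iff₀ (by linarith)] at h
      have := Real.log_le_log (by positivity) h
      rw [Real.log_pow] at this
      rw [hC₃, div_mul_eq_mul_div, le_div_iff₀ hl]
      exact this.trans hlogM
    have hδ : ∀ p ∈ P, 1 / (16 * (C₁ + 1) * T n) ≤ ‖(s - a) - p‖ := by
      intro p hp
      have hz := hRH _ (hPm p hp).2 (hPstrip p hp).1 (hPstrip p hp).2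
      have e : p + a = 1 / 2 + ((p + a).im : ℝ) * Complex.I := by
        apply Complex.ext <;> simp [hz]
      have h := hT n (p + a).im (by rw [← e]; exact (hPm p hp).2)
      refine h.trans ?_
      have := Complex.abs_im_le_norm (s - a - p)
      simp only [Complex.sub_im, h3] at this
      simpa [sub_sub, add_comm] using this
    have hlow := norm_ge_of_dist_zeros hfd (r := 3) (ρ := 4) (R := 5) (M := Real.exp (C₂ * (6 + T n)))
      (δ := 1 / (16 * (C₁ + 1) * T n)) (by norm_num) (by norm_num) (by norm_num) hM P
      (fun p hp => ⟨riemannZeta₁_eq_zero_iff.2 (hPm p hp).2, by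
        rw [deriv_comp_add_const, deriv_riemannZeta₁_of_zero (hPm p hp).2]
        refine mul_ne_zero ?_ (hsimple _ (hPm p hp).2 (hPstrip p hp).1 (hPstrip p hp).2)
        intro h0
        have := (hPstrip p hp).2
        rw [sub_eq_zero.1 h0] at this; simp at this, (hPm p hp).1⟩)
      (fun w hw hfw => Finset.mem_map.2 ⟨w + a, hfin.mem_toFinset.2
        ⟨by simpa [dist_eq_norm] using hw, riemannZeta₁_eq_zero_iff.1 hfw⟩, by simp⟩)
      (by intro h0; rw [h0] at hf0; norm_num at hf0) hf0u (by positivity) (s := s - a)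
      (by
        rw [← abs_of_nonneg (show (0 : ℝ) ≤ 3 by norm_num)]
        have e : s - a = ((s.re - 2 : ℝ) : ℂ) := by
          apply Complex.ext <;> simp [hare, haim, h3]
        rw [e, Complex.norm_real, Real.norm_eq_abs, abs_of_nonneg (show (0 : ℝ) ≤ 3 by norm_num)]
        exact abs_le.2 ⟨by linarith, by linarith⟩) hδ
    rw [sub_add_cancel] at hlow
    refine le_trans ?_ hlow
    have hT1 : T n ≤ T n ^ (3 / 2 : ℝ) := by
      calc T n = T n ^ (1 : ℝ) := (Real.rpow_one _).symm
        _ ≤ _ := Real.rpow_le_rpow_of_exponent_le (by linarith [hT8 n]) (by norm_num)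
    have e1 : Real.exp (-2) ≤ ‖riemannZeta₁ (0 + a)‖ := by
      refine le_trans ?_ hf0
      rw [Real.exp_neg, inv_eq_one_div]
      apply one_div_le_one_div_of_le (by norm_num)
      linarith [Real.add_one_le_exp (2 : ℝ)]
    have e2 : Real.exp (-(6 * (2 + 2 * C₂) * T n)) ≤ Real.exp (-(2 * Real.log (Real.exp (C₂ * (6 + T n)) / ‖riemannZeta₁ (0 + a)‖) * 3 / (4 - 3))) := by
      apply Real.exp_le_exp.2
      rw [show (4 - 3 : ℝ) = 1 by norm_num, div_one]
      linarith
    have e3 : Real.exp (-(C₃ * (2 * (160 * (C₁ + 1)) ^ (1 / 2 : ℝ)) * T n ^ (3 / 2 : ℝ))) ≤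
        (1 / (16 * (C₁ + 1) * T n) / (2 * 5)) ^ P.card := by
      have hx : 0 < 160 * (C₁ + 1) * T n := by positivity
      have e : 1 / (16 * (C₁ + 1) * T n) / (2 * 5) = Real.exp (-Real.log (160 * (C₁ + 1) * T n)) := by
        rw [Real.exp_neg, Real.exp_log hx]; field_simp; norm_num
      rw [e, ← Real.exp_nat_mul]
      apply Real.exp_le_exp.2
      have hlog := Real.log_le_rpow_div hx.le (ε := 1 / 2) (by norm_num)
      rw [Real.mul_rpow (by positivity) hT0.le] at hlog
      have h32 : T n ^ (3 / 2 : ℝ) = T n * T n ^ (1 / 2 : ℝ) := by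
        rw [← Real.rpow_one_add' hT0.le (by norm_num)]; norm_num
      rw [h32]
      have hlog0 : 0 ≤ Real.log (160 * (C₁ + 1) * T n) := Real.log_nonneg (by nlinarith [hT8 n])
      have : (P.card : ℝ) * Real.log (160 * (C₁ + 1) * T n) ≤ (C₃ * T n) *
          ((160 * (C₁ + 1)) ^ (1 / 2 : ℝ) * T n ^ (1 / 2 : ℝ) / (1 / 2)) := by gcongr
      linarith
    calc _ ≤ Real.exp (-2) * Real.exp (-(6 * (2 + 2 * C₂) * T n)) *
          Real.exp (-(C₃ * (2 * (160 * (C₁ + 1)) ^ (1 / 2 : ℝ)) * T n ^ (3 / 2 : ℝ))) := by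
            rw [← Real.exp_add, ← Real.exp_add]
            apply Real.exp_le_exp.2
            nlinarith [hT8 n]
      _ ≤ _ := by gcongr
  intro s h1 h2 h3
  rcases abs_eq (by linarith [hT8 n]) |>.1 h3 with h | h
  · exact key s h1 h2 h
  · have := key (starRingEnd ℂ s) (by simpa using h1) (by simpa using h2) (by simp [h])
    have hs : ∀ w : ℂ, w.im ≠ 0 → ‖riemannZeta₁ (starRingEnd ℂ w)‖ = ‖riemannZeta₁ w‖ := by
      intro w hw
      rw [riemannZeta₁_eq_of_ne_one (by intro h; apply hw; have := congrArg Complex.im h; simpa using this),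
        riemannZeta₁_eq_of_ne_one (by rintro rfl; simp at hw),
        riemannZeta_conj, norm_mul, norm_mul, RCLike.norm_conj, ← RCLike.norm_conj (w - 1)]
      simp
    rwa [hs s (by rw [h]; linarith [hT8 n])] at this

/-- The ordinates of the zeros of `ζ` on the critical line. -/
def zetaOrdinates : Set ℝ := {γ | riemannZeta (1 / 2 + γ * Complex.I) = 0}

lemma norm_exp_sub_sq_le {w s : ℂ} {R : ℝ} (hR : |w.re - s.re| ≤ R) :
    ‖Complex.exp ((w - s) ^ 2)‖ ≤ Real.exp (R ^ 2) * Real.exp (-(w.im - s.im) ^ 2) := by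
  rw [Complex.norm_exp, ← Real.exp_add]
  apply Real.exp_le_exp.2
  have : ((w - s) ^ 2).re = (w.re - s.re) ^ 2 - (w.im - s.im) ^ 2 := by
    rw [sq, Complex.mul_re]; simp; ring
  rw [this]
  have h2 : |w.re - s.re| ^ 2 ≤ R ^ 2 := by gcongr
  rw [sq_abs] at h2
  linarith

lemma norm_integral_vertical_le {F : ℂ → ℂ} {x t K T : ℝ}
    (hF : ∀ y : ℝ, ‖F (x + y * Complex.I)‖ ≤ K * Real.exp (-(y - t) ^ 2)) (hK : 0 ≤ K) (hT : 0 ≤ T) :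
    ‖∫ y : ℝ in -T..T, F (x + y * Complex.I)‖ ≤ K * Real.sqrt Real.pi := by
  have hIntegr : Integrable fun y : ℝ => K * Real.exp (-(y - t) ^ 2) := by
    have := (integrable_exp_neg_mul_sq (b := 1) one_pos).comp_sub_right t
    simpa using this.const_mul K
  refine (intervalIntegral.norm_integral_le_of_norm_le (by linarith)
    (Eventually.of_forall fun y _ => hF y) hIntegr.intervalIntegrable).trans ?_
  rw [intervalIntegral.integral_of_le (by linarith)]
  refine (setIntegral_le_integral hIntegr (Eventually.of_forall fun y => by positivity)).trans (le_of_eq ?_)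
  rw [integral_const_mul, integral_sub_right_eq_self (fun y : ℝ => Real.exp (-y ^ 2)) t]
  congr 1
  have := integral_gaussian 1
  simpa using this

lemma eventually_exponent_nonpos (C b : ℝ) :
    ∀ᶠ T : ℝ in atTop, 13 + T + C * T ^ (3 / 2 : ℝ) - (T - b) ^ 2 ≤ 0 := by
  have h1 := (tendsto_rpow_atTop (y := 1 / 2) (by norm_num)).eventually_ge_atTop (8 * |C|)
  filter_upwards [h1, eventually_ge_atTop 8, eventually_ge_atTop (8 * (13 + b ^ 2))] with T h1 h2 h3
  have h32 : T ^ (3 / 2 : ℝ) = T * T ^ (1 / 2 : ℝ) := by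
    rw [← Real.rpow_one_add' (by linarith) (by norm_num)]; norm_num
  have h22 : T ^ (1 / 2 : ℝ) * T ^ (1 / 2 : ℝ) = T := by
    rw [← Real.rpow_add (by linarith)]; norm_num
  have h4 : C * T ^ (3 / 2 : ℝ) ≤ T ^ 2 / 8 := by
    rw [h32]
    have : 0 ≤ T ^ (1 / 2 : ℝ) := by positivity
    have h5 : C * T ^ (1 / 2 : ℝ) ≤ T / 8 := by
      nlinarith [le_abs_self C, mul_le_mul_of_nonneg_right (le_abs_self C) this]
    nlinarith
  nlinarith [sq_nonneg (T - 2 * b), sq_nonneg b]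

lemma norm_sub_one_div_riemannZeta₁_le {s : ℂ} {c : ℝ} (hc : 0 < c) (hs : s ≠ 1) (h : c ≤ ‖riemannZeta s‖) :
    ‖(s - 1) / riemannZeta₁ s‖ ≤ 1 / c := by
  have hs' : s - 1 ≠ 0 := sub_ne_zero.2 hs
  rw [riemannZeta₁_eq_of_ne_one hs, div_mul_eq_div_div, div_self hs', norm_div, norm_one]
  exact one_div_le_one_div_of_le hc h

lemma exists_norm_inv_zeta_le
    (hRH : ∀ ρ : ℂ, riemannZeta ρ = 0 → 0 < ρ.re → ρ.re < 1 → ρ.re = 1 / 2)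
    (hsimple : ∀ ρ : ℂ, riemannZeta ρ = 0 → 0 < ρ.re → ρ.re < 1 → deriv riemannZeta ρ ≠ 0) :
    ∃ C : ℝ, 0 < C ∧ ∀ s : ℂ, 1 / 2 < s.re → s.re ≤ 2 →
      ENNReal.ofReal ‖(s - 1) / riemannZeta₁ s‖ ≤ ENNReal.ofReal C * (1 + ∑' γ : zetaOrdinates,
        ENNReal.ofReal (Real.exp (-((γ : ℝ) - s.im) ^ 2) /
          (‖deriv riemannZeta (1 / 2 + (γ : ℝ) * Complex.I)‖ * ‖s - (1 / 2 + (γ : ℝ) * Complex.I)‖))) := by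
  obtain ⟨C₀, T, hTt, hT8, hT⟩ := exists_heights hRH hsimple
  set B : ℝ := 63 * Real.exp 9 * Real.sqrt Real.pi + 8 * Real.exp 9 with hB
  have hB0 : 0 < B := by positivity
  refine ⟨max B (Real.exp 9), by positivity, fun s hs1 hs2 => ?_⟩
  have hζs : riemannZeta₁ s ≠ 0 := by
    intro h
    have h0 := riemannZeta₁_eq_zero_iff.1 h
    have h1 := re_pos_of_riemannZeta_eq_zero h0 (Or.inr (by linarith))
    have := hRH s h0 h1.1 h1.2
    linarith
  obtain ⟨n, hn1, hn2⟩ := ((hTt.eventually (eventually_exponent_nonpos C₀ |s.im|)).and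
    (hTt.eventually (eventually_ge_atTop (|s.im| + 1)))).exists
  set t := T n with ht
  have ht8 := hT8 n
  have him := abs_le.1 (show |s.im| ≤ t - 1 by linarith)
  set z : ℂ := ⟨-1, -t⟩ with hz
  set w : ℂ := ⟨3, t⟩ with hw
  set f : ℂ → ℂ := fun v => Complex.exp ((v - s) ^ 2) * ((v - 1) / riemannZeta₁ v) * (v - s)⁻¹ with hf
  have hfin : {γ : ℝ | riemannZeta (1 / 2 + γ * Complex.I) = 0 ∧ γ ∈ Set.Icc (-t) t}.Finite :=
    finite_zeros_im_mem_Icc (-t) t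
  have hinj : Function.Injective fun γ : ℝ => ((1 / 2 : ℂ) + γ * Complex.I) := by
    intro x y h
    have := congrArg Complex.im h
    simpa using this
  have hbd : ∀ v : ℂ, -1 ≤ v.re → v.re ≤ 3 → |v.im| = t → riemannZeta₁ v ≠ 0 := by
    intro v h1 h2 h3 h0
    have := hT n v h1 h2 h3
    rw [h0, norm_zero] at this
    exact absurd this (not_le.2 (Real.exp_pos _))
  have hsQ : s ∉ hfin.toFinset.map ⟨_, hinj⟩ := by
    intro h
    obtain ⟨γ, -, hγ⟩ := Finset.mem_map.1 h
    have := congrArg Complex.re hγ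
    simp at this
    linarith
  have hQ : ∀ γ ∈ hfin.toFinset, riemannZeta (1 / 2 + γ * Complex.I) = 0 ∧ -t < γ ∧ γ < t := by
    intro γ hγ
    obtain ⟨h1, h2, h3⟩ := hfin.mem_toFinset.1 hγ
    have hne : |γ| ≠ t := by
      intro h
      exact hbd (1 / 2 + γ * Complex.I) (by simp; norm_num) (by simp; norm_num) (by simpa using h)
        (riemannZeta₁_eq_zero_iff.2 h1)
    refine ⟨h1, lt_of_le_of_ne h2 ?_, lt_of_le_of_ne h3 ?_⟩
    · intro h; apply hne; rw [← h, abs_neg, abs_of_pos (by linarith)]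
    · intro h; apply hne; rw [h, abs_of_pos (by linarith)]
  have hres := rectIntegral_eq_sum_residues (z := z) (w := w) (by simp [hz, hw]; norm_num)
    (by simp [hz, hw]; linarith) (Finset.cons s (hfin.toFinset.map ⟨_, hinj⟩) hsQ)
    (fun v => if v = s then (s - 1) / riemannZeta₁ s else
      Complex.exp ((v - s) ^ 2) / (deriv riemannZeta v * (v - s))) f
    (by
      intro p hp
      rcases Finset.mem_cons.1 hp with rfl | hp
      · exact ⟨by simp [hz]; linarith, by simp [hw]; linarith, by simp [hz]; linarith, by simp [hw]; linarith⟩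
      · obtain ⟨γ, hγ, rfl⟩ := Finset.mem_map.1 hp
        obtain ⟨h1, h2, h3⟩ := hQ γ hγ
        exact ⟨by simp [hz]; norm_num, by simp [hw]; norm_num, by simpa [hz] using h2, by simpa [hw] using h3⟩)
    (by
      intro v hv1 hv2 hv
      simp only [hz, hw] at hv1 hv2
      have hvs : v - s ≠ 0 := by
        intro h; exact hv (Finset.mem_cons.2 (Or.inl (sub_eq_zero.1 h)))
      have hζv : riemannZeta₁ v ≠ 0 := by
        intro h
        have h0 := riemannZeta₁_eq_zero_iff.1 h
        have h1 := re_pos_of_riemannZeta_eq_zero h0 (Or.inr hv1.1)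
        have h2 := hRH v h0 h1.1 h1.2
        have e : (1 / 2 : ℂ) + v.im * Complex.I = v := by
          apply Complex.ext <;> simp [h2]
        exact hv (Finset.mem_cons.2 (Or.inr (Finset.mem_map.2 ⟨v.im, hfin.mem_toFinset.2
          ⟨by rw [e]; exact h0, hv2⟩, e⟩)))
      have hd := differentiable_riemannZeta₁ v
      exact ((by fun_prop : DifferentiableAt ℂ (fun v => Complex.exp ((v - s) ^ 2)) v).mul
        ((differentiableAt_id.sub_const 1).div hd hζv)).mul
        (DifferentiableAt.inv (by fun_prop) hvs))
    (by
      intro p hp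
      rcases Finset.mem_cons.1 hp with rfl | hp
      · rw [if_pos rfl]
        have h1 : ContinuousAt (fun v => Complex.exp ((v - p) ^ 2) * ((v - 1) / riemannZeta₁ v)) p := by
          have hd := (differentiable_riemannZeta₁ p).continuousAt
          exact (by fun_prop : ContinuousAt (fun v => Complex.exp ((v - p) ^ 2)) p).mul
            ((by fun_prop : ContinuousAt (fun v : ℂ => v - 1) p).div hd hζs)
        have h2 := h1.tendsto.mono_left (nhdsWithin_le_nhds (s := {p}ᶜ))
        simp only [sub_self, ne_eq, OfNat.ofNat_ne_zero, not_false_eq_true, zero_pow, Complex.exp_zero, one_mul] at h2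
        refine h2.congr' ?_
        filter_upwards [self_mem_nhdsWithin] with v hv
        have hv' : v - p ≠ 0 := sub_ne_zero.2 hv
        simp only [hf]
        field_simp
      · have hps : p ≠ s := by
          intro h
          rw [h] at hp
          exact hsQ hp
        rw [if_neg hps]
        obtain ⟨γ, hγ, rfl⟩ := Finset.mem_map.1 hp
        obtain ⟨h1, h2, h3⟩ := hQ γ hγ
        simp only [Function.Embedding.coeFn_mk] at hps ⊢
        set p : ℂ := 1 / 2 + γ * Complex.I with hp'
        have hp1 : p - 1 ≠ 0 := by
          intro h; have := congrArg Complex.re h; simp [hp'] at this; norm_num at this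
        have hd' : deriv riemannZeta p ≠ 0 := hsimple p h1 (by simp [hp']) (by simp [hp']; norm_num)
        have hd := (differentiable_riemannZeta₁ p).hasDerivAt
        rw [deriv_riemannZeta₁_of_zero h1] at hd
        have h4 := (hasDerivAt_iff_tendsto_slope.1 hd).inv₀ (mul_ne_zero hp1 hd')
        have h5 : ContinuousAt (fun v => Complex.exp ((v - s) ^ 2) * (v - 1) * (v - s)⁻¹) p := by
          exact (by fun_prop : ContinuousAt (fun v => Complex.exp ((v - s) ^ 2) * (v - 1)) p).mul
            (ContinuousAt.inv₀ (by fun_prop) (sub_ne_zero.2 hps))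
        have h6 := (h5.tendsto.mono_left (nhdsWithin_le_nhds (s := {p}ᶜ))).mul h4
        have e : Complex.exp ((p - s) ^ 2) / (deriv riemannZeta p * (p - s)) =
            Complex.exp ((p - s) ^ 2) * (p - 1) * (p - s)⁻¹ * ((p - 1) * deriv riemannZeta p)⁻¹ := by
          have := sub_ne_zero.2 hps
          field_simp
        rw [e]
        refine h6.congr fun v => ?_
        simp only [hf, slope_def_field, riemannZeta₁_eq_zero_iff.2 h1, sub_zero]
        rw [inv_div]; ring)
  rw [Finset.sum_cons, if_pos rfl, Finset.sum_map] at hres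
  have hsum : ∑ γ ∈ hfin.toFinset, (if ((1 / 2 : ℂ) + γ * Complex.I) = s then (s - 1) / riemannZeta₁ s else
      Complex.exp (((1 / 2 : ℂ) + γ * Complex.I - s) ^ 2) /
        (deriv riemannZeta ((1 / 2 : ℂ) + γ * Complex.I) * ((1 / 2 : ℂ) + γ * Complex.I - s))) =
      ∑ γ ∈ hfin.toFinset, Complex.exp (((1 / 2 : ℂ) + γ * Complex.I - s) ^ 2) /
        (deriv riemannZeta ((1 / 2 : ℂ) + γ * Complex.I) * ((1 / 2 : ℂ) + γ * Complex.I - s)) := by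
    refine Finset.sum_congr rfl fun γ hγ => if_neg fun h => hsQ ?_
    exact Finset.mem_map.2 ⟨γ, hγ, h⟩
  simp only [Function.Embedding.coeFn_mk] at hres
  rw [hsum] at hres
  have hhor : ∀ u : ℝ, |u| = t → ‖∫ x : ℝ in z.re..w.re, f (x + u * Complex.I)‖ ≤ 4 * Real.exp 9 := by
    intro u hu
    have := intervalIntegral.norm_integral_le_of_norm_le_const (a := z.re) (b := w.re) (C := Real.exp 9)
      (f := fun x : ℝ => f (x + u * Complex.I)) (fun x hx => by
        rw [Set.uIoc_of_le (by simp [hz, hw]; norm_num)] at hx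
        have hx1 : -1 < x := hx.1
        have hx2 : x ≤ 3 := hx.2
        simp only [hf]
        rw [norm_mul, norm_mul, norm_inv, norm_div]
        set v : ℂ := x + u * Complex.I with hv
        have hvre : v.re = x := by simp [hv]
        have hvim : v.im = u := by simp [hv]
        have hb1 := norm_exp_sub_sq_le (w := v) (s := s) (R := 3) (by rw [hvre]; exact abs_le.2 ⟨by linarith, by linarith⟩)
        have hb2 := hT n v (by rw [hvre]; exact hx1.le) (by rw [hvre]; exact hx2) (by rw [hvim]; exact hu)
        have hus : t - |s.im| ≤ |u - s.im| := by rw [← hu]; exact abs_sub_abs_le_abs_sub u s.im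
        have hb3 : 1 ≤ ‖v - s‖ := by
          have := Complex.abs_im_le_norm (v - s)
          rw [Complex.sub_im, hvim] at this
          linarith
        have hb4 : ‖v - 1‖ ≤ Real.exp (4 + t) := by
          have : ‖v - 1‖ ≤ 4 + t := by
            refine (Complex.norm_le_abs_re_add_abs_im _).trans ?_
            simp only [Complex.sub_re, Complex.sub_im, hvre, hvim, Complex.one_re, Complex.one_im, sub_zero, hu]
            have : |x - 1| ≤ 4 := abs_le.2 ⟨by linarith, by linarith⟩
            linarith
          linarith [Real.add_one_le_exp (4 + t)]
        have hsq : (t - |s.im|) ^ 2 ≤ (u - s.im) ^ 2 := by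
          rw [← sq_abs (u - s.im)]
          have : 0 ≤ t - |s.im| := by linarith
          gcongr
        rw [hvim] at hb1
        calc _ ≤ (Real.exp (3 ^ 2) * Real.exp (-(u - s.im) ^ 2)) * (Real.exp (4 + t) /
              Real.exp (-(C₀ * t ^ (3 / 2 : ℝ)))) * 1 := by
              gcongr
              exact inv_le_one_of_one_le₀ hb3
          _ = Real.exp (3 ^ 2) * Real.exp (-(u - s.im) ^ 2 + (4 + t) + C₀ * t ^ (3 / 2 : ℝ)) := by
              rw [Real.exp_neg (C₀ * _), div_inv_eq_mul,
                Real.exp_add (-(u - s.im) ^ 2 + (4 + t)) (C₀ * t ^ (3 / 2 : ℝ)),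
                Real.exp_add (-(u - s.im) ^ 2) (4 + t)]
              ring
          _ ≤ Real.exp (3 ^ 2) * 1 := by
              gcongr
              rw [Real.exp_le_one_iff]
              linarith
          _ = Real.exp 9 := by norm_num)
    refine this.trans (le_of_eq ?_)
    simp only [hz, hw]
    norm_num; ring
  have hver : ∀ x c : ℝ, 0 < c → |x - s.re| ≤ 3 → 1 ≤ |x - s.re| → x ≠ 1 →
      (∀ y : ℝ, c ≤ ‖riemannZeta (x + y * Complex.I)‖) →
      ‖∫ y : ℝ in -t..t, f (x + y * Complex.I)‖ ≤ 1 / c * Real.exp 9 * Real.sqrt Real.pi := by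
    intro x c hc hx3 hx1 hx hζ
    refine norm_integral_vertical_le (t := s.im) (fun y => ?_) (by positivity) (by linarith)
    simp only [hf]
    rw [norm_mul, norm_mul, norm_inv]
    have hb1 := norm_exp_sub_sq_le (w := x + y * Complex.I) (s := s) (R := 3) (by simpa using hx3)
    have hb2 := norm_sub_one_div_riemannZeta₁_le hc (s := x + y * Complex.I)
      (by intro h; apply hx; have := congrArg Complex.re h; simpa using this) (hζ y)
    have hb3 : 1 ≤ ‖(x + y * Complex.I : ℂ) - s‖ := by
      have := Complex.abs_re_le_norm ((x + y * Complex.I : ℂ) - s)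
      simp at this
      linarith
    have e : ((x + y * Complex.I : ℂ)).im = y := by simp
    rw [e] at hb1
    calc _ ≤ (Real.exp (3 ^ 2) * Real.exp (-(y - s.im) ^ 2)) * (1 / c) * 1 := by
          gcongr
          exact inv_le_one_of_one_le₀ hb3
      _ = _ := by norm_num; ring
  have hright := hver 3 (1 / 3) (by norm_num) (abs_le.2 ⟨by linarith, by linarith⟩)
    (le_abs.2 (Or.inl (by linarith))) (by norm_num) (fun y => norm_riemannZeta_ge (by simp; norm_num))
  have hleft := hver (-1) (1 / 60) (by norm_num) (abs_le.2 ⟨by linarith, by linarith⟩)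
    (le_abs.2 (Or.inr (by linarith))) (by norm_num) (fun y => by
      have := norm_riemannZeta_neg_one_add_ge y; push_cast; exact this)
  have hrect : ‖rectIntegral f z w‖ ≤ B := by
    unfold rectIntegral
    have e1 := hhor z.im (by simp only [hz]; rw [abs_neg, abs_of_pos (by linarith)])
    have e2 := hhor w.im (by simp only [hw]; rw [abs_of_pos (by linarith)])
    refine (norm_sub_le _ _).trans ?_
    refine (add_le_add (norm_add_le _ _) le_rfl).trans ?_
    refine (add_le_add (add_le_add (norm_sub_le _ _) le_rfl) le_rfl).trans ?_
    rw [norm_smul, norm_smul, Complex.norm_I, one_mul, one_mul]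
    have e3 : ‖∫ y : ℝ in z.im..w.im, f (w.re + y * Complex.I)‖ ≤ 1 / (1 / 3) * Real.exp 9 * Real.sqrt Real.pi := hright
    have e4 : ‖∫ y : ℝ in z.im..w.im, f (z.re + y * Complex.I)‖ ≤ 1 / (1 / 60) * Real.exp 9 * Real.sqrt Real.pi := hleft
    rw [hB]
    norm_num at e3 e4
    linarith
  have hfinal : ‖(s - 1) / riemannZeta₁ s‖ ≤ max B (Real.exp 9) * (1 + ∑ γ ∈ hfin.toFinset,
      Real.exp (-(γ - s.im) ^ 2) /
          (‖deriv riemannZeta (1 / 2 + γ * Complex.I)‖ * ‖s - (1 / 2 + γ * Complex.I)‖)) := by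
    have h2pi : ‖(2 * Real.pi * Complex.I : ℂ)‖ = 2 * Real.pi := by
      simp [abs_of_pos Real.pi_pos]
    have h1 : (s - 1) / riemannZeta₁ s = (2 * Real.pi * Complex.I)⁻¹ * rectIntegral f z w -
        ∑ γ ∈ hfin.toFinset, Complex.exp (((1 / 2 : ℂ) + γ * Complex.I - s) ^ 2) /
        (deriv riemannZeta ((1 / 2 : ℂ) + γ * Complex.I) * ((1 / 2 : ℂ) + γ * Complex.I - s)) := by
      have h2pi0 : (2 * Real.pi * Complex.I : ℂ) ≠ 0 := by
        rw [← norm_ne_zero_iff, h2pi]; positivity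
      rw [hres, inv_mul_cancel_left₀ h2pi0]; ring
    rw [h1]
    refine (norm_sub_le _ _).trans ?_
    rw [mul_add, mul_one]
    refine add_le_add ?_ ?_
    · rw [norm_mul, norm_inv, h2pi]
      refine le_trans ?_ (le_max_left _ _)
      refine (mul_le_of_le_one_left (norm_nonneg _) (inv_le_one_of_one_le₀ ?_)).trans hrect
      linarith [Real.pi_gt_three]
    · rw [Finset.mul_sum]
      refine (norm_sum_le _ _).trans (Finset.sum_le_sum fun γ hγ => ?_)
      rw [norm_div, norm_mul, norm_sub_rev _ s, ← mul_div_assoc]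
      gcongr
      have := norm_exp_sub_sq_le (w := 1 / 2 + γ * Complex.I) (s := s) (R := 3)
        (by simp; exact abs_le.2 ⟨by linarith, by linarith⟩)
      have e : ((1 / 2 : ℂ) + γ * Complex.I).im = γ := by simp
      rw [e] at this
      refine this.trans ?_
      gcongr
      refine le_trans (le_of_eq ?_) (le_max_right _ _)
      norm_num
  refine (ENNReal.ofReal_le_ofReal hfinal).trans ?_
  rw [ENNReal.ofReal_mul (by positivity), ENNReal.ofReal_add zero_le_one
    (Finset.sum_nonneg fun γ _ => by positivity), ENNReal.ofReal_one,
    ENNReal.ofReal_sum_of_nonneg (fun γ _ => by positivity)]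
  gcongr
  rw [tsum_subtype zetaOrdinates (fun γ : ℝ => ENNReal.ofReal (Real.exp (-(γ - s.im) ^ 2) /
          (‖deriv riemannZeta (1 / 2 + γ * Complex.I)‖ * ‖s - (1 / 2 + γ * Complex.I)‖)))]
  refine le_trans (le_of_eq ?_) (ENNReal.sum_le_tsum hfin.toFinset)
  refine Finset.sum_congr rfl fun γ hγ => ?_
  rw [Set.indicator_of_mem]
  exact (hQ γ hγ).1

lemma countable_zetaOrdinates : zetaOrdinates.Countable := by
  have : zetaOrdinates = ⋃ n : ℕ, {γ : ℝ | riemannZeta (1 / 2 + γ * Complex.I) = 0 ∧ γ ∈ Set.Icc (-n : ℝ) n} := by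
    ext γ
    simp only [zetaOrdinates, Set.mem_ofPred_eq, Set.mem_iUnion, Set.mem_Icc]
    constructor
    · intro h
      obtain ⟨n, hn⟩ := exists_nat_ge |γ|
      exact ⟨n, h, abs_le.1 hn⟩
    · rintro ⟨n, h, -⟩
      exact h
  rw [this]
  exact Set.countable_iUnion fun n => (finite_zeros_im_mem_Icc _ _).countable

instance : Countable zetaOrdinates := countable_zetaOrdinates.to_subtype

lemma ENNReal.tsum_mul_sq_le {ι : Type*} (f g : ι → ENNReal) :
    (∑' i, f i * g i) ^ 2 ≤ (∑' i, f i ^ 2) * ∑' i, g i ^ 2 := by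
  let _ : MeasurableSpace ι := ⊤
  have h := ENNReal.lintegral_mul_le_Lp_mul_Lq (Measure.count : Measure ι) Real.HolderConjugate.two_two
    (f := f) (g := g) (measurable_from_top).aemeasurable (measurable_from_top).aemeasurable
  simp only [Pi.mul_apply] at h
  rw [lintegral_count' (measurable_from_top), lintegral_count' (measurable_from_top),
    lintegral_count' (measurable_from_top)] at h
  refine (pow_le_pow_left' h 2).trans (le_of_eq ?_)
  rw [mul_pow, ← ENNReal.rpow_natCast, ← ENNReal.rpow_natCast, ← ENNReal.rpow_mul, ← ENNReal.rpow_mul]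
  norm_num

lemma one_add_abs_le_mul (a b : ℝ) : 1 + |a| ≤ (1 + |b|) * (1 + |a - b|) := by
  have h1 : |a| ≤ |b| + |a - b| := by
    calc |a| = |b + (a - b)| := by ring_nf
      _ ≤ _ := abs_add_le _ _
  nlinarith [abs_nonneg b, abs_nonneg (a - b), mul_nonneg (abs_nonneg b) (abs_nonneg (a - b))]

lemma one_add_abs_sq_le_exp (u : ℝ) : (1 + |u|) ^ 2 ≤ 4 * Real.exp (u ^ 2 / 2) := by
  have := Real.add_one_le_exp (u ^ 2 / 2)
  nlinarith [sq_abs u, sq_nonneg (|u| - 1)]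

lemma rpow_neg_mul_exp_le {a : ℝ} (ha : 0 ≤ a) (ha2 : a ≤ 2) (γ t : ℝ) :
    (1 + |t|) ^ (-a) * Real.exp (-(γ - t) ^ 2) ≤
      4 * ((1 + |γ|) ^ (-a) * Real.exp (-(γ - t) ^ 2 / 2)) := by
  have h1 : (1 + |γ|) ^ a ≤ (1 + |t|) ^ a * (4 * Real.exp ((γ - t) ^ 2 / 2)) := by
    calc (1 + |γ|) ^ a ≤ ((1 + |t|) * (1 + |γ - t|)) ^ a :=
          Real.rpow_le_rpow (by positivity) (one_add_abs_le_mul γ t) ha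
      _ = (1 + |t|) ^ a * (1 + |γ - t|) ^ a := Real.mul_rpow (by positivity) (by positivity)
      _ ≤ (1 + |t|) ^ a * (1 + |γ - t|) ^ (2 : ℝ) := by
          gcongr
          linarith [abs_nonneg (γ - t)]
      _ ≤ _ := by
          gcongr
          rw [Real.rpow_two]
          exact one_add_abs_sq_le_exp _
  have e : Real.exp (-(γ - t) ^ 2) = Real.exp (-(γ - t) ^ 2 / 2) * Real.exp (-(γ - t) ^ 2 / 2) := by
    rw [← Real.exp_add]; congr 1; ring
  have e2 : Real.exp ((γ - t) ^ 2 / 2) * Real.exp (-(γ - t) ^ 2 / 2) = 1 := by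
    rw [← Real.exp_add, ← Real.exp_zero]; congr 1; ring
  rw [Real.rpow_neg (by positivity), Real.rpow_neg (by positivity), e]
  have p1 : 0 < (1 + |γ|) ^ a := by positivity
  have p2 : 0 < (1 + |t|) ^ a := by positivity
  have p3 := Real.exp_pos (-(γ - t) ^ 2 / 2)
  generalize Real.exp (-(γ - t) ^ 2 / 2) = E at *
  generalize Real.exp ((γ - t) ^ 2 / 2) = E' at *
  rw [inv_mul_eq_div, inv_mul_eq_div, div_le_iff₀ p2]
  rw [show 4 * (E / (1 + |γ|) ^ a) * (1 + |t|) ^ a = 4 * E * (1 + |t|) ^ a / (1 + |γ|) ^ a by ring,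
    le_div_iff₀ p1]
  calc E * E * (1 + |γ|) ^ a ≤ E * E * ((1 + |t|) ^ a * (4 * E')) := by gcongr
    _ = 4 * E * (1 + |t|) ^ a * (E' * E) := by ring
    _ = _ := by rw [e2, mul_one]

lemma tsum_indicator_abs_sub_le {C : ℝ} (hcount : ∀ t : ℝ, ∀ S : Finset ℝ,
    (∀ γ ∈ S, riemannZeta (1 / 2 + γ * Complex.I) = 0 ∧ |γ - t| ≤ 1 / 4) →
      (S.card : ℝ) ≤ C * (1 + |t|) ^ (1 / 4 : ℝ)) (u : ℝ) :
    ∑' γ : zetaOrdinates, (Set.Icc ((γ : ℝ) - 1 / 4) (γ + 1 / 4)).indicator (1 : ℝ → ENNReal) u ≤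
      ENNReal.ofReal (C * (1 + |u|) ^ (1 / 4 : ℝ)) := by
  rw [tsum_subtype zetaOrdinates
    (fun γ : ℝ => (Set.Icc (γ - 1 / 4) (γ + 1 / 4)).indicator (1 : ℝ → ENNReal) u)]
  rw [ENNReal.tsum_eq_iSup_sum]
  refine iSup_le fun S => ?_
  classical
  have hS := hcount u (S.filter fun γ => γ ∈ zetaOrdinates ∧ |γ - u| ≤ 1 / 4)
    (fun γ hγ => (Finset.mem_filter.1 hγ).2)
  refine le_trans (le_of_eq ?_) (ENNReal.ofReal_le_ofReal hS)
  rw [ENNReal.ofReal_natCast, Finset.card_filter, Nat.cast_sum]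
  refine Finset.sum_congr rfl fun γ _ => ?_
  by_cases h1 : γ ∈ zetaOrdinates
  · by_cases h2 : |γ - u| ≤ 1 / 4
    · have := abs_le.1 h2
      rw [if_pos ⟨h1, h2⟩, Set.indicator_of_mem h1, Set.indicator_of_mem (show u ∈ Set.Icc (γ - 1 / 4) (γ + 1 / 4) from
        ⟨by linarith, by linarith⟩)]
      simp
    · rw [if_neg (fun h => h2 h.2), Set.indicator_of_mem h1, Set.indicator_of_notMem]
      · simp
      · rintro ⟨h3, h4⟩
        exact h2 (abs_le.2 ⟨by linarith, by linarith⟩)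
  · rw [if_neg (fun h => h1 h.1), Set.indicator_of_notMem h1]
    simp

lemma exists_tsum_exp_neg_sq_le : ∃ C : ℝ, 0 < C ∧ ∀ t : ℝ,
    ∑' γ : zetaOrdinates, ENNReal.ofReal (Real.exp (-((γ : ℝ) - t) ^ 2)) ≤
      ENNReal.ofReal (C * (1 + |t|) ^ (1 / 4 : ℝ)) := by
  obtain ⟨C, hC, hcount⟩ := exists_card_zeros_le
  have hIntegr : Integrable fun v : ℝ => Real.exp (-v ^ 2 / 4) := by
    have := integrable_exp_neg_mul_sq (b := 1 / 4) (by norm_num)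
    refine this.congr (Eventually.of_forall fun v => ?_)
    simp only; congr 1; ring
  set J : ℝ := ∫ v : ℝ, Real.exp (-v ^ 2 / 4) with hJ
  have hJ0 : 0 ≤ J := integral_nonneg fun v => by positivity
  set K : ℝ := 2 * Real.exp (1 / 16) with hK
  refine ⟨K * (C * (2 * J)) + 1, by positivity, fun t => ?_⟩
  have hpt : ∀ γ : zetaOrdinates, ENNReal.ofReal (Real.exp (-((γ : ℝ) - t) ^ 2)) ≤
      ∫⁻ u, ENNReal.ofReal (K * Real.exp (-(u - t) ^ 2 / 2)) *
        (Set.Icc ((γ : ℝ) - 1 / 4) (γ + 1 / 4)).indicator 1 u := by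
    intro γ
    have h1 : ∫⁻ u in Set.Icc ((γ : ℝ) - 1 / 4) (γ + 1 / 4), ENNReal.ofReal (2 * Real.exp (-((γ : ℝ) - t) ^ 2)) =
        ENNReal.ofReal (Real.exp (-((γ : ℝ) - t) ^ 2)) := by
      rw [setLIntegral_const, Real.volume_Icc, ← ENNReal.ofReal_mul (by positivity)]
      congr 1; ring
    rw [← h1, ← lintegral_indicator measurableSet_Icc]
    refine lintegral_mono fun u => ?_
    by_cases hu : u ∈ Set.Icc ((γ : ℝ) - 1 / 4) (γ + 1 / 4)
    · rw [Set.indicator_of_mem hu, Set.indicator_of_mem hu, Pi.one_apply, mul_one]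
      apply ENNReal.ofReal_le_ofReal
      rw [hK, mul_assoc, ← Real.exp_add]
      gcongr
      have : |u - γ| ≤ 1 / 4 := abs_le.2 ⟨by linarith [hu.1], by linarith [hu.2]⟩
      have h2 : (u - γ) ^ 2 ≤ 1 / 16 := by
        rw [← sq_abs]; nlinarith [abs_nonneg (u - γ)]
      nlinarith [sq_nonneg ((γ - t) - (u - γ))]
    · rw [Set.indicator_of_notMem hu]; exact zero_le
  refine (ENNReal.tsum_le_tsum hpt).trans ?_
  rw [← lintegral_tsum (fun γ => by
    refine Measurable.aemeasurable ?_
    exact (by fun_prop : Measurable fun u : ℝ => ENNReal.ofReal (K * Real.exp (-(u - t) ^ 2 / 2))).mul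
      (measurable_one.indicator measurableSet_Icc))]
  have h3 : ∀ u : ℝ, ∑' γ : zetaOrdinates, ENNReal.ofReal (K * Real.exp (-(u - t) ^ 2 / 2)) *
        (Set.Icc ((γ : ℝ) - 1 / 4) (γ + 1 / 4)).indicator 1 u ≤
      ENNReal.ofReal (K * (C * 2) * (1 + |t|) ^ (1 / 4 : ℝ) * Real.exp (-(u - t) ^ 2 / 4)) := by
    intro u
    rw [ENNReal.tsum_mul_left]
    refine (mul_le_mul_right (tsum_indicator_abs_sub_le hcount u) _).trans ?_
    rw [← ENNReal.ofReal_mul (by positivity)]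
    apply ENNReal.ofReal_le_ofReal
    have h4 : (1 + |u|) ^ (1 / 4 : ℝ) ≤ (1 + |t|) ^ (1 / 4 : ℝ) * (1 + |u - t|) := by
      calc (1 + |u|) ^ (1 / 4 : ℝ) ≤ ((1 + |t|) * (1 + |u - t|)) ^ (1 / 4 : ℝ) :=
            Real.rpow_le_rpow (by positivity) (one_add_abs_le_mul u t) (by norm_num)
        _ = (1 + |t|) ^ (1 / 4 : ℝ) * (1 + |u - t|) ^ (1 / 4 : ℝ) :=
            Real.mul_rpow (by positivity) (by positivity)
        _ ≤ (1 + |t|) ^ (1 / 4 : ℝ) * (1 + |u - t|) ^ (1 : ℝ) := by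
            gcongr
            · linarith [abs_nonneg (u - t)]
            · norm_num
        _ = _ := by rw [Real.rpow_one]
    have h5 : 1 + |u - t| ≤ 2 * Real.exp ((u - t) ^ 2 / 4) := by
      have h := one_add_abs_sq_le_exp (u - t)
      have e : 4 * Real.exp ((u - t) ^ 2 / 2) = (2 * Real.exp ((u - t) ^ 2 / 4)) ^ 2 := by
        rw [mul_pow, ← Real.exp_nat_mul]; norm_num; ring_nf
      rw [e] at h
      exact (sq_le_sq₀ (by positivity) (by positivity)).1 h
    have e : Real.exp (-(u - t) ^ 2 / 4) = Real.exp ((u - t) ^ 2 / 4) * Real.exp (-(u - t) ^ 2 / 2) := by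
      rw [← Real.exp_add]; congr 1; ring
    calc K * Real.exp (-(u - t) ^ 2 / 2) * (C * (1 + |u|) ^ (1 / 4 : ℝ)) ≤
        K * Real.exp (-(u - t) ^ 2 / 2) * (C * ((1 + |t|) ^ (1 / 4 : ℝ) * (2 * Real.exp ((u - t) ^ 2 / 4)))) := by
          gcongr
          exact h4.trans (by gcongr)
      _ = _ := by rw [e]; ring
  refine (lintegral_mono h3).trans ?_
  rw [← ofReal_integral_eq_lintegral_ofReal ((hIntegr.comp_sub_right t).const_mul _)
    (Eventually.of_forall fun u => by positivity), integral_const_mul,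
    integral_sub_right_eq_self (fun u : ℝ => Real.exp (-u ^ 2 / 4)) t, ← hJ]
  apply ENNReal.ofReal_le_ofReal
  have : 0 ≤ (1 + |t|) ^ (1 / 4 : ℝ) := by positivity
  nlinarith

lemma riemannZeta_one_half_ne_zero
    (hsimple : ∀ ρ : ℂ, riemannZeta ρ = 0 → 0 < ρ.re → ρ.re < 1 → deriv riemannZeta ρ ≠ 0) :
    riemannZeta (1 / 2) ≠ 0 := by
  intro h0
  have hne0 : (1 / 2 : ℂ) ≠ 0 := by norm_num
  have hne1 : (1 / 2 : ℂ) ≠ 1 := by norm_num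
  have hd := differentiableAt_completedZeta hne0 hne1
  have hΛ : deriv completedRiemannZeta (1 / 2) = 0 := by
    have h1 : HasDerivAt (fun s : ℂ => completedRiemannZeta (1 - s)) (-deriv completedRiemannZeta (1 / 2)) (1 / 2) := by
      have h2 : HasDerivAt completedRiemannZeta (deriv completedRiemannZeta (1 / 2)) (1 - 1 / 2) := by
        rw [show (1 : ℂ) - 1 / 2 = 1 / 2 by norm_num]; exact hd.hasDerivAt
      have h4 := h2.comp (1 / 2 : ℂ) ((hasDerivAt_id (1 / 2 : ℂ)).const_sub 1)
      rw [mul_neg_one] at h4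
      exact h4
    have h3 : (fun s : ℂ => completedRiemannZeta (1 - s)) = completedRiemannZeta :=
      funext completedRiemannZeta_one_sub
    rw [h3] at h1
    have := h1.deriv
    have h4 : (2 : ℂ) * deriv completedRiemannZeta (1 / 2) = 0 := by linear_combination this
    simpa using h4
  have hG : Complex.Gammaℝ (1 / 2) ≠ 0 := Complex.Gammaℝ_ne_zero_of_re_pos (by norm_num)
  have hGd : DifferentiableAt ℂ Complex.Gammaℝ (1 / 2) := by
    have := Complex.differentiable_Gammaℝ_inv (1 / 2)
    have h5 := this.inv (inv_ne_zero hG)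
    refine h5.congr_of_eventuallyEq (Eventually.of_forall fun s => ?_)
    simp
  have hev : riemannZeta =ᶠ[𝓝 (1 / 2)] fun s => completedRiemannZeta s / Complex.Gammaℝ s := by
    filter_upwards [isOpen_ne.mem_nhds hne0] with s hs
    exact riemannZeta_def_of_ne_zero hs
  have hΛ0 : completedRiemannZeta (1 / 2) = 0 := by
    have := hev.eq_of_nhds
    rw [h0] at this
    exact (div_eq_zero_iff.1 this.symm).resolve_right hG
  refine hsimple (1 / 2) h0 (by norm_num) (by norm_num) ?_
  rw [hev.deriv_eq]
  have := (hd.hasDerivAt.div hGd.hasDerivAt hG).deriv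
  refine Eq.trans this ?_
  rw [hΛ, hΛ0]; simp

lemma neg_mem_zetaOrdinates {γ : ℝ} (h : γ ∈ zetaOrdinates) : -γ ∈ zetaOrdinates := by
  have e : (1 / 2 : ℂ) + (-γ : ℝ) * Complex.I = (starRingEnd ℂ) (1 / 2 + γ * Complex.I) := by
    apply Complex.ext <;> simp
  change riemannZeta _ = 0
  rw [e, riemannZeta_conj, show riemannZeta (1 / 2 + γ * Complex.I) = 0 from h, map_zero]

lemma deriv_riemannZeta_conj (s : ℂ) :
    deriv riemannZeta (starRingEnd ℂ s) = starRingEnd ℂ (deriv riemannZeta s) := by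
  have h : (starRingEnd ℂ ∘ riemannZeta ∘ starRingEnd ℂ) = riemannZeta := by
    funext s
    simp [riemannZeta_conj]
  conv_lhs => rw [← h]
  rw [deriv_conj_conj]
  simp

lemma rpow_neg_eq_lintegral {γ : ℝ} (hγ : 0 < γ) :
    ENNReal.ofReal ((1 + γ) ^ (-(7 / 5) : ℝ)) =
      ∫⁻ T in Set.Ioi γ, ENNReal.ofReal (7 / 5 * (1 + T) ^ (-(12 / 5) : ℝ)) := by
  have hi : IntegrableOn (fun T : ℝ => (T + 1) ^ (-(12 / 5) : ℝ)) (Set.Ioi γ) :=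
    integrableOn_add_rpow_Ioi_of_lt (by norm_num) (by linarith)
  have hi2 : IntegrableOn (fun T : ℝ => 7 / 5 * (1 + T) ^ (-(12 / 5) : ℝ)) (Set.Ioi γ) := by
    simp_rw [add_comm (1 : ℝ)]
    exact hi.const_mul _
  rw [← ofReal_integral_eq_lintegral_ofReal hi2 ((ae_restrict_mem measurableSet_Ioi).mono fun T hT => by
    have : (0 : ℝ) < T := hγ.trans hT
    positivity)]
  congr 1
  have h1 : ∫ T in Set.Ioi γ, 7 / 5 * (1 + T) ^ (-(12 / 5) : ℝ) = 0 - -(1 + γ) ^ (-(7 / 5) : ℝ) := by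
    refine integral_Ioi_of_hasDerivAt_of_tendsto' (f := fun T : ℝ => -(1 + T) ^ (-(7 / 5) : ℝ)) (fun T hT => ?_) hi2 ?_
    · have hT' : 0 < 1 + T := by linarith [Set.mem_Ici.1 hT]
      have := (((hasDerivAt_id T).const_add 1).rpow_const (p := (-(7 / 5) : ℝ)) (Or.inl hT'.ne')).neg
      refine this.congr_deriv ?_
      simp only [id]
      norm_num
    · have := (tendsto_rpow_neg_atTop (y := 7 / 5) (by norm_num)).comp (tendsto_atTop_add_const_left atTop (1 : ℝ) tendsto_id)
      simpa using this.neg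
  rw [h1]; ring

lemma lintegral_Ioi_one_add_rpow_lt_top {a : ℝ} (ha : a < -1) :
    ∫⁻ T in Set.Ioi (0 : ℝ), ENNReal.ofReal ((1 + T) ^ a) < ⊤ := by
  have hi : IntegrableOn (fun T : ℝ => (1 + T) ^ a) (Set.Ioi 0) := by
    simp_rw [add_comm (1 : ℝ)]
    exact integrableOn_add_rpow_Ioi_of_lt ha (by norm_num)
  exact hi.lintegral_lt_top

lemma tsum_pos_rpow_div_deriv_sq_ne_top {θ C : ℝ} (hθ2 : θ < 7 / 5)
    (hJ : ∀ T : ℝ, 1 ≤ T →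
      (∑' γ : {γ : ℝ // 0 < γ ∧ γ ≤ T ∧ riemannZeta (1 / 2 + γ * Complex.I) = 0},
        1 / ‖deriv riemannZeta (1 / 2 + (γ : ℝ) * Complex.I)‖ ^ 2) ≤ C * T ^ θ) :
    ∑' γ : {γ : ℝ // 0 < γ ∧ riemannZeta (1 / 2 + γ * Complex.I) = 0},
      ENNReal.ofReal ((1 + |(γ : ℝ)|) ^ (-(7 / 5) : ℝ) / ‖deriv riemannZeta (1 / 2 + (γ : ℝ) * Complex.I)‖ ^ 2) ≠ ⊤ := by
  set a : ℝ → ENNReal := fun γ => ENNReal.ofReal (1 / ‖deriv riemannZeta (1 / 2 + (γ : ℝ) * Complex.I)‖ ^ 2) with ha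
  have hcount : Countable {γ : ℝ // 0 < γ ∧ riemannZeta (1 / 2 + γ * Complex.I) = 0} :=
    (countable_zetaOrdinates.mono (s₁ := {γ : ℝ | 0 < γ ∧ riemannZeta (1 / 2 + γ * Complex.I) = 0})
      fun γ h => h.2).to_subtype
  have hC : 0 ≤ C := by
    have := hJ 1 le_rfl
    rw [Real.one_rpow, mul_one] at this
    exact (tsum_nonneg fun γ => by positivity).trans this
  have hJ' : ∀ T : ℝ, 0 < T → ∑' γ : {γ : ℝ // 0 < γ ∧ riemannZeta (1 / 2 + γ * Complex.I) = 0},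
      (Set.Ioi (γ : ℝ)).indicator (fun _ => a γ) T ≤ ENNReal.ofReal (C * (1 + T) ^ θ) := by
    intro T hT
    have h1 := hJ (1 + T) (by linarith)
    have hfin : Finite {γ : ℝ // 0 < γ ∧ γ ≤ 1 + T ∧ riemannZeta (1 / 2 + γ * Complex.I) = 0} := by
      refine Set.Finite.to_subtype ((finite_zeros_im_mem_Icc 0 (1 + T)).subset ?_)
      rintro γ ⟨h1, h2, h3⟩
      exact ⟨h3, h1.le, h2⟩
    refine le_trans ?_ (ENNReal.ofReal_le_ofReal h1)
    rw [ENNReal.ofReal_tsum_of_nonneg (fun γ => by positivity) (Summable.of_finite)]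
    refine (tsum_subtype {γ : ℝ | 0 < γ ∧ riemannZeta (1 / 2 + γ * Complex.I) = 0}
      (fun γ => (Set.Ioi (γ : ℝ)).indicator (fun _ => a γ) T)).le.trans (le_trans ?_
      (tsum_subtype {γ : ℝ | 0 < γ ∧ γ ≤ 1 + T ∧ riemannZeta (1 / 2 + γ * Complex.I) = 0} a).ge)
    refine ENNReal.tsum_le_tsum fun γ => ?_
    by_cases h2 : γ ∈ {γ : ℝ | 0 < γ ∧ riemannZeta (1 / 2 + γ * Complex.I) = 0}
    · rw [Set.indicator_of_mem h2]
      by_cases h3 : T ∈ Set.Ioi γ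
      · rw [Set.indicator_of_mem h3, Set.indicator_of_mem (show γ ∈ {γ : ℝ | 0 < γ ∧ γ ≤ 1 + T ∧
          riemannZeta (1 / 2 + γ * Complex.I) = 0} from ⟨h2.1, by linarith [Set.mem_Ioi.1 h3], h2.2⟩)]
      · rw [Set.indicator_of_notMem h3]; exact zero_le
    · rw [Set.indicator_of_notMem h2]; exact zero_le
  have hterm : ∀ γ : {γ : ℝ // 0 < γ ∧ riemannZeta (1 / 2 + γ * Complex.I) = 0},
      ENNReal.ofReal ((1 + |(γ : ℝ)|) ^ (-(7 / 5) : ℝ) / ‖deriv riemannZeta (1 / 2 + (γ : ℝ) * Complex.I)‖ ^ 2) =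
      ∫⁻ T in Set.Ioi (0 : ℝ), ENNReal.ofReal (7 / 5 * (1 + T) ^ (-(12 / 5) : ℝ)) *
        (Set.Ioi (γ : ℝ)).indicator (fun _ => a γ) T := by
    intro γ
    have hγ := γ.2.1
    rw [abs_of_pos hγ, div_eq_mul_one_div, ENNReal.ofReal_mul (by positivity), rpow_neg_eq_lintegral hγ,
      ← lintegral_mul_const _ (by fun_prop)]
    have : ∀ T : ℝ, ENNReal.ofReal (7 / 5 * (1 + T) ^ (-(12 / 5) : ℝ)) *
        (Set.Ioi (γ : ℝ)).indicator (fun _ => a γ) T =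
        (Set.Ioi (γ : ℝ)).indicator (fun T => ENNReal.ofReal (7 / 5 * (1 + T) ^ (-(12 / 5) : ℝ)) * a γ) T := by
      intro T
      by_cases h3 : T ∈ Set.Ioi (γ : ℝ)
      · rw [Set.indicator_of_mem h3, Set.indicator_of_mem h3]
      · rw [Set.indicator_of_notMem h3, Set.indicator_of_notMem h3, mul_zero]
    simp_rw [this]
    rw [setLIntegral_indicator measurableSet_Ioi, Set.inter_eq_left.2 (Set.Ioi_subset_Ioi hγ.le)]
  simp_rw [hterm]
  rw [← lintegral_tsum (fun γ => by
    refine Measurable.aemeasurable ?_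
    exact (by fun_prop : Measurable fun T : ℝ => ENNReal.ofReal (7 / 5 * (1 + T) ^ (-(12 / 5) : ℝ))).mul
      (measurable_const.indicator measurableSet_Ioi))]
  refine ne_of_lt ?_
  have hbound : ∀ T ∈ Set.Ioi (0 : ℝ), ∑' γ : {γ : ℝ // 0 < γ ∧ riemannZeta (1 / 2 + γ * Complex.I) = 0},
      ENNReal.ofReal (7 / 5 * (1 + T) ^ (-(12 / 5) : ℝ)) * (Set.Ioi (γ : ℝ)).indicator (fun _ => a γ) T ≤
      ENNReal.ofReal (7 / 5 * C) * ENNReal.ofReal ((1 + T) ^ (-(12 / 5) + θ)) := by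
    intro T hT
    have hT' : 0 < T := hT
    rw [ENNReal.tsum_mul_left]
    refine (mul_le_mul_right (hJ' T hT) _).trans (le_of_eq ?_)
    rw [← ENNReal.ofReal_mul (by positivity), ← ENNReal.ofReal_mul (by positivity),
      Real.rpow_add (by linarith)]
    congr 1; ring
  refine (setLIntegral_mono (by fun_prop) hbound).trans_lt ?_
  rw [lintegral_const_mul _ (by fun_prop)]
  exact ENNReal.mul_lt_top ENNReal.ofReal_lt_top (lintegral_Ioi_one_add_rpow_lt_top (by linarith))

lemma tsum_rpow_div_deriv_sq_ne_top
    (hsimple : ∀ ρ : ℂ, riemannZeta ρ = 0 → 0 < ρ.re → ρ.re < 1 → deriv riemannZeta ρ ≠ 0)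
    {θ C : ℝ} (hθ2 : θ < 7 / 5)
    (hJ : ∀ T : ℝ, 1 ≤ T →
      (∑' γ : {γ : ℝ // 0 < γ ∧ γ ≤ T ∧ riemannZeta (1 / 2 + γ * Complex.I) = 0},
        1 / ‖deriv riemannZeta (1 / 2 + (γ : ℝ) * Complex.I)‖ ^ 2) ≤ C * T ^ θ) :
    ∑' γ : zetaOrdinates,
      ENNReal.ofReal ((1 + |(γ : ℝ)|) ^ (-(7 / 5) : ℝ) / ‖deriv riemannZeta (1 / 2 + (γ : ℝ) * Complex.I)‖ ^ 2) ≠ ⊤ := by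
  have h := tsum_pos_rpow_div_deriv_sq_ne_top hθ2 hJ
  set b : ℝ → ENNReal := fun γ =>
    ENNReal.ofReal ((1 + |γ|) ^ (-(7 / 5) : ℝ) / ‖deriv riemannZeta (1 / 2 + (γ : ℝ) * Complex.I)‖ ^ 2) with hb
  have hbn : ∀ γ, b (-γ) = b γ := by
    intro γ
    have e : (1 / 2 : ℂ) + (-γ : ℝ) * Complex.I = (starRingEnd ℂ) (1 / 2 + γ * Complex.I) := by
      apply Complex.ext <;> simp
    simp only [hb]
    rw [e, deriv_riemannZeta_conj, Complex.norm_conj, abs_neg]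
  set P : Set ℝ := {γ : ℝ | 0 < γ ∧ riemannZeta (1 / 2 + γ * Complex.I) = 0} with hP
  have h' : ∑' γ, P.indicator b γ ≠ ⊤ := by rw [← tsum_subtype]; exact h
  have h'' : ∑' γ, P.indicator b (-γ) ≠ ⊤ := by
    exact ((Equiv.neg ℝ).tsum_eq (P.indicator b)).trans_ne h'
  change ∑' γ : zetaOrdinates, b γ ≠ ⊤
  rw [tsum_subtype]
  refine ne_top_of_le_ne_top (ENNReal.add_ne_top.2 ⟨h', h''⟩) ?_
  rw [← ENNReal.tsum_add]
  refine ENNReal.tsum_le_tsum fun γ => ?_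
  by_cases hγ : γ ∈ zetaOrdinates
  · rw [Set.indicator_of_mem hγ]
    rcases lt_trichotomy γ 0 with h0 | h0 | h0
    · rw [Set.indicator_of_mem (show -γ ∈ P from ⟨by linarith, neg_mem_zetaOrdinates hγ⟩), hbn]
      exact le_add_self
    · exfalso
      rw [h0] at hγ
      have : riemannZeta (1 / 2 + (0 : ℝ) * Complex.I) = 0 := hγ
      exact riemannZeta_one_half_ne_zero hsimple (by simpa using this)
    · rw [Set.indicator_of_mem (show γ ∈ P from ⟨h0, hγ⟩)]
      exact le_self_add
  · rw [Set.indicator_of_notMem hγ]; exact zero_le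

/-- The function `ζ(1 + 2z) / ((1/2 + z) ζ(1/2 + z))`, written through the entire function
`(s - 1) ζ(s)`. -/
noncomputable def liouvilleTransform (z : ℂ) : ℂ :=
  riemannZeta₁ (1 + 2 * z) / (2 * z * (1 / 2 + z)) * ((1 / 2 + z - 1) / riemannZeta₁ (1 / 2 + z))

lemma exists_norm_riemannZeta₁_div_le : ∃ K : ℝ, 0 < K ∧ ∀ z : ℂ, 0 < z.re → z.re ≤ 3 / 2 →
    ‖riemannZeta₁ (1 + 2 * z) / (2 * z * (1 / 2 + z))‖ ≤
      K * ((1 + 1 / ‖z‖) * (1 + |z.im|) ^ (-(7 / 8) : ℝ)) := by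
  obtain ⟨C, hC, hb⟩ := exists_norm_riemannZeta₁_le_of_one_le
  refine ⟨15 * (1 + C), by positivity, fun z hz1 hz2 => ?_⟩
  have hz0 : 0 < ‖z‖ := by
    rw [norm_pos_iff]; intro h; rw [h] at hz1; simp at hz1
  have h1 := hb (1 + 2 * z) (by simp; linarith)
  rw [add_sub_cancel_left, norm_mul, Complex.norm_two] at h1
  have hzn : ‖z‖ ≤ 3 / 2 + |z.im| := by
    refine (Complex.norm_le_abs_re_add_abs_im z).trans ?_
    rw [abs_of_pos hz1]; linarith
  have h2 : (1 + ‖1 + 2 * z‖) ^ (1 / 8 : ℝ) ≤ 5 * (1 + |z.im|) ^ (1 / 8 : ℝ) := by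
    have h3 : 1 + ‖1 + 2 * z‖ ≤ 5 * (1 + |z.im|) := by
      have := norm_add_le (1 : ℂ) (2 * z)
      rw [norm_mul, Complex.norm_two, norm_one] at this
      linarith [abs_nonneg z.im]
    calc (1 + ‖1 + 2 * z‖) ^ (1 / 8 : ℝ) ≤ (5 * (1 + |z.im|)) ^ (1 / 8 : ℝ) := by gcongr
      _ = 5 ^ (1 / 8 : ℝ) * (1 + |z.im|) ^ (1 / 8 : ℝ) := Real.mul_rpow (by norm_num) (by positivity)
      _ ≤ 5 ^ (1 : ℝ) * (1 + |z.im|) ^ (1 / 8 : ℝ) := by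
        gcongr
        · norm_num
        · norm_num
      _ = _ := by rw [Real.rpow_one]
  have h4 : (1 + |z.im|) / 3 ≤ ‖1 / 2 + z‖ := by
    have a1 := Complex.abs_re_le_norm (1 / 2 + z)
    have a2 := Complex.abs_im_le_norm (1 / 2 + z)
    have e1 : (1 / 2 + z).re = 1 / 2 + z.re := by simp
    have e2 : (1 / 2 + z).im = z.im := by simp
    rw [e1, abs_of_pos (by linarith)] at a1
    rw [e2] at a2
    linarith
  have hE : 1 ≤ (1 + |z.im|) ^ (1 / 8 : ℝ) := Real.one_le_rpow (by linarith [abs_nonneg z.im]) (by norm_num)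
  have h5 : ‖riemannZeta₁ (1 + 2 * z)‖ / (2 * ‖z‖) ≤ 5 * (1 + C) * ((1 + 1 / ‖z‖) * (1 + |z.im|) ^ (1 / 8 : ℝ)) := by
    rw [div_le_iff₀ (by positivity)]
    have e : 5 * (1 + C) * ((1 + 1 / ‖z‖) * (1 + |z.im|) ^ (1 / 8 : ℝ)) * (2 * ‖z‖) =
        10 * (1 + C) * ((‖z‖ + 1) * (1 + |z.im|) ^ (1 / 8 : ℝ)) := by field_simp; ring
    rw [e]
    refine h1.trans ?_
    have h6 : 2 * ‖z‖ * (1 + ‖1 + 2 * z‖) ^ (1 / 8 : ℝ) ≤ 2 * ‖z‖ * (5 * (1 + |z.im|) ^ (1 / 8 : ℝ)) := by gcongr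
    have h7 := mul_le_mul_of_nonneg_left h6 hC.le
    have h8 : 0 ≤ ‖z‖ * (1 + |z.im|) ^ (1 / 8 : ℝ) := by positivity
    have h9 : 0 ≤ C * (1 + |z.im|) ^ (1 / 8 : ℝ) := by positivity
    nlinarith
  have hpow : (1 + |z.im|) ^ (-(7 / 8) : ℝ) = (1 + |z.im|) ^ (1 / 8 : ℝ) / (1 + |z.im|) := by
    rw [← Real.rpow_sub_one (by positivity)]; norm_num
  rw [norm_div, norm_mul, norm_mul, Complex.norm_two, ← div_div, hpow]
  calc _ ≤ 5 * (1 + C) * ((1 + 1 / ‖z‖) * (1 + |z.im|) ^ (1 / 8 : ℝ)) / ((1 + |z.im|) / 3) := by gcongr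
    _ = _ := by rw [div_div_eq_mul_div]; ring

/-- The weight `exp(-(γ - Im z)²) / |ζ'(1/2 + iγ) (z - iγ)|²` attached to an ordinate `γ`. -/
noncomputable def zeroWeight (z : ℂ) (γ : ℝ) : ENNReal :=
  ENNReal.ofReal (Real.exp (-(γ - z.im) ^ 2) /
    (‖deriv riemannZeta (1 / 2 + γ * Complex.I)‖ * ‖z - γ * Complex.I‖) ^ 2)

lemma exists_norm_inv_zeta_sq_le
    (hRH : ∀ ρ : ℂ, riemannZeta ρ = 0 → 0 < ρ.re → ρ.re < 1 → ρ.re = 1 / 2)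
    (hsimple : ∀ ρ : ℂ, riemannZeta ρ = 0 → 0 < ρ.re → ρ.re < 1 → deriv riemannZeta ρ ≠ 0) :
    ∃ K : ℝ, 0 < K ∧ ∀ z : ℂ, 0 < z.re → z.re ≤ 3 / 2 →
      ENNReal.ofReal (‖(1 / 2 + z - 1) / riemannZeta₁ (1 / 2 + z)‖ ^ 2) ≤
        ENNReal.ofReal (K * (1 + |z.im|) ^ (1 / 4 : ℝ)) * (1 + ∑' γ : zetaOrdinates, zeroWeight z γ) := by
  obtain ⟨C, hC, hb⟩ := exists_norm_inv_zeta_le hRH hsimple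
  obtain ⟨C', hC', hb'⟩ := exists_tsum_exp_neg_sq_le
  refine ⟨2 * C ^ 2 * (1 + C'), by positivity, fun z hz1 hz2 => ?_⟩
  have h1 := hb (1 / 2 + z) (by simp; linarith) (by simp; linarith)
  have him : (1 / 2 + z).im = z.im := by simp
  rw [him] at h1
  have hE : 1 ≤ (1 + |z.im|) ^ (1 / 4 : ℝ) := Real.one_le_rpow (by linarith [abs_nonneg z.im]) (by norm_num)
  have h2 := ENNReal.tsum_mul_sq_le (fun γ : zetaOrdinates => ENNReal.ofReal (Real.exp (-((γ : ℝ) - z.im) ^ 2 / 2)))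
    (fun γ : zetaOrdinates => ENNReal.ofReal (Real.exp (-((γ : ℝ) - z.im) ^ 2 / 2) /
      (‖deriv riemannZeta (1 / 2 + (γ : ℝ) * Complex.I)‖ * ‖z - (γ : ℝ) * Complex.I‖)))
  have e1 : ∀ γ : zetaOrdinates, ENNReal.ofReal (Real.exp (-((γ : ℝ) - z.im) ^ 2 / 2)) *
      ENNReal.ofReal (Real.exp (-((γ : ℝ) - z.im) ^ 2 / 2) /
      (‖deriv riemannZeta (1 / 2 + (γ : ℝ) * Complex.I)‖ * ‖z - (γ : ℝ) * Complex.I‖)) =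
      ENNReal.ofReal (Real.exp (-((γ : ℝ) - z.im) ^ 2) /
      (‖deriv riemannZeta (1 / 2 + (γ : ℝ) * Complex.I)‖ * ‖1 / 2 + z - (1 / 2 + (γ : ℝ) * Complex.I)‖)) := by
    intro γ
    rw [← ENNReal.ofReal_mul (by positivity), ← mul_div_assoc, ← Real.exp_add, add_sub_add_left_eq_sub]
    congr 4; ring
  have e2 : ∀ γ : zetaOrdinates, ENNReal.ofReal (Real.exp (-((γ : ℝ) - z.im) ^ 2 / 2)) ^ 2 =
      ENNReal.ofReal (Real.exp (-((γ : ℝ) - z.im) ^ 2)) := by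
    intro γ
    rw [← ENNReal.ofReal_pow (by positivity), ← Real.exp_nat_mul]
    congr 2; push_cast; ring
  have e3 : ∀ γ : zetaOrdinates, ENNReal.ofReal (Real.exp (-((γ : ℝ) - z.im) ^ 2 / 2) /
      (‖deriv riemannZeta (1 / 2 + (γ : ℝ) * Complex.I)‖ * ‖z - (γ : ℝ) * Complex.I‖)) ^ 2 = zeroWeight z γ := by
    intro γ
    rw [zeroWeight, ← ENNReal.ofReal_pow (by positivity), div_pow, ← Real.exp_nat_mul]
    congr 3; push_cast; ring
  simp_rw [e1, e2, e3] at h2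
  have h3 := h2.trans (mul_le_mul_left (hb' z.im) _)
  rw [ENNReal.ofReal_pow (norm_nonneg _)]
  refine (pow_le_pow_left' h1 2).trans ?_
  rw [mul_pow]
  set S := ∑' γ : zetaOrdinates, zeroWeight z γ
  set A := ∑' γ : zetaOrdinates, ENNReal.ofReal (Real.exp (-((γ : ℝ) - z.im) ^ 2) /
      (‖deriv riemannZeta (1 / 2 + (γ : ℝ) * Complex.I)‖ * ‖1 / 2 + z - (1 / 2 + (γ : ℝ) * Complex.I)‖))
  have h4 : (1 + A) ^ 2 ≤ 2 * (1 + A ^ 2) := by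
    have := ENNReal.rpow_add_le_mul_rpow_add_rpow 1 A (p := 2) (by norm_num)
    norm_num at this
    exact this
  have h5 : (1 : ENNReal) ≤ ENNReal.ofReal ((1 + C') * (1 + |z.im|) ^ (1 / 4 : ℝ)) := by
    rw [← ENNReal.ofReal_one]
    apply ENNReal.ofReal_le_ofReal
    nlinarith
  have h6 : ENNReal.ofReal (C' * (1 + |z.im|) ^ (1 / 4 : ℝ)) ≤ ENNReal.ofReal ((1 + C') * (1 + |z.im|) ^ (1 / 4 : ℝ)) := by
    apply ENNReal.ofReal_le_ofReal
    gcongr; linarith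
  calc ENNReal.ofReal C ^ 2 * (1 + A) ^ 2 ≤ ENNReal.ofReal C ^ 2 * (2 * (1 + A ^ 2)) := by gcongr
    _ ≤ ENNReal.ofReal C ^ 2 * (2 * (ENNReal.ofReal ((1 + C') * (1 + |z.im|) ^ (1 / 4 : ℝ)) +
        ENNReal.ofReal ((1 + C') * (1 + |z.im|) ^ (1 / 4 : ℝ)) * S)) := by
        gcongr
        exact h3.trans (by gcongr)
    _ = ENNReal.ofReal C ^ 2 * 2 * ENNReal.ofReal ((1 + C') * (1 + |z.im|) ^ (1 / 4 : ℝ)) * (1 + S) := by ring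
    _ = _ := by
        congr 1
        rw [← ENNReal.ofReal_pow hC.le, ← ENNReal.ofReal_ofNat 2, ← ENNReal.ofReal_mul (by positivity),
          ← ENNReal.ofReal_mul (by positivity)]
        congr 1; ring

lemma exists_norm_liouvilleTransform_sq_le
    (hRH : ∀ ρ : ℂ, riemannZeta ρ = 0 → 0 < ρ.re → ρ.re < 1 → ρ.re = 1 / 2)
    (hsimple : ∀ ρ : ℂ, riemannZeta ρ = 0 → 0 < ρ.re → ρ.re < 1 → deriv riemannZeta ρ ≠ 0) :
    ∃ K : ℝ, 0 < K ∧ ∀ z : ℂ, 0 < z.re → z.re ≤ 3 / 2 →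
      ENNReal.ofReal (‖liouvilleTransform z‖ ^ 2) ≤
        ENNReal.ofReal (K * (1 + 1 / ‖z‖) ^ 2 * (1 + |z.im|) ^ (-(3 / 2) : ℝ)) *
          (1 + ∑' γ : zetaOrdinates, zeroWeight z γ) := by
  obtain ⟨K₁, hK₁, h1⟩ := exists_norm_riemannZeta₁_div_le
  obtain ⟨K₂, hK₂, h2⟩ := exists_norm_inv_zeta_sq_le hRH hsimple
  refine ⟨K₁ ^ 2 * K₂, by positivity, fun z hz1 hz2 => ?_⟩
  rw [liouvilleTransform, norm_mul, mul_pow, ENNReal.ofReal_mul (by positivity)]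
  refine (mul_le_mul' (ENNReal.ofReal_le_ofReal (pow_le_pow_left₀ (norm_nonneg _) (h1 z hz1 hz2) 2))
    (h2 z hz1 hz2)).trans (le_of_eq ?_)
  rw [← mul_assoc, ← ENNReal.ofReal_mul (by positivity)]
  congr 2
  have e : (1 + |z.im|) ^ (-(3 / 2) : ℝ) = ((1 + |z.im|) ^ (-(7 / 8) : ℝ)) ^ 2 * (1 + |z.im|) ^ (1 / 4 : ℝ) := by
    rw [← Real.rpow_natCast, ← Real.rpow_mul (by positivity), ← Real.rpow_add (by positivity)]
    norm_num
  rw [e]; ring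

lemma integrable_poisson {x : ℝ} (hx : 0 < x) (γ : ℝ) :
    Integrable fun t : ℝ => x / (x ^ 2 + (t - γ) ^ 2) := by
  have h := ((integrable_inv_one_add_sq.comp_mul_right' (inv_ne_zero hx.ne')).const_mul x⁻¹).comp_sub_right γ
  refine h.congr (Eventually.of_forall fun t => ?_)
  simp only
  have : 0 < x ^ 2 + (t - γ) ^ 2 := by positivity
  field_simp

lemma integral_poisson {x : ℝ} (hx : 0 < x) (γ : ℝ) :
    ∫ t : ℝ, x / (x ^ 2 + (t - γ) ^ 2) = Real.pi := by
  have e : ∀ t : ℝ, x / (x ^ 2 + (t - γ) ^ 2) = x⁻¹ * (1 + ((t - γ) * x⁻¹) ^ 2)⁻¹ := by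
    intro t
    have : 0 < x ^ 2 + (t - γ) ^ 2 := by positivity
    field_simp
  simp_rw [e]
  rw [integral_sub_right_eq_self (fun t : ℝ => x⁻¹ * (1 + (t * x⁻¹) ^ 2)⁻¹) γ, integral_const_mul,
    Measure.integral_comp_mul_right (fun t : ℝ => (1 + t ^ 2)⁻¹) x⁻¹, integral_univ_inv_one_add_sq,
    inv_inv, abs_of_pos hx, smul_eq_mul, inv_mul_cancel_left₀ hx.ne']

lemma lintegral_poisson {x : ℝ} (hx : 0 < x) (γ : ℝ) :
    ∫⁻ t : ℝ, ENNReal.ofReal (x / (x ^ 2 + (t - γ) ^ 2)) = ENNReal.ofReal Real.pi := by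
  rw [← ofReal_integral_eq_lintegral_ofReal (integrable_poisson hx γ)
    (Eventually.of_forall fun t => by positivity), integral_poisson hx]

lemma sq_norm_add_mul_I_sub (x t γ : ℝ) :
    ‖(x + t * Complex.I : ℂ) - γ * Complex.I‖ ^ 2 = x ^ 2 + (t - γ) ^ 2 := by
  rw [Complex.sq_norm, Complex.normSq_apply]
  simp; ring

lemma ofReal_mul_zeroWeight_le (z : ℂ) (γ : ℝ) :
    ENNReal.ofReal ((1 + |z.im|) ^ (-(7 / 5) : ℝ)) * zeroWeight z γ ≤
      ENNReal.ofReal ((1 + |γ|) ^ (-(7 / 5) : ℝ) / ‖deriv riemannZeta (1 / 2 + γ * Complex.I)‖ ^ 2) *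
        ENNReal.ofReal (4 * Real.exp (-(γ - z.im) ^ 2 / 2) / ‖z - γ * Complex.I‖ ^ 2) := by
  rw [zeroWeight, ← ENNReal.ofReal_mul (by positivity), ← ENNReal.ofReal_mul (by positivity)]
  apply ENNReal.ofReal_le_ofReal
  have h := rpow_neg_mul_exp_le (a := 7 / 5) (by norm_num) (by norm_num) γ z.im
  rw [mul_pow, ← mul_div_assoc, div_mul_div_comm]
  gcongr ?_ / _
  linarith

lemma lintegral_one_add_abs_rpow_lt_top {a : ℝ} (ha : a < -1) :
    ∫⁻ t : ℝ, ENNReal.ofReal ((1 + |t|) ^ a) < ⊤ := by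
  have := integrable_one_add_norm (E := ℝ) (μ := volume) (r := -a) (by simp; linarith)
  simp only [neg_neg, Real.norm_eq_abs] at this
  exact this.lintegral_lt_top

section

variable (hRH : ∀ ρ : ℂ, riemannZeta ρ = 0 → 0 < ρ.re → ρ.re < 1 → ρ.re = 1 / 2)
  (hsimple : ∀ ρ : ℂ, riemannZeta ρ = 0 → 0 < ρ.re → ρ.re < 1 → deriv riemannZeta ρ ≠ 0)
  (hsum : ∑' γ : zetaOrdinates, ENNReal.ofReal
    ((1 + |(γ : ℝ)|) ^ (-(7 / 5) : ℝ) / ‖deriv riemannZeta (1 / 2 + (γ : ℝ) * Complex.I)‖ ^ 2) ≠ ⊤)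

include hRH hsimple hsum

lemma exists_lintegral_tail_le : ∃ K : ℝ, 0 ≤ K ∧ ∀ x : ℝ, 0 < x → x ≤ 3 / 2 → ∀ T : ℝ, 1 ≤ T →
    ∫⁻ t in {t : ℝ | T ≤ |t|}, ENNReal.ofReal (x * ‖liouvilleTransform (x + t * Complex.I)‖ ^ 2) ≤
      ENNReal.ofReal (K * T ^ (-(1 / 10) : ℝ)) := by
  obtain ⟨K, hK, hb⟩ := exists_norm_liouvilleTransform_sq_le hRH hsimple
  set S := ∑' γ : zetaOrdinates, ENNReal.ofReal
    ((1 + |(γ : ℝ)|) ^ (-(7 / 5) : ℝ) / ‖deriv riemannZeta (1 / 2 + (γ : ℝ) * Complex.I)‖ ^ 2) with hS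
  set I := ∫⁻ t : ℝ, ENNReal.ofReal ((1 + |t|) ^ (-(7 / 5) : ℝ)) with hI
  have hItop : I ≠ ⊤ := (lintegral_one_add_abs_rpow_lt_top (by norm_num)).ne
  set M := ENNReal.ofReal (3 / 2) * I + S * (ENNReal.ofReal (4 * Real.pi)) with hM
  have hMtop : M ≠ ⊤ := by
    refine ENNReal.add_ne_top.2 ⟨ENNReal.mul_ne_top ENNReal.ofReal_ne_top hItop,
      ENNReal.mul_ne_top hsum ENNReal.ofReal_ne_top⟩
  refine ⟨4 * K * M.toReal, by positivity, fun x hx hx2 T hT => ?_⟩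
  have hpt : ∀ t ∈ {t : ℝ | T ≤ |t|},
      ENNReal.ofReal (x * ‖liouvilleTransform (x + t * Complex.I)‖ ^ 2) ≤
      ENNReal.ofReal (4 * K * T ^ (-(1 / 10) : ℝ)) * (ENNReal.ofReal (3 / 2) *
        ENNReal.ofReal ((1 + |t|) ^ (-(7 / 5) : ℝ)) + ∑' γ : zetaOrdinates, ENNReal.ofReal
        ((1 + |(γ : ℝ)|) ^ (-(7 / 5) : ℝ) / ‖deriv riemannZeta (1 / 2 + (γ : ℝ) * Complex.I)‖ ^ 2) *
        (ENNReal.ofReal 4 * ENNReal.ofReal (x / (x ^ 2 + (t - γ) ^ 2)))) := by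
    intro t ht
    have ht' : T ≤ |t| := ht
    set z : ℂ := x + t * Complex.I with hz
    have hre : z.re = x := by simp [hz]
    have him : z.im = t := by simp [hz]
    have h1 := hb z (by rw [hre]; exact hx) (by rw [hre]; exact hx2)
    have hz1 : 1 ≤ ‖z‖ := by
      have := Complex.abs_im_le_norm z
      rw [him] at this; linarith
    rw [ENNReal.ofReal_mul hx.le]
    refine (mul_le_mul_right h1 _).trans ?_
    have h2 : K * (1 + 1 / ‖z‖) ^ 2 * (1 + |z.im|) ^ (-(3 / 2) : ℝ) ≤
        4 * K * T ^ (-(1 / 10) : ℝ) * (1 + |t|) ^ (-(7 / 5) : ℝ) := by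
      have e : (1 + |t|) ^ (-(3 / 2) : ℝ) = (1 + |t|) ^ (-(1 / 10) : ℝ) * (1 + |t|) ^ (-(7 / 5) : ℝ) := by
        rw [← Real.rpow_add (by positivity)]; norm_num
      have h3 : (1 + |t|) ^ (-(1 / 10) : ℝ) ≤ T ^ (-(1 / 10) : ℝ) :=
        Real.rpow_le_rpow_of_nonpos (by linarith) (by linarith) (by norm_num)
      have h4 : (1 + 1 / ‖z‖) ^ 2 ≤ 4 := by
        have : 1 / ‖z‖ ≤ 1 := by rw [div_le_one (by linarith)]; exact hz1
        have h0 : 0 ≤ 1 / ‖z‖ := by positivity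
        nlinarith
      rw [him, e]
      calc _ ≤ K * 4 * (T ^ (-(1 / 10) : ℝ) * (1 + |t|) ^ (-(7 / 5) : ℝ)) := by gcongr
        _ = _ := by ring
    refine (mul_le_mul_right (mul_le_mul_left (ENNReal.ofReal_le_ofReal h2) _) _).trans ?_
    rw [ENNReal.ofReal_mul (by positivity), mul_assoc, ← mul_assoc (ENNReal.ofReal x),
      mul_comm (ENNReal.ofReal x), mul_assoc (ENNReal.ofReal (4 * K * _))]
    gcongr
    rw [mul_add, mul_one, mul_add, ← ENNReal.tsum_mul_left, ← ENNReal.tsum_mul_left]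
    refine add_le_add ?_ (ENNReal.tsum_le_tsum fun γ => ?_)
    · gcongr
    · have h5 := ofReal_mul_zeroWeight_le z γ
      rw [him, sq_norm_add_mul_I_sub] at h5
      refine (mul_le_mul_right h5 _).trans ?_
      rw [mul_left_comm]
      refine mul_le_mul_right ?_ _
      rw [← ENNReal.ofReal_mul hx.le, ← ENNReal.ofReal_mul (by norm_num)]
      apply ENNReal.ofReal_le_ofReal
      have h6 : Real.exp (-((γ : ℝ) - t) ^ 2 / 2) ≤ 1 := by
        rw [Real.exp_le_one_iff]; nlinarith [sq_nonneg ((γ : ℝ) - t)]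
      calc x * (4 * Real.exp (-((γ : ℝ) - t) ^ 2 / 2) / (x ^ 2 + (t - γ) ^ 2)) ≤
          x * (4 * 1 / (x ^ 2 + (t - γ) ^ 2)) := by gcongr
        _ = _ := by ring
  refine (setLIntegral_mono' (measurableSet_le measurable_const measurable_norm) hpt).trans ?_
  refine (setLIntegral_le_lintegral _ _).trans ?_
  rw [lintegral_const_mul' _ _ ENNReal.ofReal_ne_top, lintegral_add_left (by fun_prop),
    lintegral_const_mul' _ _ ENNReal.ofReal_ne_top, ← hI,
    lintegral_tsum (fun γ => by fun_prop)]
  have h7 : ∀ γ : zetaOrdinates, ∫⁻ t : ℝ, ENNReal.ofReal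
        ((1 + |(γ : ℝ)|) ^ (-(7 / 5) : ℝ) / ‖deriv riemannZeta (1 / 2 + (γ : ℝ) * Complex.I)‖ ^ 2) *
        (ENNReal.ofReal 4 * ENNReal.ofReal (x / (x ^ 2 + (t - γ) ^ 2))) =
      ENNReal.ofReal
        ((1 + |(γ : ℝ)|) ^ (-(7 / 5) : ℝ) / ‖deriv riemannZeta (1 / 2 + (γ : ℝ) * Complex.I)‖ ^ 2) *
        ENNReal.ofReal (4 * Real.pi) := by
    intro γ
    rw [lintegral_const_mul' _ _ ENNReal.ofReal_ne_top, lintegral_const_mul' _ _ ENNReal.ofReal_ne_top,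
      lintegral_poisson hx, ← ENNReal.ofReal_mul (by norm_num)]
  simp_rw [h7]
  rw [ENNReal.tsum_mul_right, ← hS, ← hM, ← ENNReal.ofReal_toReal hMtop, ← ENNReal.ofReal_mul (by positivity),
    ENNReal.toReal_ofReal ENNReal.toReal_nonneg]
  apply le_of_eq
  congr 1; ring

lemma exists_integrable_bound {δ : ℝ} (hδ : 0 < δ) : ∃ G : ℝ → ℝ, Integrable G ∧ ∀ᵐ t : ℝ,
    ∀ z : ℂ, δ ≤ z.re → z.re ≤ 3 / 2 → |z.im - t| ≤ 1 → ‖liouvilleTransform z‖ ^ 2 ≤ G t := by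
  obtain ⟨K, hK, hb⟩ := exists_norm_liouvilleTransform_sq_le hRH hsimple
  set S := ∑' γ : zetaOrdinates, ENNReal.ofReal
    ((1 + |(γ : ℝ)|) ^ (-(7 / 5) : ℝ) / ‖deriv riemannZeta (1 / 2 + (γ : ℝ) * Complex.I)‖ ^ 2) with hS
  set D := K * (1 + 1 / δ) ^ 2 with hD
  have hD0 : 0 < D := by positivity
  set g : ℝ → ENNReal := fun t => ENNReal.ofReal D * (ENNReal.ofReal 4 * ENNReal.ofReal ((1 + |t|) ^ (-(7 / 5) : ℝ)) +
    ∑' γ : zetaOrdinates, ENNReal.ofReal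
    ((1 + |(γ : ℝ)|) ^ (-(7 / 5) : ℝ) / ‖deriv riemannZeta (1 / 2 + (γ : ℝ) * Complex.I)‖ ^ 2) *
      (ENNReal.ofReal (4 * Real.exp 1 / δ ^ 2) * ENNReal.ofReal (Real.exp (-(t - γ) ^ 2 / 4)))) with hg
  have hgm : Measurable g := by
    refine Measurable.const_mul ((by fun_prop : Measurable fun t : ℝ =>
      ENNReal.ofReal 4 * ENNReal.ofReal ((1 + |t|) ^ (-(7 / 5) : ℝ))).add ?_) _
    exact Measurable.tsum fun γ => by fun_prop
  have hIntegr : Integrable fun v : ℝ => Real.exp (-v ^ 2 / 4) := by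
    have := integrable_exp_neg_mul_sq (b := 1 / 4) (by norm_num)
    refine this.congr (Eventually.of_forall fun v => ?_)
    simp only; congr 1; ring
  have hgi : ∫⁻ t, g t ≠ ⊤ := by
    simp only [hg]
    rw [lintegral_const_mul' _ _ ENNReal.ofReal_ne_top, lintegral_add_left (by fun_prop),
      lintegral_const_mul' _ _ ENNReal.ofReal_ne_top,
      lintegral_tsum (fun γ => by fun_prop)]
    have h7 : ∀ γ : zetaOrdinates, ∫⁻ t : ℝ, ENNReal.ofReal
        ((1 + |(γ : ℝ)|) ^ (-(7 / 5) : ℝ) / ‖deriv riemannZeta (1 / 2 + (γ : ℝ) * Complex.I)‖ ^ 2) *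
        (ENNReal.ofReal (4 * Real.exp 1 / δ ^ 2) * ENNReal.ofReal (Real.exp (-(t - γ) ^ 2 / 4))) =
      ENNReal.ofReal
        ((1 + |(γ : ℝ)|) ^ (-(7 / 5) : ℝ) / ‖deriv riemannZeta (1 / 2 + (γ : ℝ) * Complex.I)‖ ^ 2) *
        (ENNReal.ofReal (4 * Real.exp 1 / δ ^ 2) * ∫⁻ t, ENNReal.ofReal (Real.exp (-t ^ 2 / 4))) := by
      intro γ
      rw [lintegral_const_mul' _ _ ENNReal.ofReal_ne_top, lintegral_const_mul' _ _ ENNReal.ofReal_ne_top,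
        lintegral_sub_right_eq_self (fun t : ℝ => ENNReal.ofReal (Real.exp (-t ^ 2 / 4))) (γ : ℝ)]
    simp_rw [h7]
    rw [ENNReal.tsum_mul_right]
    have := hIntegr.lintegral_lt_top.ne
    exact ENNReal.mul_ne_top ENNReal.ofReal_ne_top (ENNReal.add_ne_top.2
      ⟨ENNReal.mul_ne_top ENNReal.ofReal_ne_top (lintegral_one_add_abs_rpow_lt_top (by norm_num)).ne,
      ENNReal.mul_ne_top hsum (ENNReal.mul_ne_top ENNReal.ofReal_ne_top this)⟩)
  refine ⟨fun t => (g t).toReal, integrable_toReal_of_lintegral_ne_top hgm.aemeasurable hgi, ?_⟩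
  filter_upwards [ae_lt_top hgm hgi] with t ht z hz1 hz2 hzt
  rw [← ENNReal.ofReal_le_iff_le_toReal ht.ne]
  refine (hb z (hδ.trans_le hz1) hz2).trans ?_
  have hzn : δ ≤ ‖z‖ := hz1.trans ((le_abs_self _).trans (Complex.abs_re_le_norm z))
  have h1 : K * (1 + 1 / ‖z‖) ^ 2 * (1 + |z.im|) ^ (-(3 / 2) : ℝ) ≤ D * (1 + |z.im|) ^ (-(7 / 5) : ℝ) := by
    have h2 : (1 + |z.im|) ^ (-(3 / 2) : ℝ) ≤ (1 + |z.im|) ^ (-(7 / 5) : ℝ) :=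
      Real.rpow_le_rpow_of_exponent_le (by linarith [abs_nonneg z.im]) (by norm_num)
    have h3 : K * (1 + 1 / ‖z‖) ^ 2 ≤ D := by rw [hD]; gcongr
    exact mul_le_mul h3 h2 (by positivity) hD0.le
  refine (mul_le_mul_left (ENNReal.ofReal_le_ofReal h1) _).trans ?_
  rw [ENNReal.ofReal_mul hD0.le, mul_assoc]
  simp only [hg]
  gcongr
  rw [mul_add, mul_one, ← ENNReal.tsum_mul_left]
  refine add_le_add ?_ (ENNReal.tsum_le_tsum fun γ => ?_)
  · rw [← ENNReal.ofReal_mul (by norm_num)]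
    apply ENNReal.ofReal_le_ofReal
    have h2 : 1 + |t| ≤ (1 + |z.im|) * 2 := by
      refine (one_add_abs_le_mul t z.im).trans ?_
      rw [abs_sub_comm]
      gcongr; linarith
    have h3 : (1 + |t|) ^ (7 / 5 : ℝ) ≤ (1 + |z.im|) ^ (7 / 5 : ℝ) * 4 := by
      refine (Real.rpow_le_rpow (by positivity) h2 (by norm_num)).trans ?_
      rw [Real.mul_rpow (by positivity) (by norm_num)]
      gcongr
      calc (2 : ℝ) ^ (7 / 5 : ℝ) ≤ 2 ^ (2 : ℝ) := Real.rpow_le_rpow_of_exponent_le (by norm_num) (by norm_num)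
        _ = 4 := by norm_num
    rw [Real.rpow_neg (by positivity), Real.rpow_neg (by positivity), ← div_eq_mul_inv,
      inv_le_comm₀ (by positivity) (by positivity), inv_div, div_le_iff₀ (by norm_num)]
    exact h3
  · refine (ofReal_mul_zeroWeight_le z γ).trans ?_
    rw [← ENNReal.ofReal_mul (by positivity : (0:ℝ) ≤ 4 * Real.exp 1 / δ ^ 2)]
    gcongr
    rw [div_mul_eq_mul_div, mul_assoc, ← Real.exp_add]
    have h4 : δ ≤ ‖z - (γ : ℝ) * Complex.I‖ := by
      have := Complex.abs_re_le_norm (z - (γ : ℝ) * Complex.I)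
      have e : (z - (γ : ℝ) * Complex.I).re = z.re := by simp
      rw [e] at this
      exact hz1.trans ((le_abs_self _).trans this)
    have h5 : (z.im - t) ^ 2 ≤ 1 := by
      rw [← sq_abs]; nlinarith [abs_nonneg (z.im - t)]
    gcongr
    nlinarith [sq_nonneg ((γ - z.im) - (z.im - t))]

end

lemma exists_norm_sub_simple_pole_le {N D : ℂ → ℂ} (hN : Differentiable ℂ N) (hD : Differentiable ℂ D)
    {p : ℂ} (h0 : D p = 0) (h1 : deriv D p ≠ 0) :
    ∃ K : ℝ, ∀ᶠ z in 𝓝[≠] p, ‖N z / D z - N p / deriv D p / (z - p)‖ ≤ K := by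
  have hg : DifferentiableAt ℂ (dslope D p) p := by
    have : DifferentiableOn ℂ (dslope D p) Set.univ :=
      (Complex.differentiableOn_dslope univ_mem).2 hD.differentiableOn
    exact (this p (Set.mem_univ p)).differentiableAt univ_mem
  have hgp : dslope D p p = deriv D p := dslope_same _ _
  have hq : DifferentiableAt ℂ (fun z => N z / dslope D p z) p :=
    (hN p).div hg (by rw [hgp]; exact h1)
  have hs := (hasDerivAt_iff_tendsto_slope.1 hq.hasDerivAt).norm
  refine ⟨‖deriv (fun z => N z / dslope D p z) p‖ + 1, ?_⟩
  filter_upwards [self_mem_nhdsWithin, hs.eventually_le_const (lt_add_one _)] with z hz hle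
  refine le_trans (le_of_eq ?_) hle
  have hz' : z - p ≠ 0 := sub_ne_zero.2 hz
  rw [slope_def_field, hgp, dslope_of_ne _ hz, slope_def_field, h0, sub_zero, div_div_eq_mul_div,
    sub_div, mul_div_right_comm, mul_div_cancel_right₀ _ hz']

lemma exists_abs_poisson_sub_le {N D : ℂ → ℂ} (hN : Differentiable ℂ N) (hD : Differentiable ℂ D)
    {p : ℂ} (hp : p.re = 0) (h0 : D p = 0) (h1 : deriv D p ≠ 0) :
    ∃ K : ℝ, ∀ᶠ z in 𝓝 p, 0 < z.re →
      |z.re * ‖N z / D z‖ ^ 2 - ‖N p / deriv D p‖ ^ 2 * (z.re / ‖z - p‖ ^ 2)| ≤ K := by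
  obtain ⟨K, hK⟩ := exists_norm_sub_simple_pole_le hN hD h0 h1
  set c := N p / deriv D p with hc
  refine ⟨2 * ‖c‖ * |K| + |K| ^ 2, ?_⟩
  have hball : ∀ᶠ z in 𝓝 p, z.re < 1 :=
    Complex.continuous_re.continuousAt.eventually_lt continuousAt_const (by rw [hp]; norm_num)
  filter_upwards [eventually_nhdsWithin_iff.1 hK, hball] with z hz hz1 hre
  have hzp : z ≠ p := by intro h; rw [h, hp] at hre; exact lt_irrefl _ hre
  have hz2 := (hz hzp).trans (le_abs_self K)
  have hn : 0 < ‖z - p‖ := norm_pos_iff.2 (sub_ne_zero.2 hzp)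
  have hzr : z.re ≤ ‖z - p‖ := by
    have := Complex.abs_re_le_norm (z - p)
    rw [Complex.sub_re, hp, sub_zero] at this
    exact (le_abs_self _).trans this
  have han : ‖c / (z - p)‖ = ‖c‖ / ‖z - p‖ := norm_div _ _
  generalize c / (z - p) = a at han hz2
  clear_value c
  set f := N z / D z with hf
  have h2 : |‖f‖ - ‖a‖| ≤ |K| := (abs_norm_sub_norm_le f a).trans hz2
  have h3 : ‖c‖ ^ 2 * (z.re / ‖z - p‖ ^ 2) = z.re * ‖a‖ ^ 2 := by
    rw [han, div_pow]; ring
  have h4 : z.re * ‖a‖ ≤ ‖c‖ := by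
    rw [han, ← mul_div_assoc, div_le_iff₀ hn]
    nlinarith [norm_nonneg c]
  have e : z.re * ‖f‖ ^ 2 - z.re * ‖a‖ ^ 2 = (‖f‖ - ‖a‖) * (2 * (z.re * ‖a‖) + z.re * (‖f‖ - ‖a‖)) := by ring
  rw [h3, e, abs_mul]
  have h5 : |2 * (z.re * ‖a‖) + z.re * (‖f‖ - ‖a‖)| ≤ 2 * ‖c‖ + |K| := by
    refine (abs_add_le _ _).trans (add_le_add ?_ ?_)
    · rw [abs_of_nonneg (by positivity)]; linarith
    · rw [abs_mul, abs_of_pos hre]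
      nlinarith [abs_nonneg (‖f‖ - ‖a‖), abs_nonneg K]
  calc _ ≤ |K| * (2 * ‖c‖ + |K|) := mul_le_mul h2 h5 (abs_nonneg _) (abs_nonneg _)
    _ = _ := by ring

lemma tendsto_integral_poisson_window {γ T : ℝ} (hγ : |γ| < T) :
    Tendsto (fun x : ℝ => ∫ t in -T..T, x / (x ^ 2 + (t - γ) ^ 2)) (𝓝[>] 0) (𝓝 Real.pi) := by
  have hγ' := abs_lt.1 hγ
  have h : ∀ᶠ x : ℝ in 𝓝[>] 0, Real.arctan ((T - γ) * x⁻¹) - Real.arctan (-(T + γ) * x⁻¹) =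
      ∫ t in -T..T, x / (x ^ 2 + (t - γ) ^ 2) := by
    filter_upwards [self_mem_nhdsWithin] with x hx
    have hx' : 0 < x := hx
    rw [intervalIntegral.integral_eq_sub_of_hasDerivAt (f := fun t => Real.arctan ((t - γ) * x⁻¹))
      (fun t _ => ?_) (integrable_poisson hx' γ).intervalIntegrable]
    · ring_nf
    · have := (((hasDerivAt_id t).sub_const γ).mul_const x⁻¹).arctan
      refine this.congr_deriv ?_
      have : 0 < x ^ 2 + (t - γ) ^ 2 := by positivity
      simp only [id]
      field_simp
  refine Tendsto.congr' h ?_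
  have hpi : Real.pi = Real.pi / 2 - -(Real.pi / 2) := by ring
  rw [hpi]
  refine Tendsto.sub ?_ ?_
  · exact (Real.tendsto_arctan_atTop.mono_right nhdsWithin_le_nhds).comp
      (tendsto_inv_nhdsGT_zero.const_mul_atTop (by linarith))
  · exact (Real.tendsto_arctan_atBot.mono_right nhdsWithin_le_nhds).comp
      (tendsto_inv_nhdsGT_zero.const_mul_atTop_of_neg (by linarith))

lemma tendsto_mul_integral_window {N D : ℂ → ℂ} (hN : Differentiable ℂ N) (hD : Differentiable ℂ D)
    {T : ℝ} (hT : 0 ≤ T) (W : Finset ℝ)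
    (hW : ∀ γ ∈ W, D (γ * Complex.I) = 0 ∧ deriv D (γ * Complex.I) ≠ 0 ∧ |γ| < T)
    (hW' : ∀ t : ℝ, |t| ≤ T → D (t * Complex.I) = 0 → t ∈ W) (hD0 : ∀ z : ℂ, 0 < z.re → D z ≠ 0) :
    Tendsto (fun x : ℝ => ∫ t in -T..T, x * ‖N (x + t * Complex.I) / D (x + t * Complex.I)‖ ^ 2) (𝓝[>] 0)
      (𝓝 (Real.pi * ∑ γ ∈ W, ‖N (γ * Complex.I) / deriv D (γ * Complex.I)‖ ^ 2)) := by
  set c : ℝ → ℂ := fun γ => N (γ * Complex.I) / deriv D (γ * Complex.I) with hc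
  set F : ℂ → ℂ := fun z => N z / D z with hF
  set E : ℂ → ℝ := fun z => z.re * ‖F z‖ ^ 2 - ∑ γ ∈ W, ‖c γ‖ ^ 2 * (z.re / ‖z - γ * Complex.I‖ ^ 2) with hE
  have hcont : ∀ (t : ℝ) (γ : ℝ), γ ≠ t → ContinuousAt (fun z : ℂ => ‖c γ‖ ^ 2 * (z.re / ‖z - γ * Complex.I‖ ^ 2))
      (t * Complex.I) := by
    intro t γ h
    refine continuousAt_const.mul (ContinuousAt.div (by fun_prop) (by fun_prop) ?_)
    have : (t : ℂ) * Complex.I - γ * Complex.I ≠ 0 := by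
      rw [← sub_mul]
      refine mul_ne_zero (sub_ne_zero.2 ?_) Complex.I_ne_zero
      exact_mod_cast h.symm
    positivity
  have hbdd : ∀ {g : ℂ → ℝ} {p : ℂ}, ContinuousAt g p → ∃ K, ∀ᶠ z in 𝓝 p, |g z| ≤ K := by
    intro g p hg
    exact ⟨_, hg.abs.tendsto.eventually_le_const (lt_add_one _)⟩
  have hE0 : ∀ t : ℝ, |t| ≤ T → t ∉ W → ContinuousAt E (t * Complex.I) := by
    intro t ht htW
    have hDt : D (t * Complex.I) ≠ 0 := fun h => htW (hW' t ht h)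
    have h1 : ContinuousAt F (t * Complex.I) := hN.continuous.continuousAt.div hD.continuous.continuousAt hDt
    refine (Complex.continuous_re.continuousAt.mul (h1.norm.pow 2)).sub ?_
    exact tendsto_finsetSum _ fun γ hγ => hcont t γ (fun h => htW (h ▸ hγ))
  have hlocal : ∀ t : ℝ, |t| ≤ T → ∃ K : ℝ, ∀ᶠ z in 𝓝 (t * Complex.I : ℂ), 0 < z.re → |E z| ≤ K := by
    intro t ht
    by_cases htW : t ∈ W
    · obtain ⟨hd0, hd1, -⟩ := hW t htW
      obtain ⟨K, hK⟩ := exists_abs_poisson_sub_le hN hD (p := t * Complex.I) (by simp) hd0 hd1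
      have h1 : ContinuousAt (fun z : ℂ => ∑ γ ∈ W.erase t, ‖c γ‖ ^ 2 * (z.re / ‖z - γ * Complex.I‖ ^ 2))
          (t * Complex.I) :=
        tendsto_finsetSum _ fun γ hγ => hcont t γ (Finset.ne_of_mem_erase hγ)
      obtain ⟨K', hK'⟩ := hbdd h1
      refine ⟨K + K', ?_⟩
      filter_upwards [hK, hK'] with z h2 h3 hz
      have e : E z = (z.re * ‖N z / D z‖ ^ 2 - ‖c t‖ ^ 2 * (z.re / ‖z - t * Complex.I‖ ^ 2)) -
          ∑ γ ∈ W.erase t, ‖c γ‖ ^ 2 * (z.re / ‖z - γ * Complex.I‖ ^ 2) := by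
        simp only [hE]
        rw [← Finset.add_sum_erase W _ htW]; ring
      rw [e]
      exact (abs_sub _ _).trans (add_le_add (h2 hz) h3)
    · obtain ⟨K, hK⟩ := hbdd (hE0 t ht htW)
      exact ⟨K, hK.mono fun z hz _ => hz⟩
  have hunif : ∃ K : ℝ, ∀ᶠ x : ℝ in 𝓝[>] 0, ∀ t ∈ Set.Icc (-T) T, |E (x + t * Complex.I)| ≤ K := by
    refine (isCompact_Icc : IsCompact (Set.Icc (-T) T)).induction_on
      (p := fun S : Set ℝ => ∃ K : ℝ, ∀ᶠ x : ℝ in 𝓝[>] 0, ∀ t ∈ S, |E (x + t * Complex.I)| ≤ K)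
      ⟨0, Eventually.of_forall fun x t ht => ht.elim⟩ ?_ ?_ ?_
    · rintro S S' hS ⟨K, hK⟩
      exact ⟨K, hK.mono fun x hx t ht => hx t (hS ht)⟩
    · rintro S S' ⟨K, hK⟩ ⟨K', hK'⟩
      refine ⟨max K K', (hK.and hK').mono fun x hx t ht => ?_⟩
      exact ht.elim (fun h => (hx.1 t h).trans (le_max_left _ _)) (fun h => (hx.2 t h).trans (le_max_right _ _))
    · intro t ht
      obtain ⟨K, hK⟩ := hlocal t (abs_le.2 ht)
      have hmap : Tendsto (fun q : ℝ × ℝ => (q.1 + q.2 * Complex.I : ℂ)) (𝓝 0 ×ˢ 𝓝 t) (𝓝 (t * Complex.I)) := by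
        rw [← nhds_prod_eq]
        have : Continuous fun q : ℝ × ℝ => (q.1 + q.2 * Complex.I : ℂ) := by fun_prop
        simpa using this.tendsto (0, t)
      obtain ⟨pa, hpa, pb, hpb, h⟩ := eventually_prod_iff.1 (hmap.eventually hK)
      refine ⟨{s | pb s}, mem_nhdsWithin_of_mem_nhds hpb, K, ?_⟩
      filter_upwards [nhdsWithin_le_nhds hpa, self_mem_nhdsWithin] with x hx hx0 s hs
      exact h hx hs (by simpa using hx0)
  obtain ⟨K, hK⟩ := hunif
  have hcontE : ∀ x : ℝ, 0 < x → Continuous fun t : ℝ => x * ‖F (x + t * Complex.I)‖ ^ 2 := by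
    intro x hx
    refine continuous_const.mul (Continuous.pow (Continuous.norm ?_) 2)
    exact (hN.continuous.comp (by fun_prop)).div (hD.continuous.comp (by fun_prop))
      fun t => hD0 _ (by simpa using hx)
  have hEq : ∀ x : ℝ, ∀ t : ℝ, E (x + t * Complex.I) =
      x * ‖F (x + t * Complex.I)‖ ^ 2 - ∑ γ ∈ W, ‖c γ‖ ^ 2 * (x / (x ^ 2 + (t - γ) ^ 2)) := by
    intro x t
    simp only [hE, sq_norm_add_mul_I_sub]
    simp
  have hPint : ∀ x : ℝ, 0 < x → ∀ γ : ℝ, Integrable fun t : ℝ => ‖c γ‖ ^ 2 * (x / (x ^ 2 + (t - γ) ^ 2)) :=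
    fun x hx γ => (integrable_poisson hx γ).const_mul _
  have hEint : ∀ x : ℝ, 0 < x → IntervalIntegrable (fun t : ℝ => E (x + t * Complex.I)) volume (-T) T := by
    intro x hx
    simp_rw [hEq]
    exact ((hcontE x hx).intervalIntegrable _ _).sub
      (integrable_finsetSum W fun γ _ => hPint x hx γ).intervalIntegrable
  have hdct : Tendsto (fun x : ℝ => ∫ t in -T..T, E (x + t * Complex.I)) (𝓝[>] 0) (𝓝 (∫ t in -T..T, (0 : ℝ))) := by
    refine intervalIntegral.tendsto_integral_filter_of_dominated_convergence (fun _ => K) ?_ ?_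
      intervalIntegrable_const ?_
    · filter_upwards [self_mem_nhdsWithin] with x hx
      exact (hEint x hx).aestronglyMeasurable_restrict_uIoc
    · filter_upwards [hK] with x hx
      refine Eventually.of_forall fun t ht => hx t ?_
      rw [Set.uIoc_of_le (by linarith)] at ht
      exact ⟨ht.1.le, ht.2⟩
    · have hnull : volume (W : Set ℝ) = 0 := W.finite_toSet.measure_zero _
      filter_upwards [compl_mem_ae_iff.2 hnull] with t htW ht
      rw [Set.uIoc_of_le (by linarith)] at ht
      have h1 := hE0 t (abs_le.2 ⟨ht.1.le, ht.2⟩) htW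
      have h2 : Tendsto (fun x : ℝ => (x + t * Complex.I : ℂ)) (𝓝[>] 0) (𝓝 (t * Complex.I)) := by
        have : Continuous fun x : ℝ => (x + t * Complex.I : ℂ) := by fun_prop
        have h := this.tendsto 0
        simp only [Complex.ofReal_zero, zero_add] at h
        exact h.mono_left nhdsWithin_le_nhds
      have h3 := h1.tendsto.comp h2
      have h4 : E (t * Complex.I) = 0 := by simp [hE]
      rw [h4] at h3
      exact h3
  rw [intervalIntegral.integral_zero] at hdct
  have hsum : Tendsto (fun x : ℝ => ∑ γ ∈ W, ‖c γ‖ ^ 2 * ∫ t in -T..T, x / (x ^ 2 + (t - γ) ^ 2)) (𝓝[>] 0)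
      (𝓝 (∑ γ ∈ W, ‖c γ‖ ^ 2 * Real.pi)) :=
    tendsto_finsetSum _ fun γ hγ => (tendsto_integral_poisson_window (hW γ hγ).2.2).const_mul _
  have hadd := hdct.add hsum
  rw [zero_add, ← Finset.sum_mul, mul_comm] at hadd
  refine hadd.congr' ?_
  filter_upwards [self_mem_nhdsWithin] with x hx
  have hx' : 0 < x := hx
  simp_rw [hEq]
  rw [intervalIntegral.integral_sub ((hcontE x hx').intervalIntegrable _ _)
      (integrable_finsetSum W fun γ _ => hPint x hx' γ).intervalIntegrable,
    intervalIntegral.integral_finsetSum (fun γ _ => (hPint x hx' γ).intervalIntegrable)]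
  simp_rw [intervalIntegral.integral_const_mul]
  rw [sub_add_cancel, hF]

noncomputable def liouvilleNum (z : ℂ) : ℂ := riemannZeta₁ (1 + 2 * z) * (1 / 2 + z - 1)

noncomputable def liouvilleDen (z : ℂ) : ℂ := 2 * z * (1 / 2 + z) * riemannZeta₁ (1 / 2 + z)

lemma liouvilleTransform_eq_div (z : ℂ) : liouvilleTransform z = liouvilleNum z / liouvilleDen z :=
  div_mul_div_comm _ _ _ _

lemma differentiable_liouvilleNum : Differentiable ℂ liouvilleNum := by
  have h : Differentiable ℂ fun z : ℂ => riemannZeta₁ (1 + 2 * z) :=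
    differentiable_riemannZeta₁.comp (by fun_prop)
  exact h.mul (by fun_prop)

lemma hasDerivAt_liouvilleDen (z : ℂ) :
    HasDerivAt liouvilleDen ((1 + 4 * z) * riemannZeta₁ (1 / 2 + z) +
      2 * z * (1 / 2 + z) * deriv riemannZeta₁ (1 / 2 + z)) z := by
  have h1 : HasDerivAt (fun z : ℂ => riemannZeta₁ (1 / 2 + z)) (deriv riemannZeta₁ (1 / 2 + z)) z :=
    (differentiable_riemannZeta₁ _).hasDerivAt.comp_const_add (1 / 2) z
  have h2 : HasDerivAt (fun z : ℂ => 2 * z * (1 / 2 + z)) (1 + 4 * z) z := by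
    refine (((hasDerivAt_id z).const_mul (2 : ℂ)).mul ((hasDerivAt_id z).const_add (1 / 2))).congr_deriv ?_
    simp only [id]; ring
  exact h2.mul h1

lemma differentiable_liouvilleDen : Differentiable ℂ liouvilleDen :=
  fun z => (hasDerivAt_liouvilleDen z).differentiableAt

lemma liouvilleDen_eq_zero_iff {z : ℂ} :
    liouvilleDen z = 0 ↔ z = 0 ∨ 1 / 2 + z = 0 ∨ riemannZeta (1 / 2 + z) = 0 := by
  rw [liouvilleDen, mul_eq_zero, mul_eq_zero, mul_eq_zero, riemannZeta₁_eq_zero_iff]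
  simp only [OfNat.ofNat_ne_zero, false_or, or_assoc]

/-- The ordinates of the poles of `liouvilleTransform` on the imaginary axis. -/
def poleOrdinates : Set ℝ := insert 0 zetaOrdinates

/-- The squared modulus of the residue of `liouvilleTransform` at `γ * I`. -/
noncomputable def residueSq (γ : ℝ) : ℝ :=
  ‖liouvilleNum (γ * Complex.I) / deriv liouvilleDen (γ * Complex.I)‖ ^ 2

instance : Countable poleOrdinates := (countable_zetaOrdinates.insert 0).to_subtype

lemma residueSq_nonneg (γ : ℝ) : 0 ≤ residueSq γ := by unfold residueSq; positivity

lemma liouvilleDen_mul_I_eq_zero_iff {t : ℝ} : liouvilleDen (t * Complex.I) = 0 ↔ t ∈ poleOrdinates := by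
  rw [liouvilleDen_eq_zero_iff, poleOrdinates, Set.mem_insert_iff]
  refine or_congr (by simp) ((or_iff_right fun h => ?_).trans Iff.rfl)
  have := congrArg Complex.re h
  norm_num at this

lemma finite_poleOrdinates_inter_Icc (a b : ℝ) : (poleOrdinates ∩ Set.Icc a b).Finite := by
  refine ((finite_zeros_im_mem_Icc a b).insert 0).subset ?_
  rintro t ⟨ht | ht, h⟩
  · exact Or.inl ht
  · exact Or.inr ⟨ht, h⟩

lemma riemannZeta_ordinate_ne_zero {γ : ℝ} (hγ : γ ∈ zetaOrdinates)
    (hsimple : ∀ ρ : ℂ, riemannZeta ρ = 0 → 0 < ρ.re → ρ.re < 1 → deriv riemannZeta ρ ≠ 0) : γ ≠ 0 := by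
  rintro rfl
  apply riemannZeta_one_half_ne_zero hsimple
  have : riemannZeta (1 / 2 + (0 : ℝ) * Complex.I) = 0 := hγ
  simpa using this

lemma deriv_liouvilleDen_zero : deriv liouvilleDen 0 = -(1 / 2) * riemannZeta (1 / 2) := by
  rw [(hasDerivAt_liouvilleDen 0).deriv]
  simp only [mul_zero, add_zero, zero_mul, one_mul]
  rw [riemannZeta₁_eq_of_ne_one (by norm_num)]
  norm_num

lemma deriv_liouvilleDen_ordinate {γ : ℝ} (hγ : γ ∈ zetaOrdinates) :
    deriv liouvilleDen (γ * Complex.I) = 2 * (γ * Complex.I) * (1 / 2 + γ * Complex.I) *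
      ((1 / 2 + γ * Complex.I - 1) * deriv riemannZeta (1 / 2 + γ * Complex.I)) := by
  have h0 : riemannZeta (1 / 2 + γ * Complex.I) = 0 := hγ
  rw [(hasDerivAt_liouvilleDen _).deriv, riemannZeta₁_eq_zero_iff.2 h0, mul_zero, zero_add,
    deriv_riemannZeta₁_of_zero h0]

lemma residueSq_zero : residueSq 0 = ‖1 / riemannZeta (1 / 2)‖ ^ 2 := by
  rw [residueSq, Complex.ofReal_zero, zero_mul, deriv_liouvilleDen_zero, liouvilleNum]
  simp only [mul_zero, add_zero, riemannZeta₁_one]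
  congr 2
  rw [show (1 * (1 / 2 - 1) : ℂ) = -(1 / 2) * 1 by norm_num, mul_div_mul_left _ _ (by norm_num)]

section

variable (hsimple : ∀ ρ : ℂ, riemannZeta ρ = 0 → 0 < ρ.re → ρ.re < 1 → deriv riemannZeta ρ ≠ 0)

include hsimple

lemma deriv_liouvilleDen_ne_zero {γ : ℝ} (hγ : γ ∈ poleOrdinates) :
    deriv liouvilleDen (γ * Complex.I) ≠ 0 := by
  rcases hγ with rfl | hγ
  · rw [Complex.ofReal_zero, zero_mul, deriv_liouvilleDen_zero]
    exact mul_ne_zero (by norm_num) (riemannZeta_one_half_ne_zero hsimple)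
  · rw [deriv_liouvilleDen_ordinate hγ]
    have h0 := riemannZeta_ordinate_ne_zero hγ hsimple
    have h1 := hsimple _ hγ (by simp) (by simp; norm_num)
    refine mul_ne_zero (mul_ne_zero ?_ ?_) (mul_ne_zero ?_ h1)
    · simpa using h0
    · intro h; have := congrArg Complex.re h; norm_num at this
    · intro h; have := congrArg Complex.re h; norm_num at this

lemma residueSq_ordinate {γ : ℝ} (hγ : γ ∈ zetaOrdinates) :
    residueSq γ = ‖riemannZeta (2 * ((1 / 2 : ℂ) + γ * Complex.I)) /
      (((1 / 2 : ℂ) + γ * Complex.I) * deriv riemannZeta (1 / 2 + γ * Complex.I))‖ ^ 2 := by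
  have h0 := riemannZeta_ordinate_ne_zero hγ hsimple
  have hz : (2 * (γ * Complex.I) : ℂ) ≠ 0 := by simpa using h0
  have hs : (1 / 2 + γ * Complex.I - 1 : ℂ) ≠ 0 := by
    intro h; have := congrArg Complex.re h; norm_num at this
  rw [residueSq, deriv_liouvilleDen_ordinate hγ, liouvilleNum,
    riemannZeta₁_eq_of_ne_one (by simpa using h0), add_sub_cancel_left,
    show (1 + 2 * (γ * Complex.I) : ℂ) = 2 * (1 / 2 + γ * Complex.I) by ring]
  congr 2
  rw [show ∀ a b c d e : ℂ, a * b * c / (a * d * (c * e)) = (a * c) * b / ((a * c) * (d * e)) by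
    intros; ring_nf, mul_div_mul_left _ _ (mul_ne_zero hz hs)]

end

section

variable (hRH : ∀ ρ : ℂ, riemannZeta ρ = 0 → 0 < ρ.re → ρ.re < 1 → ρ.re = 1 / 2)

include hRH

lemma liouvilleDen_ne_zero {z : ℂ} (hz : 0 < z.re) : liouvilleDen z ≠ 0 := by
  intro h
  rcases liouvilleDen_eq_zero_iff.1 h with h | h | h
  · rw [h] at hz; simp at hz
  · have := congrArg Complex.re h
    norm_num at this; linarith
  · obtain ⟨h1, h2⟩ := re_pos_of_riemannZeta_eq_zero h (Or.inr (by norm_num; linarith))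
    have := hRH _ h h1 h2
    norm_num at this; linarith

lemma differentiableAt_liouvilleTransform {z : ℂ} (hz : 0 < z.re) :
    DifferentiableAt ℂ liouvilleTransform z := by
  rw [show liouvilleTransform = fun z => liouvilleNum z / liouvilleDen z from funext liouvilleTransform_eq_div]
  exact (differentiable_liouvilleNum z).div (differentiable_liouvilleDen z) (liouvilleDen_ne_zero hRH hz)

lemma continuous_liouvilleTransform_vertical {x : ℝ} (hx : 0 < x) :
    Continuous fun t : ℝ => liouvilleTransform (x + t * Complex.I) := by
  rw [continuous_iff_continuousAt]
  intro t
  exact ContinuousAt.comp (f := fun t : ℝ => (x + t * Complex.I : ℂ))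
    (differentiableAt_liouvilleTransform hRH (by simpa using hx)).continuousAt (by fun_prop)

variable (hsimple : ∀ ρ : ℂ, riemannZeta ρ = 0 → 0 < ρ.re → ρ.re < 1 → deriv riemannZeta ρ ≠ 0)

include hsimple

lemma tendsto_mul_integral_liouvilleTransform_window {T : ℝ} (hT : 0 ≤ T) (h1 : T ∉ poleOrdinates)
    (h2 : -T ∉ poleOrdinates) :
    Tendsto (fun x : ℝ => ∫ t in -T..T, x * ‖liouvilleTransform (x + t * Complex.I)‖ ^ 2) (𝓝[>] 0)
      (𝓝 (Real.pi * ∑ γ ∈ (finite_poleOrdinates_inter_Icc (-T) T).toFinset, residueSq γ)) := by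
  simp only [liouvilleTransform_eq_div]
  refine tendsto_mul_integral_window differentiable_liouvilleNum differentiable_liouvilleDen hT _ ?_ ?_
    fun z hz => liouvilleDen_ne_zero hRH hz
  · intro γ hγ
    rw [Set.Finite.mem_toFinset] at hγ
    refine ⟨liouvilleDen_mul_I_eq_zero_iff.2 hγ.1, deriv_liouvilleDen_ne_zero hsimple hγ.1, abs_lt.2
      ⟨hγ.2.1.lt_of_ne ?_, hγ.2.2.lt_of_ne ?_⟩⟩
    · rintro rfl; exact h2 hγ.1
    · rintro rfl; exact h1 hγ.1
  · intro t ht hd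
    rw [Set.Finite.mem_toFinset]
    exact ⟨liouvilleDen_mul_I_eq_zero_iff.1 hd, abs_le.1 ht⟩

variable (hsum : ∑' γ : zetaOrdinates, ENNReal.ofReal
    ((1 + |(γ : ℝ)|) ^ (-(7 / 5) : ℝ) / ‖deriv riemannZeta (1 / 2 + (γ : ℝ) * Complex.I)‖ ^ 2) ≠ ⊤)

include hsum

lemma integrable_norm_liouvilleTransform_sq {x : ℝ} (hx : 0 < x) (hx2 : x ≤ 3 / 2) :
    Integrable fun t : ℝ => ‖liouvilleTransform (x + t * Complex.I)‖ ^ 2 := by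
  obtain ⟨G, hG, h⟩ := exists_integrable_bound hRH hsimple hsum hx
  refine hG.mono' ((continuous_liouvilleTransform_vertical hRH hx).norm.pow 2).aestronglyMeasurable ?_
  filter_upwards [h] with t ht
  rw [Real.norm_of_nonneg (by positivity)]
  exact ht _ (by simp) (by simpa using hx2) (by simp)

lemma exists_integral_le_window_add : ∃ K : ℝ, 0 ≤ K ∧ ∀ x : ℝ, 0 < x → x ≤ 3 / 2 → ∀ T : ℝ, 1 ≤ T →
    (∫ t in -T..T, x * ‖liouvilleTransform (x + t * Complex.I)‖ ^ 2) ≤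
      ∫ t : ℝ, x * ‖liouvilleTransform (x + t * Complex.I)‖ ^ 2 ∧
    (∫ t : ℝ, x * ‖liouvilleTransform (x + t * Complex.I)‖ ^ 2) ≤
      (∫ t in -T..T, x * ‖liouvilleTransform (x + t * Complex.I)‖ ^ 2) + K * T ^ (-(1 / 10) : ℝ) := by
  obtain ⟨K, hK, h⟩ := exists_lintegral_tail_le hRH hsimple hsum
  refine ⟨K, hK, fun x hx hx2 T hT => ?_⟩
  have hi := (integrable_norm_liouvilleTransform_sq hRH hsimple hsum hx hx2).const_mul x
  set g : ℝ → ℝ := fun t => x * ‖liouvilleTransform (x + t * Complex.I)‖ ^ 2 with hg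
  have hg0 : ∀ t, 0 ≤ g t := fun t => by positivity
  rw [intervalIntegral.integral_of_le (by linarith), ← integral_add_compl measurableSet_Ioc hi]
  refine ⟨le_add_of_nonneg_right (integral_nonneg hg0), add_le_add le_rfl ?_⟩
  rw [integral_eq_lintegral_of_nonneg_ae (Eventually.of_forall hg0) hi.integrableOn.aestronglyMeasurable]
  refine ENNReal.toReal_le_of_le_ofReal (by positivity) (le_trans (lintegral_mono_set ?_) (h x hx hx2 T hT))
  intro t ht
  by_contra hcon
  have hcon' : ¬ T ≤ |t| := hcon
  have := abs_lt.1 (not_le.1 hcon')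
  exact ht ⟨this.1, this.2.le⟩

lemma tendsto_mul_integral_liouvilleTransform :
    Summable (fun γ : poleOrdinates => residueSq γ) ∧
    Tendsto (fun x : ℝ => ∫ t : ℝ, x * ‖liouvilleTransform (x + t * Complex.I)‖ ^ 2) (𝓝[>] 0)
      (𝓝 (Real.pi * ∑' γ : poleOrdinates, residueSq γ)) := by
  classical
  obtain ⟨K, hK, h⟩ := exists_integral_le_window_add hRH hsimple hsum
  have hT : ∀ n : ℕ, ∃ T : ℝ, (n + 1 : ℝ) < T ∧ T < n + 2 ∧ T ∉ poleOrdinates ∧ -T ∉ poleOrdinates := by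
    intro n
    have hc : (poleOrdinates ∪ Neg.neg ⁻¹' poleOrdinates).Countable :=
      (countable_zetaOrdinates.insert 0).union ((countable_zetaOrdinates.insert 0).preimage neg_injective)
    obtain ⟨T, hT, hT1, hT2⟩ := hc.dense_compl ℝ |>.exists_between (show (n + 1 : ℝ) < n + 2 by linarith)
    rw [Set.mem_compl_iff, Set.mem_union, not_or] at hT
    exact ⟨T, hT1, hT2, hT.1, hT.2⟩
  choose T hT1 hT2 hT3 hT4 using hT
  have hT0 : ∀ n, 1 ≤ T n := fun n => by have := hT1 n; have : (0 : ℝ) ≤ n := n.cast_nonneg; linarith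
  have hTtop : Tendsto T atTop atTop :=
    tendsto_atTop_mono (fun n => by have := hT1 n; linarith) tendsto_natCast_atTop_atTop
  have hTmono : Monotone T := monotone_nat_of_le_succ fun n => by
    have := hT1 (n + 1); have := hT2 n; push_cast at *; linarith
  set W : ℕ → Finset ℝ := fun n => (finite_poleOrdinates_inter_Icc (-T n) (T n)).toFinset with hW
  set J : ℕ → ℝ → ℝ := fun n x => ∫ t in -T n..T n, x * ‖liouvilleTransform (x + t * Complex.I)‖ ^ 2 with hJ
  set M : ℝ → ℝ := fun x => ∫ t : ℝ, x * ‖liouvilleTransform (x + t * Complex.I)‖ ^ 2 with hM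
  have hlim : ∀ n, Tendsto (J n) (𝓝[>] 0) (𝓝 (Real.pi * ∑ γ ∈ W n, residueSq γ)) := fun n =>
    tendsto_mul_integral_liouvilleTransform_window hRH hsimple (by linarith [hT0 n]) (hT3 n) (hT4 n)
  have hx : ∀ᶠ x : ℝ in 𝓝[>] 0, 0 < x ∧ x ≤ 3 / 2 := by
    filter_upwards [Ioc_mem_nhdsGT (show (0 : ℝ) < 3 / 2 by norm_num)] with x hx using hx
  have hle : ∀ n, ∑ γ ∈ W n, residueSq γ ≤
      (Real.pi * ∑ γ ∈ W 0, residueSq γ + K * T 0 ^ (-(1 / 10) : ℝ)) / Real.pi := by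
    intro n
    rw [le_div_iff₀ Real.pi_pos, mul_comm]
    refine le_of_tendsto_of_tendsto (hlim n) ((hlim 0).add_const _) ?_
    filter_upwards [hx] with x hx
    exact (h x hx.1 hx.2 (T n) (hT0 n)).1.trans (h x hx.1 hx.2 (T 0) (hT0 0)).2
  set V : ℕ → Finset poleOrdinates := fun n => (W n).subtype (· ∈ poleOrdinates) with hV
  have hVW : ∀ n, ∑ γ ∈ V n, residueSq γ = ∑ γ ∈ W n, residueSq γ := fun n =>
    Finset.sum_subtype_of_mem residueSq fun γ hγ => ((Set.Finite.mem_toFinset _).1 hγ).1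
  have hVtop : Tendsto V atTop atTop := by
    refine tendsto_atTop_finset_of_monotone ?_ ?_
    · intro m n hmn γ hγ
      rw [Finset.mem_subtype, Set.Finite.mem_toFinset] at hγ ⊢
      have := hTmono hmn
      exact ⟨hγ.1, by linarith [hγ.2.1], by linarith [hγ.2.2]⟩
    · intro γ
      obtain ⟨n, hn⟩ := (hTtop.eventually_ge_atTop |(γ : ℝ)|).exists
      refine ⟨n, ?_⟩
      rw [Finset.mem_subtype, Set.Finite.mem_toFinset]
      exact ⟨γ.2, abs_le.1 hn⟩
  have hsummable : Summable (fun γ : poleOrdinates => residueSq γ) := by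
    refine summable_of_sum_le (fun γ => residueSq_nonneg γ) (fun U => ?_)
      (c := (Real.pi * ∑ γ ∈ W 0, residueSq γ + K * T 0 ^ (-(1 / 10) : ℝ)) / Real.pi)
    obtain ⟨n, hn⟩ := (hVtop.eventually_ge_atTop U).exists
    exact (Finset.sum_le_sum_of_subset_of_nonneg hn fun γ _ _ => residueSq_nonneg γ).trans
      ((hVW n).trans_le (hle n))
  refine ⟨hsummable, ?_⟩
  have hSn := (hsummable.hasSum.comp hVtop).const_mul Real.pi
  have hKn : Tendsto (fun n => K * T n ^ (-(1 / 10) : ℝ)) atTop (𝓝 0) := by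
    have := ((tendsto_rpow_neg_atTop (show (0 : ℝ) < 1 / 10 by norm_num)).comp hTtop).const_mul K
    simpa using this
  rw [Metric.tendsto_nhds]
  intro ε hε
  obtain ⟨n, hn1, hn2⟩ := ((Metric.tendsto_nhds.1 hSn (ε / 3) (by positivity)).and
    (hKn.eventually_lt_const (show (0 : ℝ) < ε / 3 by positivity))).exists
  simp only [Function.comp_apply, hVW, Real.dist_eq] at hn1
  filter_upwards [Metric.tendsto_nhds.1 (hlim n) (ε / 3) (by positivity), hx] with x h1 h2
  obtain ⟨h3, h4⟩ := h x h2.1 h2.2 (T n) (hT0 n)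
  rw [Real.dist_eq, abs_lt] at *
  constructor <;> linarith [h1.1, h1.2, hn1.1, hn1.2]

end

lemma abs_liouville (n : ℕ) : |liouville n| = 1 := by simp [liouville]

/-- The completely multiplicative function `n ↦ λ(n) n^(-s)`. -/
noncomputable def liouvilleSummandHom {s : ℂ} (hs : s ≠ 0) : ℕ →*₀ ℂ where
  toFun n := (ArithmeticFunction.liouville n : ℂ) * riemannZetaSummandHom hs n
  map_zero' := by simp
  map_one' := by simp [ArithmeticFunction.liouville_apply_one]
  map_mul' m n := by
    rw [ArithmeticFunction.liouville_apply_mul, map_mul]; push_cast; ring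

lemma term_liouville_eq {s : ℂ} (hs : s ≠ 0) (n : ℕ) :
    LSeries.term (fun n => (liouville n : ℂ)) s n = liouvilleSummandHom hs n := by
  rcases eq_or_ne n 0 with rfl | hn
  · simp
  · rw [LSeries.term_of_ne_zero hn]
    change _ = (ArithmeticFunction.liouville n : ℂ) * (n : ℂ) ^ (-s)
    rw [ArithmeticFunction.liouville_apply hn, Complex.cpow_neg, div_eq_mul_inv, liouville]
    push_cast; rfl

lemma LSeries_liouville_mul_riemannZeta {s : ℂ} (hs : 1 < s.re) :
    LSeries (fun n => (liouville n : ℂ)) s * riemannZeta s = riemannZeta (2 * s) := by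
  have hs0 : s ≠ 0 := by rintro rfl; norm_num at hs
  have hsum : Summable fun n => ‖liouvilleSummandHom hs0 n‖ := by
    refine (summable_riemannZetaSummand hs).of_nonneg_of_le (fun _ => norm_nonneg _) fun n => ?_
    rcases eq_or_ne n 0 with rfl | hn
    · simp
    · change ‖(ArithmeticFunction.liouville n : ℂ) * riemannZetaSummandHom _ n‖ ≤ _
      rw [ArithmeticFunction.liouville_apply hn]
      simp
  have h1 := EulerProduct.eulerProduct_completely_multiplicative_hasProd hsum
  have h2 := riemannZeta_eulerProduct_hasProd hs
  have h3 := riemannZeta_eulerProduct_hasProd (s := 2 * s) (by simp; linarith)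
  have e : LSeries (fun n => (liouville n : ℂ)) s = ∑' n, liouvilleSummandHom hs0 n :=
    tsum_congr (term_liouville_eq hs0)
  rw [e]
  refine (h1.mul h2).unique ?_
  convert h3 using 2 with p
  have hp := p.2.ne_zero
  have hl : liouvilleSummandHom hs0 p = -((p : ℕ) : ℂ) ^ (-s) := by
    change (ArithmeticFunction.liouville p : ℂ) * ((p : ℕ) : ℂ) ^ (-s) = _
    rw [ArithmeticFunction.liouville_apply hp, ArithmeticFunction.cardFactors_apply_prime p.2]
    push_cast; ring
  have e2 : ((p : ℕ) : ℂ) ^ (-(2 * s)) = (((p : ℕ) : ℂ) ^ (-s)) ^ 2 := by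
    rw [← Complex.cpow_nat_mul]; congr 1; push_cast; ring
  rw [hl, e2, ← mul_inv]
  congr 1
  ring

lemma abs_sum_liouville_le (n : ℕ) : |∑ k ∈ Finset.Icc 1 n, liouville k| ≤ n := by
  refine (Finset.abs_sum_le_sum_abs _ _).trans ?_
  simp [abs_liouville]

lemma abs_Lfun_exp_le (y : ℝ) : |Lfun (Real.exp y)| ≤ Real.exp y :=
  (abs_sum_liouville_le _).trans (Nat.floor_le (Real.exp_pos y).le)

lemma LSeries_liouville_eq_integral {s : ℂ} (hs : 1 < s.re) :
    LSeries (fun n => (liouville n : ℂ)) s =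
      s * ∫ y in Set.Ioi (0 : ℝ), (Lfun (Real.exp y) : ℂ) * Complex.exp (-s * y) := by
  have hO : (fun n : ℕ => ∑ k ∈ Finset.Icc 1 n, ‖(liouville k : ℂ)‖) =O[atTop] fun n => (n : ℝ) ^ (1 : ℝ) := by
    refine Asymptotics.isBigO_of_le _ fun n => ?_
    simp [abs_liouville]
  rw [LSeries_eq_mul_integral' (fun n => (liouville n : ℂ)) zero_le_one hs hO]
  congr 1
  have himg : Real.exp '' Set.Ioi 0 = Set.Ioi 1 := by
    ext x
    constructor
    · rintro ⟨y, hy, rfl⟩; exact Real.one_lt_exp_iff.2 hy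
    · intro hx
      have hx1 : (1 : ℝ) < x := hx
      exact ⟨Real.log x, Real.log_pos hx1, Real.exp_log (by linarith)⟩
  rw [← himg, integral_image_eq_integral_abs_deriv_smul measurableSet_Ioi
    (fun y _ => (Real.hasDerivAt_exp y).hasDerivWithinAt) Real.exp_injective.injOn]
  refine setIntegral_congr_fun measurableSet_Ioi fun y _ => ?_
  simp only [Lfun]
  rw [abs_of_pos (Real.exp_pos y), Complex.real_smul, Complex.cpow_def_of_ne_zero
    (by exact_mod_cast (Real.exp_pos y).ne'), ← Complex.ofReal_log (Real.exp_pos y).le, Real.log_exp,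
    Complex.ofReal_exp, mul_left_comm, ← Complex.exp_add, Complex.ofReal_sum]
  congr 2
  ring

/-- The normalised summatory function `L(e^y) / e^(y/2)`. -/
noncomputable def normalizedL (y : ℝ) : ℝ := Lfun (Real.exp y) / Real.exp (y / 2)

lemma liouvilleTransform_eq_integral {z : ℂ} (hz : 1 / 2 < z.re) :
    liouvilleTransform z = ∫ y in Set.Ioi (0 : ℝ), (normalizedL y : ℂ) * Complex.exp (-z * y) := by
  have hs : 1 < (1 / 2 + z).re := by norm_num; linarith
  have hs0 : 1 / 2 + z ≠ 0 := by intro h; rw [h] at hs; norm_num at hs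
  have hs1 : 1 / 2 + z ≠ 1 := by intro h; rw [h] at hs; norm_num at hs
  have hz0 : 2 * z ≠ 0 := by
    intro h; have := congrArg Complex.re h; norm_num at this; linarith
  have hζ := riemannZeta_ne_zero_of_one_le_re hs.le
  have h1 := LSeries_liouville_mul_riemannZeta hs
  rw [LSeries_liouville_eq_integral hs] at h1
  have e : ∫ y in Set.Ioi (0 : ℝ), (normalizedL y : ℂ) * Complex.exp (-z * y) =
      ∫ y in Set.Ioi (0 : ℝ), (Lfun (Real.exp y) : ℂ) * Complex.exp (-(1 / 2 + z) * y) := by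
    congr 1
    funext y
    rw [normalizedL, Complex.ofReal_div, Complex.ofReal_exp, div_eq_mul_inv, ← Complex.exp_neg, mul_assoc,
      ← Complex.exp_add]
    congr 2
    push_cast; ring
  rw [e, liouvilleTransform, riemannZeta₁_eq_of_ne_one hs1, riemannZeta₁_eq_of_ne_one (by simpa using hz0),
    add_sub_cancel_left, show 1 + 2 * z = 2 * (1 / 2 + z) by ring, ← h1]
  have hs2 := sub_ne_zero.2 hs1
  generalize ∫ y in Set.Ioi (0 : ℝ), (Lfun (Real.exp y) : ℂ) * Complex.exp (-(1 / 2 + z) * y) = I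
  rw [div_mul_div_comm, div_eq_iff (mul_ne_zero (mul_ne_zero hz0 hs0) (mul_ne_zero hs2 hζ))]
  ring

lemma abs_normalizedL_le (y : ℝ) : |normalizedL y| ≤ Real.exp (y / 2) := by
  rw [normalizedL, abs_div, abs_of_pos (Real.exp_pos _), div_le_iff₀ (Real.exp_pos _), ← Real.exp_add, add_halves]
  exact abs_Lfun_exp_le y

lemma measurable_normalizedL : Measurable normalizedL := by
  have : Measurable Lfun := by
    have h : Lfun = (fun n : ℕ => ∑ k ∈ Finset.Icc 1 n, liouville k) ∘ fun x : ℝ => ⌊x⌋₊ := rfl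
    rw [h]
    exact (measurable_from_nat).comp Nat.measurable_floor
  exact (this.comp Real.measurable_exp).div (Real.measurable_exp.comp (measurable_id.div_const 2))

open scoped FourierTransform SchwartzMap ContDiff in
lemma fourier_toLp_ae_eq {f : ℝ → ℂ} (h1 : Integrable f) (h2 : MemLp f 2) :
    (𝓕 (h2.toLp f) : Lp ℂ 2 (volume : Measure ℝ)) =ᵐ[volume] 𝓕 f := by
  have hcont : Continuous (𝓕 f) := VectorFourier.fourierIntegral_continuous Real.continuous_fourierChar
    (by exact continuous_inner) h1
  refine ae_eq_of_integral_contDiff_smul_eq ((Lp.memLp _).locallyIntegrable (by norm_num))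
    hcont.locallyIntegrable fun g hg hgc => ?_
  have hg₁ : HasCompactSupport (Complex.ofRealCLM ∘ g) := hgc.comp_left rfl
  have hg₂ : ContDiff ℝ ∞ (Complex.ofRealCLM ∘ g) := by fun_prop
  set G : 𝓢(ℝ, ℂ) := hg₁.toSchwartzMap hg₂ with hG
  have hGg : ∀ x, G x = (g x : ℂ) := fun x => rfl
  have e1 : ∫ x, g x • (𝓕 (h2.toLp f) : Lp ℂ 2 (volume : Measure ℝ)) x =
      (Lp.toTemperedDistribution (𝓕 (h2.toLp f))) G := by
    rw [Lp.toTemperedDistribution_apply]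
    rfl
  rw [e1, ← Lp.fourier_toTemperedDistribution_eq, TemperedDistribution.fourier_apply,
    Lp.toTemperedDistribution_apply]
  have e2 : ∫ x, (𝓕 G) x • (h2.toLp f) x = ∫ x, 𝓕 (G : ℝ → ℂ) x • f x := by
    refine integral_congr_ae ?_
    filter_upwards [h2.coeFn_toLp] with x hx
    rw [hx]; rfl
  rw [e2]
  have := VectorFourier.integral_fourierIntegral_smul_eq_flip (L := innerₗ ℝ)
      Real.continuous_fourierChar (by exact continuous_inner) (G.integrable (μ := volume)) h1
  simp only [flip_innerₗ] at this
  exact this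

open scoped FourierTransform in
/-- **Plancherel's theorem** for integrable and square-integrable functions. -/
lemma integral_norm_fourier_sq {f : ℝ → ℂ} (h1 : Integrable f) (h2 : MemLp f 2) :
    ∫ x, ‖𝓕 f x‖ ^ 2 = ∫ x, ‖f x‖ ^ 2 := by
  have e : ∀ u : Lp ℂ 2 (volume : Measure ℝ), ‖u‖ ^ 2 = ∫ x, ‖u x‖ ^ 2 := by
    intro u
    have h0 := inner_self_eq_norm_sq_to_K (𝕜 := ℂ) u
    rw [L2.inner_def] at h0
    have h3 : ∫ x, inner ℂ (u x) (u x) = ((∫ x, ‖u x‖ ^ 2 : ℝ) : ℂ) := by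
      rw [← integral_complex_ofReal]
      refine integral_congr_ae (.of_forall fun x => ?_)
      simp
    rw [h3] at h0
    refine Complex.ofReal_injective ?_
    rw [h0]; push_cast; rfl
  calc ∫ x, ‖𝓕 f x‖ ^ 2
      = ∫ x, ‖(𝓕 (h2.toLp f) : Lp ℂ 2 (volume : Measure ℝ)) x‖ ^ 2 :=
        integral_congr_ae ((fourier_toLp_ae_eq h1 h2).mono fun x hx => by simp only [hx])
    _ = ‖h2.toLp f‖ ^ 2 := by rw [← e, Lp.norm_fourier_eq]
    _ = ∫ x, ‖f x‖ ^ 2 := by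
        rw [e]
        exact integral_congr_ae ((h2.coeFn_toLp).mono fun x hx => by simp only [hx])

/-- **Landau's lemma**: a moment generating function of a nonnegative random variable that extends
holomorphically to a disc around `v` is finite and given by the extension there. -/
lemma integrable_exp_of_extension {μ : Measure ℝ} {X : ℝ → ℝ} (hX : ∀ᵐ ω ∂μ, 0 ≤ X ω) {v R : ℝ}
    (hR : 0 < R) (hv : v ∈ interior (ProbabilityTheory.integrableExpSet X μ)) {M : ℂ → ℂ}
    (hM : DifferentiableOn ℂ M (Metric.ball (v : ℂ) R))
    (hMv : ∀ᶠ x : ℝ in 𝓝 v, M x = ∫ ω, Real.exp (x * X ω) ∂μ) {h : ℝ} (h0 : 0 ≤ h) (hhR : h < R) :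
    Integrable (fun ω => Real.exp ((v + h) * X ω)) μ ∧
      ((∫ ω, Real.exp ((v + h) * X ω) ∂μ : ℝ) : ℂ) = M (v + h) := by
  have hMa : AnalyticAt ℂ M v := hM.analyticAt (Metric.ball_mem_nhds _ hR)
  have hca := ProbabilityTheory.analyticAt_complexMGF (X := X) (μ := μ) (z := (v : ℂ)) (by simpa using hv)
  have heq : M =ᶠ[𝓝 (v : ℂ)] ProbabilityTheory.complexMGF X μ := by
    refine (hMa.frequently_eq_iff_eventually_eq hca).1 ?_
    have ht : Tendsto (fun x : ℝ => (x : ℂ)) (𝓝[≠] v) (𝓝[≠] (v : ℂ)) := by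
      refine Complex.continuous_ofReal.continuousAt.continuousWithinAt.tendsto_nhdsWithin fun x hx => ?_
      simpa using hx
    refine ht.frequently (Eventually.frequently ?_)
    filter_upwards [hMv.filter_mono nhdsWithin_le_nhds] with x hx
    rw [hx, ProbabilityTheory.complexMGF_ofReal]
    rfl
  set F : ℕ → ℝ → ℝ := fun n ω => (n.factorial : ℝ)⁻¹ * h ^ n * (X ω ^ n * Real.exp (v * X ω)) with hF
  have hFi : ∀ n, Integrable (F n) μ := fun n =>
    (ProbabilityTheory.integrable_pow_mul_exp_of_mem_interior_integrableExpSet hv n).const_mul _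
  have hFs : ∀ ω, HasSum (fun n => F n ω) (Real.exp ((v + h) * X ω)) := by
    intro ω
    have := (NormedSpace.expSeries_div_hasSum_exp (𝔸 := ℝ) (h * X ω)).mul_right (Real.exp (v * X ω))
    rw [← Real.exp_eq_exp_ℝ, ← Real.exp_add] at this
    convert! this using 1
    · ext n; simp only [hF, mul_pow]; field_simp
    · ring_nf
  have hT := Complex.hasSum_taylorSeries_on_ball (f := M) (c := (v : ℂ)) (r := R) (z := ((v + h : ℝ) : ℂ)) hM
    (by simpa [abs_of_nonneg h0] using hhR)
  have hT' : HasSum (fun n => ((∫ ω, F n ω ∂μ : ℝ) : ℂ)) (M ((v + h : ℝ) : ℂ)) := by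
    convert! hT using 2 with n
    rw [heq.iteratedDeriv_eq, ProbabilityTheory.iteratedDeriv_complexMGF (by simpa using hv)]
    simp only [hF, integral_const_mul, smul_eq_mul]
    push_cast
    rw [← integral_complex_ofReal]
    simp
    ring
  have hS : Summable fun n => ∫ ω, F n ω ∂μ := by
    have := (Complex.hasSum_iff _ _).1 hT'
    simpa using this.1.summable
  have hFn : ∀ n, ∫ ω, ‖F n ω‖ ∂μ = ∫ ω, F n ω ∂μ := fun n =>
    integral_congr_ae (hX.mono fun ω hω => Real.norm_of_nonneg (by simp only [hF]; positivity))
  have hI := hasSum_integral_of_summable_integral_norm hFi (by simpa only [hFn] using hS)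
  simp only [(hFs _).tsum_eq] at hI
  refine ⟨?_, ?_⟩
  · have hm : AEStronglyMeasurable (fun ω => Real.exp ((v + h) * X ω)) μ :=
      aestronglyMeasurable_of_tendsto_ae atTop (f := fun n ω => ∑ i ∈ Finset.range n, F i ω)
        (fun n => (integrable_finsetSum _ fun i _ => hFi i).aestronglyMeasurable)
        (.of_forall fun ω => (hFs ω).tendsto_sum_nat)
    refine ⟨hm, ?_⟩
    rw [hasFiniteIntegral_iff_ofReal (.of_forall fun ω => (Real.exp_pos _).le)]
    have : ∫⁻ ω, ENNReal.ofReal (Real.exp ((v + h) * X ω)) ∂μ = ∑' n, ENNReal.ofReal (∫ ω, F n ω ∂μ) := by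
      calc _ = ∫⁻ ω, ∑' n, ENNReal.ofReal (F n ω) ∂μ := by
            refine lintegral_congr_ae (hX.mono fun ω hω => ?_)
            simp only
            rw [← (hFs ω).tsum_eq, ENNReal.ofReal_tsum_of_nonneg _ (hFs ω).summable]
            intro n; simp only [hF]; positivity
        _ = ∑' n, ∫⁻ ω, ENNReal.ofReal (F n ω) ∂μ :=
            lintegral_tsum fun n => (hFi n).aestronglyMeasurable.aemeasurable.ennreal_ofReal
        _ = _ := by
            refine tsum_congr fun n => (ofReal_integral_eq_lintegral_ofReal (hFi n) ?_).symm
            exact hX.mono fun ω hω => by simp only [hF, Pi.zero_apply]; positivity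
    rw [this]
    exact hS.tsum_ofReal_lt_top
  · have := hT'.unique ((Complex.hasSum_ofReal).2 hI)
    rw [← this]; push_cast; rfl

/-- A locally dominated integral of holomorphic functions is holomorphic. -/
lemma differentiableOn_integral_of_dominated {U : Set ℂ} (hU : IsOpen U) {F : ℂ → ℝ → ℂ}
    (hF : ∀ t, DifferentiableOn ℂ (fun z => F z t) U) (hm : ∀ z ∈ U, AEStronglyMeasurable (F z))
    (hb : ∀ z₀ ∈ U, ∃ ε > 0, ∃ G : ℝ → ℝ, Integrable G ∧
      ∀ᵐ t, ∀ z ∈ Metric.ball z₀ ε, ‖F z t‖ ≤ G t) :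
    DifferentiableOn ℂ (fun z => ∫ t, F z t) U := by
  intro z₀ hz₀
  obtain ⟨ε₁, hε₁, hεU⟩ := Metric.isOpen_iff.1 hU z₀ hz₀
  obtain ⟨ε₂, hε₂, G, hG, hGb⟩ := hb z₀ hz₀
  set ε := min ε₁ ε₂ / 2 with hε
  have hε0 : 0 < ε := by positivity
  have hεε₁ : 2 * ε ≤ ε₁ := by rw [hε]; linarith [min_le_left ε₁ ε₂]
  have hεε₂ : 2 * ε ≤ ε₂ := by rw [hε]; linarith [min_le_right ε₁ ε₂]
  have hsub : Metric.ball z₀ (2 * ε) ⊆ U := (Metric.ball_subset_ball hεε₁).trans hεU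
  have hsub1 : ∀ z ∈ Metric.ball z₀ ε, Metric.closedBall z (ε / 2) ⊆ Metric.ball z₀ (2 * ε) := by
    intro z hz w hw
    rw [Metric.mem_ball] at hz ⊢; rw [Metric.mem_closedBall] at hw
    linarith [dist_triangle w z z₀]
  have hd : ∀ t, ∀ z ∈ Metric.ball z₀ ε, HasDerivAt (fun z => F z t) (deriv (fun z => F z t) z) z :=
    fun t z hz => ((hF t).differentiableAt (hU.mem_nhds (hsub (Metric.ball_subset_ball (by linarith) hz)))).hasDerivAt
  have hz₀b : z₀ ∈ Metric.ball z₀ ε := Metric.mem_ball_self hε0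
  have hmF' : AEStronglyMeasurable (fun t => deriv (fun z => F z t) z₀) := by
    have hc : Tendsto (fun n : ℕ => ((ε / (n + 1) : ℝ) : ℂ)) atTop (𝓝[≠] 0) := by
      refine tendsto_nhdsWithin_iff.2 ⟨?_, .of_forall fun n => ?_⟩
      · have := tendsto_const_div_atTop_nhds_zero_nat ε
        have := (tendsto_add_atTop_iff_nat 1).2 this
        have h2 := (Complex.continuous_ofReal.tendsto 0).comp this
        simpa [Function.comp_def] using h2
      · simp only [Set.mem_compl_iff, Set.mem_singleton_iff, Complex.ofReal_eq_zero]
        positivity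
    refine aestronglyMeasurable_of_tendsto_ae atTop (f := fun (n : ℕ) t =>
      ((ε / (n + 1) : ℝ) : ℂ)⁻¹ • (F (z₀ + (ε / (n + 1) : ℝ)) t - F z₀ t)) (fun n => ?_)
      (.of_forall fun t => (hasDerivAt_iff_tendsto_slope_zero.1 (hd t z₀ hz₀b)).comp hc)
    refine ((hm _ (hsub ?_)).sub (hm _ hz₀)).const_smul (_ : ℂ)
    rw [Metric.mem_ball, dist_eq_norm, add_sub_cancel_left, Complex.norm_real, Real.norm_of_nonneg (by positivity)]
    have : ε / (n + 1) ≤ ε := div_le_self hε0.le (by linarith [(Nat.cast_nonneg n : (0 : ℝ) ≤ n)])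
    linarith
  refine (hasDerivAt_integral_of_dominated_loc_of_deriv_le (Metric.ball_mem_nhds z₀ hε0)
    (F := F) (F' := fun z t => deriv (fun z => F z t) z) (bound := fun t => G t / (ε / 2))
    ?_ ?_ hmF' ?_ (hG.div_const _) (.of_forall fun t => hd t)).2.differentiableAt.differentiableWithinAt
  · filter_upwards [hU.mem_nhds hz₀] with z hz using hm z hz
  · exact hG.mono' (hm _ hz₀) (hGb.mono fun t ht => ht _ (Metric.mem_ball_self hε₂))
  · filter_upwards [hGb] with t ht z hz
    refine Complex.norm_deriv_le_of_forall_mem_sphere_norm_le (by positivity) ?_ fun w hw => ?_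
    · refine DifferentiableOn.diffContOnCl_ball (U := U) (hF t) ((hsub1 z hz).trans hsub)
    · exact ht w (Metric.ball_subset_ball hεε₂ (hsub1 z hz (Metric.sphere_subset_closedBall hw)))

lemma riemannZeta₁_conj (s : ℂ) :
    riemannZeta₁ (starRingEnd ℂ s) = starRingEnd ℂ (riemannZeta₁ s) := by
  rcases eq_or_ne s 1 with rfl | hs
  · simp [riemannZeta₁_one]
  · have hs' : starRingEnd ℂ s ≠ 1 := fun h => hs (by simpa using congrArg (starRingEnd ℂ) h)
    rw [riemannZeta₁_eq_of_ne_one hs, riemannZeta₁_eq_of_ne_one hs', riemannZeta_conj]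
    simp

lemma liouvilleTransform_conj (z : ℂ) :
    liouvilleTransform (starRingEnd ℂ z) = starRingEnd ℂ (liouvilleTransform z) := by
  simp only [liouvilleTransform, map_mul, map_div₀, map_add, map_sub, map_one, map_ofNat,
    ← riemannZeta₁_conj]

lemma measurable_normalizedL_mul_exp (z : ℂ) :
    Measurable fun y : ℝ => (normalizedL y : ℂ) * Complex.exp (-z * y) :=
  (Complex.measurable_ofReal.comp measurable_normalizedL).mul (by fun_prop)

lemma norm_normalizedL_mul_exp_le (z : ℂ) (y : ℝ) :
    ‖(normalizedL y : ℂ) * Complex.exp (-z * y)‖ ≤ Real.exp (-(z.re - 1 / 2) * y) := by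
  rw [norm_mul, Complex.norm_real, Complex.norm_exp, Real.norm_eq_abs]
  calc |normalizedL y| * _ ≤ Real.exp (y / 2) * Real.exp ((-z * y : ℂ).re) := by
        gcongr; exact abs_normalizedL_le y
    _ = _ := by rw [← Real.exp_add]; congr 1; simp; ring

lemma integrableOn_normalizedL_mul_exp {z : ℂ} (hz : 1 / 2 < z.re) :
    IntegrableOn (fun y : ℝ => (normalizedL y : ℂ) * Complex.exp (-z * y)) (Set.Ioi 0) :=
  (exp_neg_integrableOn_Ioi 0 (sub_pos.2 hz)).mono'
    (measurable_normalizedL_mul_exp z).aestronglyMeasurable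
    (.of_forall fun y => norm_normalizedL_mul_exp_le z y)

lemma norm_normalizedL_mul_exp_sq (x y : ℝ) :
    ‖(normalizedL y : ℂ) * Complex.exp (-(x : ℂ) * y)‖ ^ 2 =
      normalizedL y ^ 2 * Real.exp (-(2 * x) * y) := by
  rw [norm_mul, Complex.norm_real, Complex.norm_exp, Real.norm_eq_abs, mul_pow, sq_abs, ← Real.exp_nat_mul]
  congr 2; simp; ring

lemma integrableOn_normalizedL_sq_mul_exp {x : ℝ} (hx : 1 / 2 < x) :
    IntegrableOn (fun y : ℝ => normalizedL y ^ 2 * Real.exp (-(2 * x) * y)) (Set.Ioi 0) := by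
  refine (exp_neg_integrableOn_Ioi 0 (b := 2 * (x - 1 / 2)) (by linarith)).mono'
    ((measurable_normalizedL.pow_const 2).mul (by fun_prop)).aestronglyMeasurable (.of_forall fun y => ?_)
  rw [← norm_normalizedL_mul_exp_sq, Real.norm_of_nonneg (by positivity)]
  calc _ ≤ Real.exp (-((x : ℂ).re - 1 / 2) * y) ^ 2 := by
        gcongr; exact norm_normalizedL_mul_exp_le x y
    _ = _ := by rw [← Real.exp_nat_mul]; congr 1; simp; ring

open scoped FourierTransform in
lemma integral_normalizedL_sq_mul_exp_of_half_lt {x : ℝ} (hx : 1 / 2 < x) :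
    ∫ y in Set.Ioi (0 : ℝ), normalizedL y ^ 2 * Real.exp (-(2 * x) * y) =
      (2 * Real.pi)⁻¹ * ∫ t : ℝ, ‖liouvilleTransform (x + t * Complex.I)‖ ^ 2 := by
  set g : ℝ → ℂ := (Set.Ioi (0 : ℝ)).indicator
    fun y => (normalizedL y : ℂ) * Complex.exp (-(x : ℂ) * y) with hg
  have hgsq : ∀ y, ‖g y‖ ^ 2 = (Set.Ioi (0 : ℝ)).indicator
      (fun y => normalizedL y ^ 2 * Real.exp (-(2 * x) * y)) y := by
    intro y
    by_cases hy : y ∈ Set.Ioi (0 : ℝ)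
    · simp only [hg, Set.indicator_of_mem hy, norm_normalizedL_mul_exp_sq]
    · simp [hg, Set.indicator_of_notMem hy]
  have h1 : Integrable g :=
    (integrable_indicator_iff measurableSet_Ioi).2 (integrableOn_normalizedL_mul_exp (by simpa using hx))
  have h2 : MemLp g 2 := by
    rw [memLp_two_iff_integrable_sq_norm h1.aestronglyMeasurable]
    simp only [hgsq]
    exact (integrable_indicator_iff measurableSet_Ioi).2 (integrableOn_normalizedL_sq_mul_exp hx)
  have hF : ∀ ξ : ℝ, 𝓕 g ξ = liouvilleTransform (x + (2 * Real.pi * ξ : ℝ) * Complex.I) := by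
    intro ξ
    rw [Real.fourier_real_eq_integral_exp_smul, liouvilleTransform_eq_integral (by simpa using hx),
      ← integral_indicator measurableSet_Ioi]
    refine integral_congr_ae (.of_forall fun y => ?_)
    by_cases hy : y ∈ Set.Ioi (0 : ℝ)
    · simp only [hg, Set.indicator_of_mem hy, smul_eq_mul]
      rw [mul_left_comm, ← Complex.exp_add]
      congr 2
      push_cast; ring
    · simp [hg, Set.indicator_of_notMem hy]
  have hP := integral_norm_fourier_sq h1 h2
  simp only [hgsq, hF] at hP
  rw [integral_indicator measurableSet_Ioi] at hP
  rw [← hP, Measure.integral_comp_mul_left (fun t : ℝ => ‖liouvilleTransform (x + t * Complex.I)‖ ^ 2),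
    abs_of_pos (by positivity), smul_eq_mul]

section
variable (hRH : ∀ ρ : ℂ, riemannZeta ρ = 0 → 0 < ρ.re → ρ.re < 1 → ρ.re = 1 / 2)
  (hsimple : ∀ ρ : ℂ, riemannZeta ρ = 0 → 0 < ρ.re → ρ.re < 1 → deriv riemannZeta ρ ≠ 0)
  (hsum : ∑' γ : zetaOrdinates, ENNReal.ofReal
    ((1 + |(γ : ℝ)|) ^ (-(7 / 5) : ℝ) / ‖deriv riemannZeta (1 / 2 + (γ : ℝ) * Complex.I)‖ ^ 2) ≠ ⊤)

include hRH hsimple hsum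

lemma differentiableOn_integral_liouvilleTransform_mul :
    DifferentiableOn ℂ (fun w : ℂ => ∫ t : ℝ, liouvilleTransform (w + t * Complex.I) *
      liouvilleTransform (w - t * Complex.I)) (Metric.ball (3 / 4) (3 / 4)) := by
  have hmem : ∀ w ∈ Metric.ball (3 / 4 : ℂ) (3 / 4), 0 < w.re ∧ w.re < 3 / 2 ∧ |w.im| < 3 / 4 := by
    intro w hw
    rw [Metric.mem_ball, dist_eq_norm] at hw
    have h1 := abs_lt.1 ((Complex.abs_re_le_norm _).trans_lt hw)
    have h2 := (Complex.abs_im_le_norm _).trans_lt hw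
    norm_num at h1 h2
    exact ⟨by linarith, by linarith, h2⟩
  have hd : ∀ t : ℝ, DifferentiableOn ℂ (fun w : ℂ => liouvilleTransform (w + t * Complex.I) *
      liouvilleTransform (w - t * Complex.I)) (Metric.ball (3 / 4) (3 / 4)) := by
    intro t w hw
    have hw0 := (hmem w hw).1
    exact (((differentiableAt_liouvilleTransform hRH (by simpa using hw0)).comp w (by fun_prop :
      DifferentiableAt ℂ (fun w : ℂ => w + t * Complex.I) w)).mul
      ((differentiableAt_liouvilleTransform hRH (by simpa using hw0)).comp w (by fun_prop :
      DifferentiableAt ℂ (fun w : ℂ => w - t * Complex.I) w))).differentiableWithinAt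
  refine differentiableOn_integral_of_dominated Metric.isOpen_ball hd (fun w hw => ?_) fun w hw => ?_
  · have hw0 := (hmem w hw).1
    refine Continuous.aestronglyMeasurable (continuous_iff_continuousAt.2 fun t => ?_)
    exact (ContinuousAt.comp (f := fun t : ℝ => (w + t * Complex.I : ℂ))
      (differentiableAt_liouvilleTransform hRH (by simpa using hw0)).continuousAt (by fun_prop)).mul
      (ContinuousAt.comp (f := fun t : ℝ => (w - t * Complex.I : ℂ))
      (differentiableAt_liouvilleTransform hRH (by simpa using hw0)).continuousAt (by fun_prop))
  · obtain ⟨ε₁, hε₁, hεU⟩ := Metric.isOpen_iff.1 Metric.isOpen_ball w hw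
    have hw0 := (hmem w hw).1
    obtain ⟨G, hG, hGb⟩ := exists_integrable_bound hRH hsimple hsum (half_pos hw0)
    refine ⟨min ε₁ (w.re / 2), by positivity, fun t => (G t + G (-t)) / 2,
      (hG.add hG.comp_neg).div_const 2, ?_⟩
    filter_upwards [hGb, (Measure.measurePreserving_neg (volume : Measure ℝ)).quasiMeasurePreserving.ae hGb]
      with t h1 h2 z hz
    have hzU := hmem z (hεU (Metric.ball_subset_ball (min_le_left _ _) hz))
    have hzr : w.re / 2 ≤ z.re := by
      have := (Metric.mem_ball.1 hz).trans_le (min_le_right _ _)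
      rw [dist_eq_norm] at this
      have := (abs_lt.1 ((Complex.abs_re_le_norm _).trans_lt this)).1
      rw [Complex.sub_re] at this
      linarith
    have a1 := h1 (z + t * Complex.I) (by simpa using hzr) (by simpa using hzU.2.1.le)
      (by simpa using hzU.2.2.le.trans (by norm_num))
    have a2 := h2 (z - t * Complex.I) (by simpa using hzr) (by simpa using hzU.2.1.le)
      (by simpa using hzU.2.2.le.trans (by norm_num))
    rw [norm_mul]
    nlinarith [sq_nonneg (‖liouvilleTransform (z + t * Complex.I)‖ - ‖liouvilleTransform (z - t * Complex.I)‖)]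

/-- The Plancherel identity for `normalizedL`, on all of `0 < x ≤ 3 / 4`. -/
lemma integral_normalizedL_sq_mul_exp {x : ℝ} (hx : 0 < x) (hx2 : x ≤ 3 / 4) :
    IntegrableOn (fun y : ℝ => normalizedL y ^ 2 * Real.exp (-(2 * x) * y)) (Set.Ioi 0) ∧
    ∫ y in Set.Ioi (0 : ℝ), normalizedL y ^ 2 * Real.exp (-(2 * x) * y) =
      (2 * Real.pi)⁻¹ * ∫ t : ℝ, ‖liouvilleTransform (x + t * Complex.I)‖ ^ 2 := by
  set w : ℝ → ENNReal := fun y => ENNReal.ofReal (normalizedL y ^ 2) with hw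
  have hwm : Measurable w := (measurable_normalizedL.pow_const 2).ennreal_ofReal
  have hwt : ∀ᵐ y ∂(volume.restrict (Set.Ioi (0 : ℝ))), w y < ⊤ := .of_forall fun y => ENNReal.ofReal_lt_top
  have hwr : ∀ y, (w y).toReal = normalizedL y ^ 2 := fun y => ENNReal.toReal_ofReal (sq_nonneg _)
  set μ := (volume.restrict (Set.Ioi (0 : ℝ))).withDensity w with hμ
  have hIntegr : ∀ s : ℝ, Integrable (fun y => Real.exp (s * y)) μ ↔
      IntegrableOn (fun y : ℝ => normalizedL y ^ 2 * Real.exp (s * y)) (Set.Ioi 0) := by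
    intro s
    rw [hμ, integrable_withDensity_iff_integrable_smul' hwm hwt]
    simp only [hwr, smul_eq_mul]; rfl
  have hval : ∀ s : ℝ, ∫ y, Real.exp (s * y) ∂μ =
      ∫ y in Set.Ioi (0 : ℝ), normalizedL y ^ 2 * Real.exp (s * y) := by
    intro s
    rw [hμ, integral_withDensity_eq_integral_toReal_smul hwm hwt]
    simp only [hwr, smul_eq_mul]
  set M : ℂ → ℂ := fun s => (2 * Real.pi : ℂ)⁻¹ * ∫ t : ℝ, liouvilleTransform (-s / 2 + t * Complex.I) *
      liouvilleTransform (-s / 2 - t * Complex.I) with hM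
  have hMr : ∀ x : ℝ, M ((-(2 * x) : ℝ) : ℂ) =
      (((2 * Real.pi)⁻¹ * ∫ t : ℝ, ‖liouvilleTransform (x + t * Complex.I)‖ ^ 2 : ℝ) : ℂ) := by
    intro x
    simp only [hM]
    push_cast
    rw [← integral_complex_ofReal]
    congr 1
    refine integral_congr_ae (.of_forall fun t => ?_)
    have e1 : -(-(2 * (x : ℂ))) / 2 = x := by ring
    have e2 : (x - t * Complex.I : ℂ) = starRingEnd ℂ (x + t * Complex.I) := by simp [sub_eq_add_neg]
    simp only [e1, e2, liouvilleTransform_conj, Complex.mul_conj, Complex.normSq_eq_norm_sq]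
  have hL := integrable_exp_of_extension (μ := μ) (X := id) (v := -(3 / 2)) (R := 3 / 2) (M := M)
    (h := 3 / 2 - 2 * x) ?_ (by norm_num) ?_ ?_ ?_ (by linarith) (by linarith)
  · have e : (-(3 / 2) + (3 / 2 - 2 * x) : ℝ) = -(2 * x) := by ring
    have e' : (((-(3 / 2) : ℝ) : ℂ) + ((3 / 2 - 2 * x : ℝ) : ℂ)) = ((-(2 * x) : ℝ) : ℂ) := by push_cast; ring
    rw [e, e'] at hL
    simp only [id] at hL
    rw [hIntegr, hval, hMr] at hL
    exact ⟨hL.1, Complex.ofReal_injective hL.2⟩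
  · rw [hμ]
    refine (withDensity_absolutelyContinuous _ _).ae_le ?_
    filter_upwards [ae_restrict_mem measurableSet_Ioi] with y hy using (Set.mem_Ioi.1 hy).le
  · refine mem_interior.2 ⟨Set.Iio (-1), fun s hs => ?_, isOpen_Iio, by norm_num⟩
    change Integrable (fun y => Real.exp (s * y)) μ
    rw [hIntegr]
    have := integrableOn_normalizedL_sq_mul_exp (x := -s / 2) (by linarith [Set.mem_Iio.1 hs])
    simpa [show -(2 * (-s / 2)) = s by ring] using this
  · refine DifferentiableOn.const_mul ?_ _
    refine (differentiableOn_integral_liouvilleTransform_mul hRH hsimple hsum).comp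
      (f := fun s : ℂ => -s / 2) (by fun_prop) fun s hs => ?_
    rw [Metric.mem_ball, dist_eq_norm] at hs ⊢
    rw [show -s / 2 - 3 / 4 = -(1 / 2) * (s - ((-(3 / 2) : ℝ) : ℂ)) by push_cast; ring, norm_mul]
    norm_num at hs ⊢
    linarith
  · filter_upwards [Iio_mem_nhds (show (-(3 / 2) : ℝ) < -1 by norm_num)] with s hs
    have e : s = -(2 * (-s / 2)) := by ring
    simp only [id]
    rw [hval]
    conv_lhs => rw [e]
    conv_rhs => rw [e]
    rw [hMr, integral_normalizedL_sq_mul_exp_of_half_lt (by linarith [Set.mem_Iio.1 hs])]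

end

section Karamata

variable {h : ℝ → ℝ} {A : ℝ}

lemma exp_neg_mul_mem_Icc {x y : ℝ} (hx : 0 < x) (hy : y ∈ Set.Ioi (0 : ℝ)) :
    Real.exp (-x * y) ∈ Set.Icc (0 : ℝ) 1 :=
  ⟨(Real.exp_pos _).le, Real.exp_le_one_iff.2 (by nlinarith [mul_pos hx (Set.mem_Ioi.1 hy)])⟩

lemma integrableOn_mul_exp_mul_comp_exp {x : ℝ} (hx : 0 < x)
    (hi : IntegrableOn (fun y => h y * Real.exp (-x * y)) (Set.Ioi 0)) {q : ℝ → ℝ} (hq : Continuous q) :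
    IntegrableOn (fun y => h y * Real.exp (-x * y) * q (Real.exp (-x * y))) (Set.Ioi 0) := by
  obtain ⟨C, hC⟩ := isCompact_Icc.exists_bound_of_continuousOn (s := Set.Icc (0 : ℝ) 1) hq.continuousOn
  refine Integrable.mul_bdd (c := C) hi (by fun_prop : Continuous _).aestronglyMeasurable ?_
  filter_upwards [ae_restrict_mem measurableSet_Ioi] with y hy
  exact hC _ (exp_neg_mul_mem_Icc hx hy)

lemma tendsto_mul_integral_exp_mul_polynomial
    (hi : ∀ x : ℝ, 0 < x → IntegrableOn (fun y => h y * Real.exp (-x * y)) (Set.Ioi 0))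
    (hlim : Tendsto (fun x : ℝ => x * ∫ y in Set.Ioi (0 : ℝ), h y * Real.exp (-x * y)) (𝓝[>] 0) (𝓝 A))
    (p : Polynomial ℝ) :
    Tendsto (fun x : ℝ => x * ∫ y in Set.Ioi (0 : ℝ), h y * Real.exp (-x * y) * p.eval (Real.exp (-x * y)))
      (𝓝[>] 0) (𝓝 (A * ∫ u in (0 : ℝ)..1, p.eval u)) := by
  induction p using Polynomial.induction_on' with
  | add p q hp hq =>
    have := hp.add hq
    rw [← mul_add, ← intervalIntegral.integral_add (p.continuous.intervalIntegrable _ _)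
      (q.continuous.intervalIntegrable _ _)] at this
    simp only [Polynomial.eval_add]
    refine this.congr' ?_
    filter_upwards [self_mem_nhdsWithin] with x hx
    rw [← mul_add, ← integral_add (integrableOn_mul_exp_mul_comp_exp hx (hi x hx) p.continuous)
      (integrableOn_mul_exp_mul_comp_exp hx (hi x hx) q.continuous)]
    simp only [mul_add]
  | monomial n c =>
    have ht : Tendsto (fun x : ℝ => (n + 1) * x) (𝓝[>] 0) (𝓝[>] 0) := by
      refine tendsto_nhdsWithin_iff.2 ⟨?_, ?_⟩
      · have : Tendsto (fun x : ℝ => (n + 1) * x) (𝓝 0) (𝓝 ((n + 1) * 0)) := tendsto_id.const_mul _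
        rw [mul_zero] at this
        exact this.mono_left nhdsWithin_le_nhds
      · filter_upwards [self_mem_nhdsWithin] with x hx
        have : (0 : ℝ) < x := hx
        exact Set.mem_Ioi.2 (by positivity)
    have h1 := (hlim.comp ht).const_mul (c / (n + 1))
    have hn : (n + 1 : ℝ) ≠ 0 := by positivity
    simp only [Polynomial.eval_monomial, intervalIntegral.integral_const_mul, integral_pow]
    convert! h1 using 1
    · ext x
      simp only [Function.comp]
      have : ∀ y, h y * Real.exp (-x * y) * (c * Real.exp (-x * y) ^ n) =
          c * (h y * Real.exp (-((n + 1) * x) * y)) := by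
        intro y
        rw [← Real.exp_nat_mul, show -((n + 1) * x) * y = -x * y + n * (-x * y) by ring, Real.exp_add]
        ring
      simp only [this, integral_const_mul]
      field_simp
    · congr 1
      simp
      ring

lemma tendsto_mul_integral_exp_mul_continuous (h0 : ∀ y, 0 ≤ h y)
    (hi : ∀ x : ℝ, 0 < x → IntegrableOn (fun y => h y * Real.exp (-x * y)) (Set.Ioi 0))
    (hlim : Tendsto (fun x : ℝ => x * ∫ y in Set.Ioi (0 : ℝ), h y * Real.exp (-x * y)) (𝓝[>] 0) (𝓝 A))
    {q : ℝ → ℝ} (hq : Continuous q) :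
    Tendsto (fun x : ℝ => x * ∫ y in Set.Ioi (0 : ℝ), h y * Real.exp (-x * y) * q (Real.exp (-x * y)))
      (𝓝[>] 0) (𝓝 (A * ∫ u in (0 : ℝ)..1, q u)) := by
  rw [Metric.tendsto_nhds]
  intro ε hε
  set η := ε / (3 * (|A| + 1)) with hη
  have hη0 : 0 < η := by positivity
  have hηA : η * (|A| + 1) = ε / 3 := by rw [hη]; field_simp
  obtain ⟨p, hp⟩ := exists_polynomial_near_of_continuousOn 0 1 q hq.continuousOn η hη0
  have h1 := Metric.tendsto_nhds.1 (tendsto_mul_integral_exp_mul_polynomial hi hlim p) (ε / 3) (by positivity)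
  have h2 := hlim.eventually (gt_mem_nhds (show A < |A| + 1 by linarith [le_abs_self A]))
  have h3 : |A * (∫ u in (0 : ℝ)..1, p.eval u) - A * ∫ u in (0 : ℝ)..1, q u| < ε / 3 := by
    rw [← mul_sub, ← intervalIntegral.integral_sub (p.continuous.intervalIntegrable _ _)
      (hq.intervalIntegrable _ _), abs_mul]
    have : |∫ u in (0 : ℝ)..1, (p.eval u - q u)| ≤ η := by
      have := intervalIntegral.norm_integral_le_of_norm_le_const (a := 0) (b := 1) (C := η)
        (f := fun u => p.eval u - q u) fun u hu => by
          rw [Set.uIoc_of_le zero_le_one] at hu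
          exact (hp u ⟨hu.1.le, hu.2⟩).le
      simpa using this
    nlinarith [abs_nonneg A]
  filter_upwards [h1, h2, self_mem_nhdsWithin] with x hx1 hx2 hx
  have hx0 : 0 < x := hx
  rw [Real.dist_eq] at hx1 ⊢
  have h4 : |x * (∫ y in Set.Ioi (0 : ℝ), h y * Real.exp (-x * y) * q (Real.exp (-x * y))) -
      x * ∫ y in Set.Ioi (0 : ℝ), h y * Real.exp (-x * y) * p.eval (Real.exp (-x * y))| < ε / 3 := by
    rw [← mul_sub, ← integral_sub (integrableOn_mul_exp_mul_comp_exp hx (hi x hx) hq)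
      (integrableOn_mul_exp_mul_comp_exp hx (hi x hx) p.continuous), abs_mul, abs_of_pos hx0]
    have : ‖∫ y in Set.Ioi (0 : ℝ), (h y * Real.exp (-x * y) * q (Real.exp (-x * y)) -
        h y * Real.exp (-x * y) * p.eval (Real.exp (-x * y)))‖ ≤
        ∫ y in Set.Ioi (0 : ℝ), h y * Real.exp (-x * y) * η := by
      refine norm_integral_le_of_norm_le ((hi x hx).mul_const _) ?_
      filter_upwards [ae_restrict_mem measurableSet_Ioi] with y hy
      have hpos : 0 ≤ h y * Real.exp (-x * y) := mul_nonneg (h0 y) (Real.exp_pos _).le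
      rw [← mul_sub, norm_mul, Real.norm_of_nonneg hpos, norm_sub_rev]
      exact mul_le_mul_of_nonneg_left (hp _ (exp_neg_mul_mem_Icc hx hy)).le hpos
    rw [integral_mul_const, Real.norm_eq_abs] at this
    calc _ ≤ x * ((∫ y in Set.Ioi (0 : ℝ), h y * Real.exp (-x * y)) * η) := by gcongr
      _ = η * (x * ∫ y in Set.Ioi (0 : ℝ), h y * Real.exp (-x * y)) := by ring
      _ < η * (|A| + 1) := by gcongr
      _ = ε / 3 := hηA
  rw [abs_lt] at *
  constructor <;> linarith [hx1.1, hx1.2, h3.1, h3.2, h4.1, h4.2]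

/-- A continuous function squeezed between `1_{u ≥ b} / u` and `1_{u ≥ a} / u`. -/
noncomputable def rampInv (a b u : ℝ) : ℝ := max 0 (min 1 ((u - a) / (b - a))) / max u a

lemma continuous_rampInv {a b : ℝ} (ha : 0 < a) : Continuous (rampInv a b) :=
  Continuous.div (by fun_prop) (by fun_prop) fun u => (lt_max_of_lt_right ha).ne'

lemma rampInv_nonneg {a b : ℝ} (ha : 0 < a) (u : ℝ) : 0 ≤ rampInv a b u :=
  div_nonneg (le_max_left _ _) (ha.le.trans (le_max_right _ _))

lemma rampInv_of_le {a b u : ℝ} (hab : a < b) (hu : u ≤ a) : rampInv a b u = 0 := by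
  have : (u - a) / (b - a) ≤ 0 := div_nonpos_of_nonpos_of_nonneg (by linarith) (by linarith)
  rw [rampInv, max_eq_left ((min_le_right _ _).trans this), zero_div]

lemma rampInv_of_ge {a b u : ℝ} (hab : a < b) (hu : b ≤ u) : rampInv a b u = u⁻¹ := by
  have : 1 ≤ (u - a) / (b - a) := by rw [le_div_iff₀ (by linarith)]; linarith
  rw [rampInv, min_eq_left this, max_eq_right zero_le_one, max_eq_left (by linarith), one_div]

lemma rampInv_le_inv {a b u : ℝ} (ha : 0 < a) (hu : a ≤ u) : rampInv a b u ≤ u⁻¹ := by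
  rw [rampInv, max_eq_left hu, ← one_div]
  exact div_le_div_of_nonneg_right (max_le zero_le_one (min_le_left _ _)) (ha.le.trans hu)

lemma integral_rampInv_le {a b : ℝ} (ha : 0 < a) (hab : a < b) (ha1 : a ≤ 1) :
    ∫ u in (0 : ℝ)..1, rampInv a b u ≤ -Real.log a := by
  have hc := continuous_rampInv (b := b) ha
  rw [← intervalIntegral.integral_add_adjacent_intervals (hc.intervalIntegrable 0 a) (hc.intervalIntegrable a 1)]
  have e : ∫ u in (0 : ℝ)..a, rampInv a b u = 0 := by
    rw [intervalIntegral.integral_congr (g := fun _ => 0) fun u hu => ?_]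
    · simp
    · rw [Set.uIcc_of_le ha.le] at hu
      exact rampInv_of_le hab hu.2
  rw [e, zero_add]
  have h2 : ∫ u in a..1, u⁻¹ = -Real.log a := by
    rw [integral_inv_of_pos ha one_pos, one_div, Real.log_inv]
  rw [← h2]
  refine intervalIntegral.integral_mono_on ha1 (hc.intervalIntegrable _ _) ?_ fun u hu => rampInv_le_inv ha hu.1
  refine intervalIntegral.intervalIntegrable_inv (fun u hu => ?_) continuousOn_id
  rw [Set.uIcc_of_le ha1] at hu
  exact (ha.trans_le hu.1).ne'

lemma le_integral_rampInv {a b : ℝ} (ha : 0 < a) (hab : a < b) (hb1 : b ≤ 1) :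
    -Real.log b ≤ ∫ u in (0 : ℝ)..1, rampInv a b u := by
  have hc := continuous_rampInv (b := b) ha
  have hb : 0 < b := ha.trans hab
  rw [← intervalIntegral.integral_add_adjacent_intervals (hc.intervalIntegrable 0 b) (hc.intervalIntegrable b 1)]
  have h2 : ∫ u in b..1, rampInv a b u = -Real.log b := by
    rw [intervalIntegral.integral_congr (g := fun u => u⁻¹) fun u hu => ?_,
      integral_inv_of_pos hb one_pos, one_div, Real.log_inv]
    rw [Set.uIcc_of_le hb1] at hu
    exact rampInv_of_ge hab hu.1
  rw [h2, le_add_iff_nonneg_left]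
  exact intervalIntegral.integral_nonneg hb.le fun u _ => rampInv_nonneg ha u

lemma integrableOn_Ioc_of_integrableOn_mul_exp
    (hi : ∀ x : ℝ, 0 < x → IntegrableOn (fun y => h y * Real.exp (-x * y)) (Set.Ioi 0)) (Y : ℝ) :
    IntegrableOn h (Set.Ioc 0 Y) := by
  have h1 : IntegrableOn (fun y => h y * Real.exp (-1 * y)) (Set.Icc 0 Y) :=
    (integrableOn_Icc_iff_integrableOn_Ioc).2 ((hi 1 one_pos).mono_set Set.Ioc_subset_Ioi_self)
  have h2 := h1.mul_continuousOn (g' := fun y : ℝ => Real.exp y) (by fun_prop) isCompact_Icc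
  refine (h2.mono_set Set.Ioc_subset_Icc_self).congr (.of_forall fun y => ?_)
  simp only
  rw [mul_assoc, ← Real.exp_add]; simp

lemma integral_Ioc_le_integral_rampInv (h0 : ∀ y, 0 ≤ h y)
    (hi : ∀ x : ℝ, 0 < x → IntegrableOn (fun y => h y * Real.exp (-x * y)) (Set.Ioi 0))
    {x c c' : ℝ} (hx : 0 < x) (hcc : c' < c) :
    ∫ y in Set.Ioc 0 (c' / x), h y ≤ ∫ y in Set.Ioi (0 : ℝ), h y * Real.exp (-x * y) *
      rampInv (Real.exp (-c)) (Real.exp (-c')) (Real.exp (-x * y)) := by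
  have hI := integrableOn_mul_exp_mul_comp_exp hx (hi x hx)
    (continuous_rampInv (b := Real.exp (-c')) (Real.exp_pos (-c)))
  rw [← integral_indicator measurableSet_Ioc, ← integral_indicator measurableSet_Ioi]
  refine integral_mono ((integrable_indicator_iff measurableSet_Ioc).2
    (integrableOn_Ioc_of_integrableOn_mul_exp hi _)) ((integrable_indicator_iff measurableSet_Ioi).2 hI) fun y => ?_
  by_cases hy : y ∈ Set.Ioc 0 (c' / x)
  · rw [Set.indicator_of_mem hy, Set.indicator_of_mem (Set.mem_Ioi.2 hy.1),
      rampInv_of_ge (Real.exp_lt_exp.2 (by linarith)), mul_assoc, mul_inv_cancel₀ (Real.exp_pos _).ne', mul_one]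
    rw [Real.exp_le_exp]
    have := (le_div_iff₀ hx).1 hy.2
    linarith
  · rw [Set.indicator_of_notMem hy]
    exact Set.indicator_nonneg (fun y _ => mul_nonneg (mul_nonneg (h0 y) (Real.exp_pos _).le)
      (rampInv_nonneg (Real.exp_pos _) _)) y

lemma integral_rampInv_le_integral_Ioc (h0 : ∀ y, 0 ≤ h y)
    (hi : ∀ x : ℝ, 0 < x → IntegrableOn (fun y => h y * Real.exp (-x * y)) (Set.Ioi 0))
    {x c c' : ℝ} (hx : 0 < x) (hcc : c' < c) :
    ∫ y in Set.Ioi (0 : ℝ), h y * Real.exp (-x * y) *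
      rampInv (Real.exp (-c)) (Real.exp (-c')) (Real.exp (-x * y)) ≤ ∫ y in Set.Ioc 0 (c / x), h y := by
  have hI := integrableOn_mul_exp_mul_comp_exp hx (hi x hx)
    (continuous_rampInv (b := Real.exp (-c')) (Real.exp_pos (-c)))
  rw [← integral_indicator measurableSet_Ioc, ← integral_indicator measurableSet_Ioi]
  refine integral_mono ((integrable_indicator_iff measurableSet_Ioi).2 hI) ((integrable_indicator_iff
    measurableSet_Ioc).2 (integrableOn_Ioc_of_integrableOn_mul_exp hi _)) fun y => ?_
  by_cases hy0 : y ∈ Set.Ioi (0 : ℝ)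
  swap
  · rw [Set.indicator_of_notMem hy0, Set.indicator_of_notMem fun hy => hy0 (Set.mem_Ioi.2 hy.1)]
  rw [Set.indicator_of_mem hy0]
  by_cases hy : y ≤ c / x
  · rw [Set.indicator_of_mem (show y ∈ Set.Ioc 0 (c / x) from ⟨hy0, hy⟩)]
    have hle := rampInv_le_inv (b := Real.exp (-c')) (u := Real.exp (-x * y)) (Real.exp_pos (-c))
      (Real.exp_le_exp.2 (by have := (le_div_iff₀ hx).1 hy; linarith))
    calc _ ≤ h y * Real.exp (-x * y) * (Real.exp (-x * y))⁻¹ :=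
          mul_le_mul_of_nonneg_left hle (mul_nonneg (h0 y) (Real.exp_pos _).le)
      _ = h y := by rw [mul_assoc, mul_inv_cancel₀ (Real.exp_pos _).ne', mul_one]
  · rw [Set.indicator_of_notMem fun h' => hy h'.2, rampInv_of_le (Real.exp_lt_exp.2 (by linarith)), mul_zero]
    rw [Real.exp_le_exp]
    have := (div_lt_iff₀ hx).1 (not_le.1 hy)
    linarith

/-- **Karamata's Tauberian theorem** for Laplace transforms of nonnegative functions. -/
theorem tendsto_average_of_tendsto_laplace (h0 : ∀ y, 0 ≤ h y)
    (hi : ∀ x : ℝ, 0 < x → IntegrableOn (fun y => h y * Real.exp (-x * y)) (Set.Ioi 0))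
    (hlim : Tendsto (fun x : ℝ => x * ∫ y in Set.Ioi (0 : ℝ), h y * Real.exp (-x * y)) (𝓝[>] 0) (𝓝 A)) :
    Tendsto (fun Y : ℝ => (1 / Y) * ∫ y in (0 : ℝ)..Y, h y) atTop (𝓝 A) := by
  have hA : 0 ≤ A := by
    refine ge_of_tendsto hlim ?_
    filter_upwards [self_mem_nhdsWithin] with x hx
    exact mul_nonneg (Set.mem_Ioi.1 hx).le
      (integral_nonneg fun y => mul_nonneg (h0 y) (Real.exp_pos _).le)
  suffices hS : Tendsto (fun x : ℝ => x * ∫ y in Set.Ioc 0 (1 / x), h y) (𝓝[>] 0) (𝓝 A) by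
    refine (hS.comp tendsto_inv_atTop_nhdsGT_zero).congr' ?_
    filter_upwards [eventually_gt_atTop 0] with Y hY
    simp only [Function.comp, one_div, inv_inv]
    rw [intervalIntegral.integral_of_le hY.le]
  rw [tendsto_order]
  constructor
  · intro a ha
    obtain ⟨c, hc, hc0, hc1⟩ : ∃ c : ℝ, a < A * c ∧ 0 < c ∧ c < 1 := by
      have ht : Tendsto (fun c : ℝ => A * c) (𝓝[<] 1) (𝓝 (A * 1)) :=
        (tendsto_id.const_mul A).mono_left nhdsWithin_le_nhds
      rw [mul_one] at ht
      obtain ⟨c, h1, h2⟩ := ((ht.eventually (lt_mem_nhds ha)).and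
        (Ioo_mem_nhdsLT (show (0 : ℝ) < 1 by norm_num))).exists
      exact ⟨c, h1, h2.1, h2.2⟩
    have hle := le_integral_rampInv (Real.exp_pos (-1)) (Real.exp_lt_exp.2 (neg_lt_neg hc1))
      (Real.exp_le_one_iff.2 (by linarith : -c ≤ 0))
    rw [Real.log_exp, neg_neg] at hle
    have ht := tendsto_mul_integral_exp_mul_continuous h0 hi hlim
      (continuous_rampInv (b := Real.exp (-c)) (Real.exp_pos (-1)))
    filter_upwards [ht.eventually (lt_mem_nhds (hc.trans_le (mul_le_mul_of_nonneg_left hle hA))),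
      self_mem_nhdsWithin] with x hx hx0
    exact hx.trans_le (mul_le_mul_of_nonneg_left (integral_rampInv_le_integral_Ioc h0 hi hx0 hc1)
      (Set.mem_Ioi.1 hx0).le)
  · intro a ha
    obtain ⟨c, hc, hc1⟩ : ∃ c : ℝ, A * c < a ∧ 1 < c := by
      have ht : Tendsto (fun c : ℝ => A * c) (𝓝[>] 1) (𝓝 (A * 1)) :=
        (tendsto_id.const_mul A).mono_left nhdsWithin_le_nhds
      rw [mul_one] at ht
      exact ((ht.eventually (gt_mem_nhds ha)).and self_mem_nhdsWithin).exists
    have hle := integral_rampInv_le (Real.exp_pos (-c)) (Real.exp_lt_exp.2 (neg_lt_neg hc1))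
      (Real.exp_le_one_iff.2 (by linarith : -c ≤ 0))
    rw [Real.log_exp, neg_neg] at hle
    have ht := tendsto_mul_integral_exp_mul_continuous h0 hi hlim
      (continuous_rampInv (b := Real.exp (-1)) (Real.exp_pos (-c)))
    filter_upwards [ht.eventually (gt_mem_nhds ((mul_le_mul_of_nonneg_left hle hA).trans_lt hc)),
      self_mem_nhdsWithin] with x hx hx0
    exact (mul_le_mul_of_nonneg_left (integral_Ioc_le_integral_rampInv h0 hi hx0 hc1)
      (Set.mem_Ioi.1 hx0).le).trans_lt hx

end Karamata

lemma residueSq_neg (hsimple : ∀ ρ : ℂ, riemannZeta ρ = 0 → 0 < ρ.re → ρ.re < 1 → deriv riemannZeta ρ ≠ 0)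
    {γ : ℝ} (hγ : γ ∈ zetaOrdinates) : residueSq (-γ) = residueSq γ := by
  have e : (1 / 2 : ℂ) + (-γ : ℝ) * Complex.I = (starRingEnd ℂ) (1 / 2 + γ * Complex.I) := by
    apply Complex.ext <;> simp
  rw [residueSq_ordinate hsimple hγ, residueSq_ordinate hsimple (neg_mem_zetaOrdinates hγ), e,
    deriv_riemannZeta_conj, ← map_mul, show (2 : ℂ) * (starRingEnd ℂ) (1 / 2 + γ * Complex.I) =
      (starRingEnd ℂ) (2 * (1 / 2 + γ * Complex.I)) by rw [map_mul, map_ofNat], riemannZeta_conj, ← map_div₀, RCLike.norm_conj]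

lemma tsum_insert_zero_of_even {f : ℝ → ℝ} {Z : Set ℝ} (h0 : ∀ γ ∈ Z, γ ≠ 0)
    (hneg : ∀ γ ∈ Z, -γ ∈ Z) (hf : ∀ γ ∈ Z, f (-γ) = f γ)
    (hs : Summable fun γ : (insert 0 Z : Set ℝ) => f γ) :
    ∑' γ : (insert 0 Z : Set ℝ), f γ = f 0 + 2 * ∑' γ : {γ : ℝ | 0 < γ ∧ γ ∈ Z}, f γ := by
  set P : Set ℝ := {γ | 0 < γ ∧ γ ∈ Z} with hP
  set N : Set ℝ := {γ | γ < 0 ∧ γ ∈ Z} with hN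
  have hsub : ∀ s : Set ℝ, s ⊆ insert 0 Z → Summable fun γ : s => f γ := fun s h =>
    hs.comp_injective (Set.inclusion_injective h)
  have hu : insert 0 Z = {0} ∪ (P ∪ N) := by
    ext γ
    constructor
    · rintro (h | h)
      · exact .inl h
      · rcases lt_or_gt_of_ne (h0 γ h) with h' | h'
        · exact .inr (.inr ⟨h', h⟩)
        · exact .inr (.inl ⟨h', h⟩)
    · rintro (h | h | h)
      exacts [.inl h, .inr h.2, .inr h.2]
  have h0 : Disjoint ({0} : Set ℝ) (P ∪ N) := by
    rw [Set.disjoint_singleton_left]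
    rintro (h | h) <;> exact absurd h.1 (lt_irrefl _)
  have hPN : Disjoint P N := Set.disjoint_left.2 fun γ h h' => lt_asymm h.1 h'.1
  have hsP : P ⊆ insert 0 Z := fun γ h => .inr h.2
  have hsN : N ⊆ insert 0 Z := fun γ h => .inr h.2
  have eN : ∑' γ : N, f γ = ∑' γ : P, f γ := by
    let e : P ≃ N :=
      { toFun := fun γ => ⟨-γ, neg_lt_zero.2 γ.2.1, hneg _ γ.2.2⟩
        invFun := fun γ => ⟨-γ, neg_pos.2 γ.2.1, hneg _ γ.2.2⟩
        left_inv := fun γ => Subtype.ext (neg_neg _)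
        right_inv := fun γ => Subtype.ext (neg_neg _) }
    rw [← e.tsum_eq]
    exact tsum_congr fun γ => hf _ γ.2.2
  rw [tsum_congr_set_coe f hu, Summable.tsum_union_disjoint h0
    (hsub _ (Set.singleton_subset_iff.2 (Set.mem_insert _ _))) (hsub _ (Set.union_subset hsP hsN)),
    Summable.tsum_union_disjoint hPN (hsub _ hsP) (hsub _ hsN), tsum_singleton, eN, ← two_mul]

lemma norm_one_div_riemannZeta_one_half_sq :
    ‖1 / riemannZeta (1 / 2)‖ ^ 2 = 1 / (riemannZeta (1 / 2 : ℂ)).re ^ 2 := by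
  have hc : (starRingEnd ℂ) (riemannZeta (1 / 2)) = riemannZeta (1 / 2) := by
    rw [← riemannZeta_conj, map_div₀, map_one, map_ofNat]
  rw [norm_div, norm_one, div_pow, one_pow, ← Complex.normSq_eq_norm_sq, Complex.normSq_apply,
    Complex.conj_eq_iff_im.1 hc]
  ring

lemma tsum_residueSq
    (hsimple : ∀ ρ : ℂ, riemannZeta ρ = 0 → 0 < ρ.re → ρ.re < 1 → deriv riemannZeta ρ ≠ 0)
    (hs : Summable fun γ : poleOrdinates => residueSq γ) :
    ∑' γ : poleOrdinates, residueSq γ = 1 / (riemannZeta (1 / 2 : ℂ)).re ^ 2 +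
        ∑' γ : {γ : ℝ // 0 < γ ∧ riemannZeta (1 / 2 + γ * Complex.I) = 0},
          2 * ‖riemannZeta (2 * ((1 / 2 : ℂ) + (γ : ℝ) * Complex.I)) /
            (((1 / 2 : ℂ) + (γ : ℝ) * Complex.I) *
              deriv riemannZeta (1 / 2 + (γ : ℝ) * Complex.I))‖ ^ 2 := by
  have h := tsum_insert_zero_of_even (f := residueSq) (Z := zetaOrdinates)
    (fun γ hγ => riemannZeta_ordinate_ne_zero hγ hsimple) (fun γ => neg_mem_zetaOrdinates)
    (fun γ => residueSq_neg hsimple) hs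
  refine h.trans ?_
  rw [residueSq_zero, norm_one_div_riemannZeta_one_half_sq, ← tsum_mul_left]
  exact congrArg _ (tsum_congr fun γ => congrArg (2 * ·) (residueSq_ordinate hsimple γ.2.2))

theorem statement14
    (hRH : ∀ ρ : ℂ, riemannZeta ρ = 0 → 0 < ρ.re → ρ.re < 1 → ρ.re = 1 / 2)
    (hsimple : ∀ ρ : ℂ, riemannZeta ρ = 0 → 0 < ρ.re → ρ.re < 1 →
      deriv riemannZeta ρ ≠ 0)
    (θ C : ℝ) (hθ1 : 1 ≤ θ) (hθ2 : θ < 3 - Real.sqrt 3)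
    (hJ : ∀ T : ℝ, 1 ≤ T →
      (∑' γ : {γ : ℝ // 0 < γ ∧ γ ≤ T ∧ riemannZeta (1 / 2 + γ * Complex.I) = 0},
        1 / ‖deriv riemannZeta (1 / 2 + (γ : ℝ) * Complex.I)‖ ^ 2) ≤ C * T ^ θ) :
    Tendsto (fun Y : ℝ => (1 / Y) * ∫ y in (0:ℝ)..Y,
        (Lfun (Real.exp y) / Real.exp (y / 2)) ^ 2) atTop
      (𝓝 (1 / (riemannZeta (1 / 2 : ℂ)).re ^ 2 +
        ∑' γ : {γ : ℝ // 0 < γ ∧ riemannZeta (1 / 2 + γ * Complex.I) = 0},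
          2 * ‖riemannZeta (2 * ((1 / 2 : ℂ) + (γ : ℝ) * Complex.I)) /
            (((1 / 2 : ℂ) + (γ : ℝ) * Complex.I) *
              deriv riemannZeta (1 / 2 + (γ : ℝ) * Complex.I))‖ ^ 2)) := by
  have hθ : θ < 7 / 5 := by
    have : (8 / 5 : ℝ) < Real.sqrt 3 := Real.lt_sqrt_of_sq_lt (by norm_num)
    linarith
  have hsum := tsum_rpow_div_deriv_sq_ne_top hsimple hθ hJ
  obtain ⟨hs, hlim⟩ := tendsto_mul_integral_liouvilleTransform hRH hsimple hsum
  rw [← tsum_residueSq hsimple hs]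
  have hdiv : Tendsto (fun x : ℝ => x / 2) (𝓝[>] 0) (𝓝[>] 0) := by
    refine tendsto_nhdsWithin_iff.2 ⟨?_, ?_⟩
    · have : Tendsto (fun x : ℝ => x / 2) (𝓝 0) (𝓝 (0 / 2)) := tendsto_id.div_const 2
      rw [zero_div] at this
      exact this.mono_left nhdsWithin_le_nhds
    · filter_upwards [self_mem_nhdsWithin] with x hx using half_pos (Set.mem_Ioi.1 hx)
  have hI : ∀ x : ℝ, 0 < x → x ≤ 3 / 2 →
      IntegrableOn (fun y : ℝ => normalizedL y ^ 2 * Real.exp (-x * y)) (Set.Ioi 0) ∧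
      ∫ y in Set.Ioi (0 : ℝ), normalizedL y ^ 2 * Real.exp (-x * y) =
        (2 * Real.pi)⁻¹ * ∫ t : ℝ, ‖liouvilleTransform ((x / 2 : ℝ) + t * Complex.I)‖ ^ 2 := by
    intro x hx hx2
    have := integral_normalizedL_sq_mul_exp hRH hsimple hsum (half_pos hx) (by linarith)
    rwa [mul_div_cancel₀ x two_ne_zero] at this
  refine tendsto_average_of_tendsto_laplace (h := fun y => normalizedL y ^ 2) (fun y => sq_nonneg _)
    (fun x hx => ?_) ?_
  · rcases le_or_gt x (3 / 2) with h | h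
    · exact (hI x hx h).1
    · refine (hI (3 / 2) (by norm_num) le_rfl).1.mono'
        ((measurable_normalizedL.pow_const 2).mul (by fun_prop)).aestronglyMeasurable ?_
      filter_upwards [ae_restrict_mem measurableSet_Ioi] with y hy
      rw [Real.norm_of_nonneg (by positivity)]
      gcongr
      exact (Set.mem_Ioi.1 hy).le
  · have h2 := ((hlim.comp hdiv).const_mul Real.pi⁻¹)
    rw [inv_mul_cancel_left₀ Real.pi_ne_zero] at h2
    refine h2.congr' ?_
    filter_upwards [Ioc_mem_nhdsGT (show (0 : ℝ) < 3 / 2 by norm_num)] with x hx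
    rw [(hI x hx.1 hx.2).2]
    simp only [Function.comp, integral_const_mul]
    rw [mul_inv]
    ring
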